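/- Global Harnack principle: let m ∈ (m_s, 1) and let u be a radial energy solution of the fast diffusion equation with exponent m and extinction time T > 0. Then for every ε ∈ (0,T) there exist constants c₁ > 0 and c₂ > 0 such that c₁ (1 − t/T)^{1/(1−m)} e^{−(N−1)r/m} ≤ u(r,t) ≤ c₂ (1 − t/T)^{1/(1−m)} e^{−(N−1)r/m} for all r ≥ 0 and all t ∈ [ε, T). -/

import Mathlib

open MeasureTheory Set Filter Topology

/-- Membership in the radial energy space `H¹_rad` on hyperbolic space `ℍ^N`:
`v` is locally absolutely continuous on `(0,∞)` (expressed via the fundamental theorem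
of calculus for its a.e. derivative) and both `v` and `v'` are square-integrable with
respect to the weight `(sinh s)^(N-1)`. -/
def MemH1rad (N : ℕ) (v : ℝ → ℝ) : Prop :=
  (∀ a b : ℝ, 0 < a → a ≤ b → v b - v a = ∫ s in a..b, deriv v s) ∧
  MeasureTheory.IntegrableOn (fun s => (v s) ^ 2 * Real.sinh s ^ (N - 1)) (Set.Ioi 0) ∧
  MeasureTheory.IntegrableOn (fun s => (deriv v s) ^ 2 * Real.sinh s ^ (N - 1)) (Set.Ioi 0)

/-- The squared `H¹` norm `‖v‖_2² + ‖v'‖_2²` with weight `(sinh s)^(N-1)`. -/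
noncomputable def H1normSq (N : ℕ) (v : ℝ → ℝ) : ℝ :=
  (∫ s in Set.Ioi (0:ℝ), (v s) ^ 2 * Real.sinh s ^ (N - 1)) +
  (∫ s in Set.Ioi (0:ℝ), (deriv v s) ^ 2 * Real.sinh s ^ (N - 1))

/-- A radial energy solution of the fast diffusion equation `u_t = Δ(u^m)` on `ℍ^N`,
with exponent `m`, extinction time `T` (initial datum `u(·,0)`). -/
structure IsRadialEnergySolution (N : ℕ) (m T : ℝ) (u : ℝ → ℝ → ℝ) : Prop where
  continuousOn : ContinuousOn (fun p : ℝ × ℝ => u p.1 p.2) (Set.Ici 0 ×ˢ Set.Icc 0 T)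
  nonneg : ∀ r ∈ Set.Ici (0:ℝ), ∀ t ∈ Set.Icc (0:ℝ) T, 0 ≤ u r t
  smooth : ContDiffOn ℝ (⊤ : ℕ∞) (fun p : ℝ × ℝ => u p.1 p.2) (Set.Ici 0 ×ˢ Set.Ioo 0 T)
  pos : ∀ r ∈ Set.Ici (0:ℝ), ∀ t ∈ Set.Ioo (0:ℝ) T, 0 < u r t
  pde : ∀ r > (0:ℝ), ∀ t ∈ Set.Ioo (0:ℝ) T,
    deriv (fun τ => u r τ) t
      = deriv (deriv (fun ρ => u ρ t ^ m)) r
        + ((N : ℝ) - 1) * (Real.cosh r / Real.sinh r) * deriv (fun ρ => u ρ t ^ m) r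
  neumann : ∀ t ∈ Set.Ioo (0:ℝ) T, deriv (fun ρ => u ρ t ^ m) 0 = 0
  extinction : ∀ r ∈ Set.Ici (0:ℝ), u r T = 0
  energy : ∀ t ∈ Set.Ioo (0:ℝ) T, MemH1rad N (fun ρ => u ρ t ^ m)
  energy_bdd : ∀ ε ∈ Set.Ioo (0:ℝ) T, ∃ C : ℝ, ∀ t ∈ Set.Ico ε T,
    H1normSq N (fun ρ => u ρ t ^ m) ≤ C
  init_bdd : ∃ M : ℝ, ∀ r ∈ Set.Ici (0:ℝ), u r 0 ≤ M
  init_nonzero : ∃ r ∈ Set.Ici (0:ℝ), u r 0 ≠ 0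
  init_energy : MemH1rad N (fun ρ => u ρ 0 ^ m)

open MeasureTheory Set Filter Topology

namespace GHP

/-- Bundle of regularity facts. -/
structure Sol (n : ℕ) (m : ℝ) (J : Set ℝ) (u wr ut : ℝ → ℝ → ℝ) : Prop where
  cu : ContinuousOn (fun p : ℝ × ℝ => u p.1 p.2) (Set.Ici 0 ×ˢ J)
  cwr : ContinuousOn (fun p : ℝ × ℝ => wr p.1 p.2) (Set.Ici 0 ×ˢ J)
  cut : ContinuousOn (fun p : ℝ × ℝ => ut p.1 p.2) (Set.Ici 0 ×ˢ J)
  pos : ∀ r, 0 ≤ r → ∀ t ∈ J, 0 < u r t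
  dw : ∀ r, 0 < r → ∀ t ∈ J, HasDerivAt (fun ρ => u ρ t ^ m) (wr r t) r
  dt : ∀ r, 0 ≤ r → ∀ t ∈ J, HasDerivAt (fun τ => u r τ) (ut r t) t
  da : ∀ r, 0 < r → ∀ t ∈ J,
    HasDerivAt (fun ρ => Real.sinh ρ ^ n * wr ρ t) (Real.sinh r ^ n * ut r t) r

theorem exists_sol (n : ℕ) (hn : 1 ≤ n) (m T : ℝ) (u : ℝ → ℝ → ℝ)
    (hu : IsRadialEnergySolution (n+1) m T u) :
    ∃ wr ut, Sol n m (Ioo 0 T) u wr ut := by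
  set f : ℝ × ℝ → ℝ := fun p => u p.1 p.2 with hf
  set g : ℝ × ℝ → ℝ := fun p => u p.1 p.2 ^ m with hg
  set S : Set (ℝ × ℝ) := Ici (0:ℝ) ×ˢ Ioo (0:ℝ) T with hS
  have hSu : UniqueDiffOn ℝ S := (uniqueDiffOn_Ici 0).prod isOpen_Ioo.uniqueDiffOn
  have hfs : ContDiffOn ℝ (⊤ : ℕ∞) f S := hu.smooth
  have hgs : ContDiffOn ℝ (⊤ : ℕ∞) g S := by
    apply ContDiffOn.rpow_const_of_ne hfs
    rintro ⟨r, t⟩ ⟨h1, h2⟩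
    exact (hu.pos r h1 t h2).ne'
  have hnhds : ∀ r t, 0 < r → t ∈ Ioo 0 T → S ∈ 𝓝 (r, t) := by
    intro r t hr ht
    exact prod_mem_nhds (Ici_mem_nhds hr) (Ioo_mem_nhds ht.1 ht.2)
  have hg1 : ContDiffOn ℝ (⊤ : ℕ∞) (fun p => fderivWithin ℝ g S p (1,0)) S :=
    (hgs.fderivWithin hSu (by simp)).clm_apply contDiffOn_const
  have hf1 : ContDiffOn ℝ (⊤ : ℕ∞) (fun p => fderivWithin ℝ f S p (0,1)) S :=
    (hfs.fderivWithin hSu (by simp)).clm_apply contDiffOn_const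
  have hdw : ∀ r, 0 < r → ∀ t ∈ Ioo 0 T,
      HasDerivAt (fun ρ => u ρ t ^ m) (fderivWithin ℝ g S (r,t) (1,0)) r := by
    intro r hr t ht
    have h1 : HasFDerivAt g (fderivWithin ℝ g S (r,t)) (r,t) :=
      ((hgs.differentiableOn (by simp)) (r,t) ⟨hr.le, ht⟩).hasFDerivWithinAt.hasFDerivAt
        (hnhds r t hr ht)
    have h2 : HasDerivAt (fun ρ : ℝ => (ρ, t)) ((1:ℝ), (0:ℝ)) r :=
      (hasDerivAt_id r).prodMk (hasDerivAt_const r t)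
    exact h1.comp_hasDerivAt r h2
  refine ⟨fun r t => fderivWithin ℝ g S (r,t) (1,0), fun r t => fderivWithin ℝ f S (r,t) (0,1),
    ?_, ?_, ?_, ?_, ?_, ?_, ?_⟩
  · exact hfs.continuousOn
  · exact hg1.continuousOn
  · exact hf1.continuousOn
  · exact fun r hr t ht => hu.pos r hr t ht
  · exact hdw
  · intro r hr t ht
    have h1 : HasFDerivWithinAt f (fderivWithin ℝ f S (r,t)) S (r,t) :=
      ((hfs.differentiableOn (by simp)) (r,t) ⟨hr, ht⟩).hasFDerivWithinAt
    have h2 : HasDerivWithinAt (fun τ : ℝ => (r, τ)) ((0:ℝ), (1:ℝ)) (Ioo 0 T) t :=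
      ((hasDerivAt_const t r).prodMk (hasDerivAt_id t)).hasDerivWithinAt
    exact (h1.comp_hasDerivWithinAt t h2 (fun τ hτ => ⟨hr, hτ⟩)).hasDerivAt
      (Ioo_mem_nhds ht.1 ht.2)
  · intro r hr t ht
    have hut : deriv (fun τ => u r τ) t = fderivWithin ℝ f S (r,t) (0,1) := by
      have h1 : HasFDerivWithinAt f (fderivWithin ℝ f S (r,t)) S (r,t) :=
        ((hfs.differentiableOn (by simp)) (r,t) ⟨hr.le, ht⟩).hasFDerivWithinAt
      have h2 : HasDerivWithinAt (fun τ : ℝ => (r, τ)) ((0:ℝ), (1:ℝ)) (Ioo 0 T) t :=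
        ((hasDerivAt_const t r).prodMk (hasDerivAt_id t)).hasDerivWithinAt
      exact ((h1.comp_hasDerivWithinAt t h2 (fun τ hτ => ⟨hr.le, hτ⟩)).hasDerivAt
        (Ioo_mem_nhds ht.1 ht.2)).deriv
    have hd : DifferentiableAt ℝ (fun ρ => fderivWithin ℝ g S (ρ,t) (1,0)) r := by
      have h1 := ((hg1.differentiableOn (by simp)) (r,t) ⟨hr.le, ht⟩).differentiableAt
        (hnhds r t hr ht)
      have h2 : DifferentiableAt ℝ (fun ρ : ℝ => (ρ, t)) r := by fun_prop
      exact DifferentiableAt.comp r h1 h2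
    have heq : (deriv (fun ρ => u ρ t ^ m)) =ᶠ[𝓝 r]
        (fun ρ => fderivWithin ℝ g S (ρ,t) (1,0)) := by
      filter_upwards [lt_mem_nhds hr] with ρ hρ
      exact (hdw ρ hρ t ht).deriv
    have hp := hu.pde r hr t ht
    rw [hut, heq.deriv_eq, (hdw r hr t ht).deriv] at hp
    have hA : HasDerivAt (fun ρ => Real.sinh ρ ^ n) (n * Real.sinh r ^ (n-1) * Real.cosh r) r := by
      simpa using (Real.hasDerivAt_sinh r).fun_pow n
    refine (hA.fun_mul hd.hasDerivAt).congr_deriv ?_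
    rw [hp]
    have hs : Real.sinh r ≠ 0 := (Real.sinh_pos_iff.2 hr).ne'
    obtain ⟨k, rfl⟩ : ∃ k, n = k + 1 := ⟨n-1, by omega⟩
    push_cast
    try simp only [Nat.add_sub_cancel]
    field_simp
    ring

end GHP

open MeasureTheory Set Filter Topology

namespace GHP

theorem slice_r {f : ℝ → ℝ → ℝ} {J : Set ℝ}
    (hf : ContinuousOn (fun p : ℝ × ℝ => f p.1 p.2) (Set.Ici 0 ×ˢ J)) {t : ℝ} (ht : t ∈ J) :
    ContinuousOn (fun r => f r t) (Ici 0) :=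
  ContinuousOn.comp (g := fun p : ℝ × ℝ => f p.1 p.2) (f := fun r : ℝ => (r, t)) hf
    (by fun_prop) (fun x hx => ⟨hx, ht⟩)

theorem slice_t {f : ℝ → ℝ → ℝ} {J : Set ℝ}
    (hf : ContinuousOn (fun p : ℝ × ℝ => f p.1 p.2) (Set.Ici 0 ×ˢ J)) {r : ℝ} (hr : 0 ≤ r) :
    ContinuousOn (fun t => f r t) J :=
  ContinuousOn.comp (g := fun p : ℝ × ℝ => f p.1 p.2) (f := fun t : ℝ => (r, t)) hf
    (by fun_prop) (fun x hx => ⟨hr, hx⟩)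

theorem sinh_ge {r : ℝ} (hr : 1 ≤ r) : Real.exp r / 4 ≤ Real.sinh r := by
  rw [Real.sinh_eq]
  have h1 : (2:ℝ) ≤ Real.exp r := by
    have := Real.add_one_le_exp r; linarith
  have h2 : Real.exp (-r) ≤ 1 := Real.exp_le_one_iff.2 (by linarith)
  linarith

theorem sinh_mono_pow (n : ℕ) {a b : ℝ} (ha : 0 ≤ a) (hab : a ≤ b) :
    Real.sinh a ^ n ≤ Real.sinh b ^ n :=
  pow_le_pow_left₀ (Real.sinh_nonneg_iff.2 ha) (Real.sinh_le_sinh.2 hab) n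

theorem sinh_pow_pos (n : ℕ) {a : ℝ} (ha : 0 < a) : 0 < Real.sinh a ^ n :=
  pow_pos (Real.sinh_pos_iff.2 ha) n

theorem sinh_pow_nonneg (n : ℕ) {a : ℝ} (ha : 0 ≤ a) : 0 ≤ Real.sinh a ^ n :=
  pow_nonneg (Real.sinh_nonneg_iff.2 ha) n

theorem sinh_pow_ge (n : ℕ) {r : ℝ} (hr : 1 ≤ r) :
    Real.exp (n * r) / 4 ^ n ≤ Real.sinh r ^ n := by
  have := pow_le_pow_left₀ (by positivity) (sinh_ge hr) n
  rwa [div_pow, ← Real.exp_nat_mul] at this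

theorem sinh_pow_le (n : ℕ) {r : ℝ} (hr : 0 ≤ r) : Real.sinh r ^ n ≤ Real.exp (n * r) := by
  rw [Real.exp_nat_mul]
  refine pow_le_pow_left₀ (Real.sinh_nonneg_iff.2 hr) ?_ n
  rw [Real.sinh_eq]
  have := Real.exp_pos r; have := Real.exp_pos (-r)
  linarith

theorem decay_far (n : ℕ) (v v' : ℝ → ℝ) (C : ℝ)
    (hv : ∀ r, 0 < r → HasDerivAt v (v' r) r)
    (hvc : ContinuousOn v' (Ioi 0))
    (h1 : IntegrableOn (fun s => (v s) ^ 2 * Real.sinh s ^ n) (Ioi 0))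
    (h2 : IntegrableOn (fun s => (v' s) ^ 2 * Real.sinh s ^ n) (Ioi 0))
    (hC : (∫ s in Ioi (0:ℝ), (v s) ^ 2 * Real.sinh s ^ n) +
      (∫ s in Ioi (0:ℝ), (v' s) ^ 2 * Real.sinh s ^ n) ≤ C) (r : ℝ) (hr : 1 ≤ r) :
    v r ≤ (C / 2 + 4 ^ n) * Real.exp (-(n / 2 * r)) := by
  have hv0 : ContinuousOn v (Ioi 0) := fun x hx => (hv x hx).continuousAt.continuousWithinAt
  have hsub : Icc r (r+1) ⊆ Ioi (0:ℝ) := fun x hx => lt_of_lt_of_le (by linarith) hx.1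
  have hrr : r ≤ r + 1 := by linarith
  have hui : uIcc r (r+1) = Icc r (r+1) := uIcc_of_le hrr
  set L := Real.exp (-(n / 2 * r)) with hL
  have hLp : 0 < L := Real.exp_pos _
  have hLL : Real.exp (n * r) * L * L = 1 := by
    rw [hL, ← Real.exp_add, ← Real.exp_add, Real.exp_eq_one_iff]; ring
  -- integrability on the compact interval
  have iv : IntervalIntegrable v volume r (r+1) := by
    apply ContinuousOn.intervalIntegrable; rw [hui]; exact hv0.mono hsub
  have iv' : IntervalIntegrable (fun s => |v' s|) volume r (r+1) := by
    apply ContinuousOn.intervalIntegrable; rw [hui]; exact (hvc.mono hsub).abs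
  have iv'' : IntervalIntegrable v' volume r (r+1) := by
    apply ContinuousOn.intervalIntegrable; rw [hui]; exact (hvc.mono hsub)
  -- pointwise bound
  have key1 : ∀ b ∈ Icc r (r+1), v r - (∫ s in r..(r+1), |v' s|) ≤ v b := by
    intro b hb
    have e1 : ∫ s in r..b, v' s = v b - v r := by
      apply intervalIntegral.integral_eq_sub_of_hasDerivAt
      · intro x hx
        rw [uIcc_of_le hb.1] at hx
        exact hv x (lt_of_lt_of_le (by linarith) hx.1)
      · exact iv''.mono_set (by rw [hui, uIcc_of_le hb.1]; exact Icc_subset_Icc_right hb.2)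
    have e2 : |∫ s in r..b, v' s| ≤ ∫ s in r..b, |v' s| :=
      intervalIntegral.abs_integral_le_integral_abs hb.1
    have e3 : ∫ s in r..b, |v' s| ≤ ∫ s in r..(r+1), |v' s| := by
      apply intervalIntegral.integral_mono_interval le_rfl hb.1 hb.2 _ iv'
      exact Eventually.of_forall (fun x => abs_nonneg _)
    have e4 := neg_abs_le (∫ s in r..b, v' s)
    linarith
  have key2 : v r - (∫ s in r..(r+1), |v' s|) ≤ ∫ s in r..(r+1), v s := by
    have := intervalIntegral.integral_mono_on hrr (intervalIntegrable_const) iv key1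
    simpa using this
  have key3 : (∫ s in r..(r+1), v s) + (∫ s in r..(r+1), |v' s|) ≤
      ∫ s in r..(r+1), ((L / 2 * (v s ^ 2 * Real.sinh s ^ n) +
        L / 2 * (v' s ^ 2 * Real.sinh s ^ n)) + 4 ^ n * L) := by
    rw [← intervalIntegral.integral_add iv iv']
    apply intervalIntegral.integral_mono_on hrr (iv.add iv')
    · apply ContinuousOn.intervalIntegrable; rw [hui]
      have := hv0.mono hsub
      have := hvc.mono hsub
      have hs : Continuous Real.sinh := Real.continuous_sinh
      fun_prop
    · intro s hs
      have hA : Real.exp (n * r) / 4 ^ n ≤ Real.sinh s ^ n :=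
        (sinh_pow_ge n hr).trans (sinh_mono_pow n (by linarith) hs.1)
      have h4 : (0:ℝ) < 4 ^ n := by positivity
      set P := Real.sinh s ^ n with hP
      have hLP : 1 ≤ 4 ^ n * P * L * L := by
        rw [div_le_iff₀ h4] at hA
        calc (1:ℝ) = Real.exp (n*r) * L * L := hLL.symm
          _ ≤ (P * 4 ^ n) * L * L := by gcongr
          _ = _ := by ring
      have aux : ∀ x : ℝ, x ≤ L / 2 * (x ^ 2 * P) + 4 ^ n / 2 * L := by
        intro x
        have hP0 : 0 < P := sinh_pow_pos n (by linarith [hs.1])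
        have : 0 ≤ (x * L * P - 1) ^ 2 := sq_nonneg _
        have h5 : 2 * (x * (L * P)) ≤ x^2 * (L * P) * (L * P) + 1 := by nlinarith
        have h6 : 2 * (x * (L * P)) ≤ x^2 * (L * P) * (L * P) + (4^n * L) * (L * P) := by
          nlinarith
        have h7 : 2 * x ≤ x^2 * (L * P) + (4^n * L) := by
          have : 0 < L * P := by positivity
          nlinarith
        nlinarith
      have a1 := aux (v s)
      have a2 := aux |v' s|
      rw [sq_abs] at a2
      linarith
  have hsubI : Ioc r (r+1) ⊆ Ioi (0:ℝ) := fun x hx => lt_trans (by linarith) hx.1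
  have mono1 : ∀ f : ℝ → ℝ, IntegrableOn (fun s => (f s)^2 * Real.sinh s ^ n) (Ioi 0) →
      ∫ s in r..(r+1), (f s)^2 * Real.sinh s ^ n ≤ ∫ s in Ioi (0:ℝ), (f s)^2 * Real.sinh s ^ n := by
    intro f hf
    rw [intervalIntegral.integral_of_le hrr]
    apply setIntegral_mono_set hf
    · filter_upwards [ae_restrict_mem measurableSet_Ioi] with x hx
      exact mul_nonneg (sq_nonneg _) (sinh_pow_nonneg n (le_of_lt hx))
    · exact hsubI.eventuallyLE
  have key4 : ∫ s in r..(r+1), ((L / 2 * (v s ^ 2 * Real.sinh s ^ n) +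
        L / 2 * (v' s ^ 2 * Real.sinh s ^ n)) + 4 ^ n * L) =
      L / 2 * (∫ s in r..(r+1), v s ^ 2 * Real.sinh s ^ n) +
      L / 2 * (∫ s in r..(r+1), v' s ^ 2 * Real.sinh s ^ n) + 4 ^ n * L := by
    have i1 : IntervalIntegrable (fun s => v s ^ 2 * Real.sinh s ^ n) volume r (r+1) := by
      rw [intervalIntegrable_iff_integrableOn_Ioc_of_le hrr]; exact h1.mono_set hsubI
    have i2 : IntervalIntegrable (fun s => v' s ^ 2 * Real.sinh s ^ n) volume r (r+1) := by
      rw [intervalIntegrable_iff_integrableOn_Ioc_of_le hrr]; exact h2.mono_set hsubI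
    rw [intervalIntegral.integral_add ((i1.const_mul _).add (i2.const_mul _))
      intervalIntegrable_const, intervalIntegral.integral_add (i1.const_mul _) (i2.const_mul _),
      intervalIntegral.integral_const_mul, intervalIntegral.integral_const_mul]
    simp
  have m1 := mono1 v h1
  have m2 := mono1 v' h2
  have : L / 2 * ((∫ s in r..(r+1), v s ^ 2 * Real.sinh s ^ n) +
      (∫ s in r..(r+1), v' s ^ 2 * Real.sinh s ^ n)) ≤ L / 2 * C := by
    apply mul_le_mul_of_nonneg_left _ (by positivity); linarith
  nlinarith

theorem decay (n : ℕ) (m T : ℝ) (hm : 0 < m) (u wr ut : ℝ → ℝ → ℝ)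
    (hu : IsRadialEnergySolution (n+1) m T u) (hs : Sol n m (Ioo 0 T) u wr ut) :
    ∀ σ ∈ Ioo 0 T, ∃ C > 0, ∀ r, 0 ≤ r → ∀ t ∈ Ico σ T,
      u r t ^ m ≤ C * Real.exp (-(n / 2 * r)) := by
  intro σ hσ
  obtain ⟨C0, hC0⟩ := hu.energy_bdd σ hσ
  have hK : IsCompact (Icc (0:ℝ) 1 ×ˢ Icc σ T) := isCompact_Icc.prod isCompact_Icc
  have hc : ContinuousOn (fun p : ℝ × ℝ => u p.1 p.2 ^ m) (Icc (0:ℝ) 1 ×ˢ Icc σ T) := by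
    apply ContinuousOn.rpow_const
    · exact hu.continuousOn.mono (prod_mono Icc_subset_Ici_self (Icc_subset_Icc_left hσ.1.le))
    · exact fun _ _ => Or.inr hm.le
  obtain ⟨C1, hC1⟩ := hK.bddAbove_image hc
  set C := max 1 (max (C0 / 2 + 4 ^ n) (C1 * Real.exp (n/2))) with hC
  have hCp : 0 < C := lt_of_lt_of_le one_pos (le_max_left _ _)
  refine ⟨C, hCp, ?_⟩
  intro r hr t ht
  have ht' : t ∈ Ioo 0 T := ⟨hσ.1.trans_le ht.1, ht.2⟩
  have hEp := Real.exp_pos (-(n / 2 * r))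
  rcases le_total 1 r with h1 | h1
  · have hd : ∀ s, 0 < s → deriv (fun ρ => u ρ t ^ m) s = wr s t :=
      fun s hs' => (hs.dw s hs' t ht').deriv
    have hE := hu.energy t ht'
    have hb := hC0 t ht
    have hcong : EqOn (fun s => (deriv (fun ρ => u ρ t ^ m) s) ^ 2 * Real.sinh s ^ n)
        (fun s => (wr s t) ^ 2 * Real.sinh s ^ n) (Ioi 0) := by
      intro s hs'; simp only [hd s hs']
    have := decay_far n (fun ρ => u ρ t ^ m) (fun ρ => wr ρ t) C0
      (fun r hr => hs.dw r hr t ht')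
      ((slice_r hs.cwr ht').mono Ioi_subset_Ici_self)
      (by simpa using hE.2.1)
      ((integrableOn_congr_fun hcong measurableSet_Ioi).1 (by simpa using hE.2.2))
      (by
        rw [← setIntegral_congr_fun measurableSet_Ioi hcong]
        simpa [H1normSq] using hb) r h1
    refine this.trans ?_
    gcongr
    exact (le_max_left _ _).trans (le_max_right _ _)
  · have h2 : u r t ^ m ≤ C1 := hC1 ⟨(r,t), ⟨⟨hr, h1⟩, ⟨ht.1, ht.2.le⟩⟩, rfl⟩
    have h0 : 0 ≤ u r t ^ m := Real.rpow_nonneg (hs.pos r hr t ht').le m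
    calc u r t ^ m ≤ C1 := h2
      _ ≤ C1 * (Real.exp (n/2) * Real.exp (-(n / 2 * r))) := by
        apply le_mul_of_one_le_right (h0.trans h2)
        rw [← Real.exp_add]
        apply Real.one_le_exp
        have : (0:ℝ) ≤ n := Nat.cast_nonneg n
        nlinarith
      _ = C1 * Real.exp (n/2) * Real.exp (-(n / 2 * r)) := by ring
      _ ≤ _ := by
        gcongr
        exact (le_max_right _ _).trans (le_max_right _ _)

end GHP

open MeasureTheory Set Filter Topology

namespace GHP

theorem swap_box {a b c d : ℝ} (hab : a ≤ b) (hcd : c ≤ d) {F : ℝ → ℝ → ℝ}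
    (hF : ContinuousOn (fun p : ℝ × ℝ => F p.1 p.2) (Icc a b ×ˢ Icc c d)) :
    ∫ x in a..b, ∫ y in c..d, F x y = ∫ y in c..d, ∫ x in a..b, F x y := by
  simp only [intervalIntegral.integral_of_le hab, intervalIntegral.integral_of_le hcd,
    ← integral_Icc_eq_integral_Ioc]
  apply integral_integral_swap
  rw [Measure.prod_restrict]
  exact hF.integrableOn_compact (isCompact_Icc.prod isCompact_Icc)

theorem param_box {a b c d : ℝ} (hcd : c ≤ d) {F : ℝ → ℝ → ℝ}
    (hF : ContinuousOn (fun p : ℝ × ℝ => F p.1 p.2) (Icc a b ×ˢ Icc c d)) :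
    ContinuousOn (fun x => ∫ y in c..d, F x y) (Icc a b) := by
  obtain ⟨C, hC⟩ := (isCompact_Icc.prod isCompact_Icc).exists_bound_of_continuousOn hF
  simp only [intervalIntegral.integral_of_le hcd]
  apply continuousOn_of_dominated (bound := fun _ => C)
  · intro x hx
    have : ContinuousOn (fun y => F x y) (Icc c d) :=
      ContinuousOn.comp (g := fun p : ℝ × ℝ => F p.1 p.2) (f := fun t : ℝ => (x, t)) hF
        (by fun_prop) (fun y hy => ⟨hx, hy⟩)
    exact (this.mono Ioc_subset_Icc_self).aestronglyMeasurable measurableSet_Ioc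
  · intro x hx
    filter_upwards [ae_restrict_mem measurableSet_Ioc] with y hy
    exact hC (x,y) ⟨hx, Ioc_subset_Icc_self hy⟩
  · exact integrable_const C
  · filter_upwards [ae_restrict_mem measurableSet_Ioc] with y hy
    exact ContinuousOn.comp (g := fun p : ℝ × ℝ => F p.1 p.2) (f := fun t : ℝ => (t, y)) hF
        (by fun_prop) (fun x hx => ⟨hx, Ioc_subset_Icc_self hy⟩)

theorem ext_zero {f g : ℝ → ℝ} (hf : ContinuousOn f (Ici 0)) (hg : ContinuousOn g (Ici 0))
    (h : ∀ r, 0 < r → f r ≤ g r) : ∀ r, 0 ≤ r → f r ≤ g r := by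
  intro r hr
  rcases hr.eq_or_lt with h0 | h0
  · subst h0
    have h1 : Tendsto f (𝓝[>] 0) (𝓝 (f 0)) :=
      (hf 0 self_mem_Ici).mono_left (nhdsWithin_mono _ Ioi_subset_Ici_self)
    have h2 : Tendsto g (𝓝[>] 0) (𝓝 (g 0)) :=
      (hg 0 self_mem_Ici).mono_left (nhdsWithin_mono _ Ioi_subset_Ici_self)
    apply le_of_tendsto_of_tendsto h1 h2
    filter_upwards [self_mem_nhdsWithin] with x hx
    exact h x hx
  · exact h r h0

/-- regularised positive part and its derivative -/
noncomputable def PP (δ x : ℝ) : ℝ := (x + √(x ^ 2 + δ ^ 2)) / 2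
noncomputable def pp (δ x : ℝ) : ℝ := (1 + x / √(x ^ 2 + δ ^ 2)) / 2

theorem sq_pos' {δ : ℝ} (hδ : 0 < δ) (x : ℝ) : 0 < √(x ^ 2 + δ ^ 2) := by
  apply Real.sqrt_pos.2; positivity

theorem PP_deriv {δ : ℝ} (hδ : 0 < δ) (x : ℝ) : HasDerivAt (PP δ) (pp δ x) x := by
  have h0 : x ^ 2 + δ ^ 2 ≠ 0 := by positivity
  have h1 : HasDerivAt (fun x : ℝ => x ^ 2 + δ ^ 2) (2 * x) x := by
    simpa using (hasDerivAt_pow 2 x).add_const (δ ^ 2)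
  have := ((hasDerivAt_id x).fun_add (h1.sqrt h0)).div_const 2
  refine this.congr_deriv ?_
  have := sq_pos' hδ x
  simp only [pp]
  field_simp

theorem pp_deriv {δ : ℝ} (hδ : 0 < δ) (x : ℝ) : ∃ c, 0 ≤ c ∧ HasDerivAt (pp δ) c x := by
  have h0 : x ^ 2 + δ ^ 2 ≠ 0 := by positivity
  have h1 : HasDerivAt (fun x : ℝ => x ^ 2 + δ ^ 2) (2 * x) x := by
    simpa using (hasDerivAt_pow 2 x).add_const (δ ^ 2)
  have hp := sq_pos' hδ x
  have := (((hasDerivAt_id x).fun_div (h1.sqrt h0) hp.ne').const_add 1).div_const 2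
  refine ⟨_, ?_, this⟩
  have hs : √(x ^ 2 + δ ^ 2) ^ 2 = x ^ 2 + δ ^ 2 := Real.sq_sqrt (by positivity)
  apply div_nonneg _ (by norm_num)
  apply div_nonneg _ (by positivity)
  simp only [id]
  have : 1 * √(x ^ 2 + δ ^ 2) - x * (2 * x / (2 * √(x ^ 2 + δ ^ 2))) =
    δ ^ 2 / √(x ^ 2 + δ ^ 2) := by
    field_simp
    rw [hs]; ring
  rw [this]; positivity

theorem pp_cont {δ : ℝ} (hδ : 0 < δ) : Continuous (pp δ) := by
  rw [continuous_iff_continuousAt]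
  intro x
  obtain ⟨c, _, h⟩ := pp_deriv hδ x
  exact h.continuousAt

theorem PP_cont {δ : ℝ} (hδ : 0 < δ) : Continuous (PP δ) := by
  rw [continuous_iff_continuousAt]
  exact fun x => (PP_deriv hδ x).continuousAt

theorem abs_le_sq (δ x : ℝ) : |x| ≤ √(x ^ 2 + δ ^ 2) := by
  rw [← Real.sqrt_sq_eq_abs]
  apply Real.sqrt_le_sqrt; nlinarith [sq_nonneg δ]

theorem pp_bd (δ x : ℝ) : 0 ≤ pp δ x ∧ pp δ x ≤ 1 := by
  have h := abs_le_sq δ x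
  have h2 : |x / √(x ^ 2 + δ ^ 2)| ≤ 1 := by
    rw [abs_div, abs_of_nonneg (Real.sqrt_nonneg _)]
    exact div_le_one_of_le₀ h (Real.sqrt_nonneg _)
  have := abs_le.1 h2
  unfold pp
  constructor <;> linarith

theorem PP_nonneg (δ x : ℝ) : 0 ≤ PP δ x := by
  have h := abs_le_sq δ x
  have := neg_abs_le x
  unfold PP; linarith

theorem PP_le {δ : ℝ} (hδ : 0 < δ) {x y : ℝ} (hy : 0 ≤ y) (hxy : x ≤ y) : PP δ x ≤ y + δ := by
  have h : √(x ^ 2 + δ ^ 2) ≤ |x| + δ := by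
    rw [Real.sqrt_le_left (by positivity)]
    nlinarith [sq_abs x, abs_nonneg x]
  unfold PP
  rcases abs_cases x with ⟨h1, _⟩ | ⟨h1, _⟩ <;> linarith

theorem pp_tendsto (x : ℝ) : Tendsto (fun δ => pp δ x) (𝓝[>] 0) (𝓝 (pp 0 x)) := by
  apply tendsto_nhdsWithin_of_tendsto_nhds
  rcases eq_or_ne x 0 with h | h
  · subst h; simp [pp]
  · have : ContinuousAt (fun δ => pp δ x) 0 := by
      unfold pp
      have : √(x ^ 2 + 0 ^ 2) ≠ 0 := by
        apply (Real.sqrt_pos.2 _).ne'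
        positivity
      fun_prop (disch := assumption)
    exact this

theorem PP_tendsto (x : ℝ) : Tendsto (fun δ => PP δ x) (𝓝[>] 0) (𝓝 (max x 0)) := by
  apply tendsto_nhdsWithin_of_tendsto_nhds
  have : ContinuousAt (fun δ => PP δ x) 0 := by
    unfold PP; fun_prop
  have h2 : PP 0 x = max x 0 := by
    unfold PP
    simp only [ne_eq, OfNat.ofNat_ne_zero, not_false_eq_true, zero_pow, add_zero,
      Real.sqrt_sq_eq_abs]
    rcases le_total x 0 with h | h
    · rw [abs_of_nonpos h, max_eq_right h]; ring
    · rw [abs_of_nonneg h, max_eq_left h]; ring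
  rw [← h2]; exact this

theorem pp_zero_sign {x y : ℝ} (h1 : 0 < x ↔ 0 < y) (h2 : x < 0 ↔ y < 0) : pp 0 x = pp 0 y := by
  unfold pp
  simp only [ne_eq, OfNat.ofNat_ne_zero, not_false_eq_true, zero_pow, add_zero,
      Real.sqrt_sq_eq_abs]
  rcases lt_trichotomy x 0 with h | h | h
  · have hy := h2.1 h
    rw [abs_of_neg h, abs_of_neg hy, div_neg, div_neg, div_self h.ne, div_self hy.ne]
  · subst h
    have : y = 0 := le_antisymm (not_lt.1 (fun h => lt_irrefl _ (h1.2 h)))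
      (not_lt.1 (fun h => lt_irrefl _ (h2.2 h)))
    subst this; rfl
  · have hy := h1.1 h
    rw [abs_of_pos h, abs_of_pos hy, div_self h.ne', div_self hy.ne']

/-- weight -/
noncomputable def psi (n : ℕ) (R r : ℝ) : ℝ := (Real.cosh r ^ n)⁻¹ - (Real.cosh R ^ n)⁻¹

theorem psi_cont (n : ℕ) (R : ℝ) : Continuous (psi n R) := by
  unfold psi
  have h : ∀ r, Real.cosh r ^ n ≠ 0 := fun r => (pow_pos (Real.cosh_pos r) n).ne'
  have := Real.continuous_cosh
  fun_prop (disch := exact h _)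

theorem psi_deriv (n : ℕ) (R r : ℝ) (hr : 0 < r) : HasDerivAt (psi n R)
    (-(n * (Real.sinh r / Real.cosh r) ^ (n+1) / Real.sinh r ^ n)) r := by
  have hc := Real.cosh_pos r
  have hs := Real.sinh_pos_iff.2 hr
  have h1 : HasDerivAt (fun r => Real.cosh r ^ n) (n * Real.cosh r ^ (n-1) * Real.sinh r) r :=
    (Real.hasDerivAt_cosh r).fun_pow n
  have h2 := (h1.fun_inv (pow_pos hc n).ne').sub_const ((Real.cosh R ^ n)⁻¹)
  refine h2.congr_deriv ?_
  rcases n with _ | k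
  · simp
  · simp only [Nat.add_sub_cancel, div_pow]
    field_simp
    ring

theorem psi_nonneg {n : ℕ} {R r : ℝ} (hr : 0 ≤ r) (hrR : r ≤ R) : 0 ≤ psi n R r := by
  unfold psi
  have h1 : Real.cosh r ≤ Real.cosh R := by
    rw [Real.cosh_le_cosh, abs_of_nonneg hr, abs_of_nonneg (hr.trans hrR)]; exact hrR
  have : (Real.cosh R ^ n)⁻¹ ≤ (Real.cosh r ^ n)⁻¹ := by
    apply inv_anti₀ (pow_pos (Real.cosh_pos r) n)
    exact pow_le_pow_left₀ (Real.cosh_pos r).le h1 n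
  linarith

theorem psi_pos {n : ℕ} (hn : 1 ≤ n) {R r : ℝ} (hr : 0 ≤ r) (hrR : r < R) : 0 < psi n R r := by
  unfold psi
  have h1 : Real.cosh r < Real.cosh R := by
    rw [Real.cosh_lt_cosh, abs_of_nonneg hr, abs_of_nonneg (hr.trans hrR.le)]; exact hrR
  have : (Real.cosh R ^ n)⁻¹ < (Real.cosh r ^ n)⁻¹ := by
    apply inv_strictAnti₀ (pow_pos (Real.cosh_pos r) n)
    exact pow_lt_pow_left₀ h1 (Real.cosh_pos r).le (by omega)
  linarith

theorem psi_mono {n : ℕ} {R R' r : ℝ} (hR : 0 ≤ R) (h : R ≤ R') : psi n R r ≤ psi n R' r := by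
  have := psi_nonneg (n := n) hR h
  unfold psi at *
  linarith

theorem space_ineq (n : ℕ) (hn : 1 ≤ n) {R δ : ℝ} (hR : 0 < R) (hδ : 0 < δ) (om om' g : ℝ → ℝ)
    (c0 : ContinuousOn om (Ici 0)) (c1 : ContinuousOn om' (Ici 0)) (c2 : ContinuousOn g (Ici 0))
    (d0 : ∀ r, 0 < r → HasDerivAt om (om' r) r)
    (d1 : ∀ r, 0 < r → HasDerivAt (fun ρ => Real.sinh ρ ^ n * om' ρ) (Real.sinh r ^ n * g r) r) :
    ∫ r in 0..R, (Real.sinh r ^ n * psi n R r) * (g r * pp δ (om r)) ≤ n * PP δ (om R) := by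
  have hsub : Icc 0 R ⊆ Ici (0:ℝ) := Icc_subset_Ici_self
  have c0' := c0.mono hsub
  have c1' := c1.mono hsub
  have c2' := c2.mono hsub
  have cs := Real.continuous_sinh
  have cc := Real.continuous_cosh
  have cpsi := psi_cont n R
  have cpp := pp_cont hδ
  have cPP := PP_cont hδ
  have hcne : ∀ r, Real.cosh r ≠ 0 := fun r => (Real.cosh_pos r).ne'
  have cq : Continuous (fun r => (Real.sinh r / Real.cosh r) ^ (n+1)) := by
    fun_prop (disch := exact hcne _)
  have cp1 : ContinuousOn (fun r => pp δ (om r)) (Icc 0 R) := cpp.comp_continuousOn c0'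
  have cP1 : ContinuousOn (fun r => PP δ (om r)) (Icc 0 R) := cPP.comp_continuousOn c0'
  set Φ : ℝ → ℝ := fun r => (Real.sinh r ^ n * om' r) * (pp δ (om r) * psi n R r) +
    n * (PP δ (om r) * (Real.sinh r / Real.cosh r) ^ (n+1)) with hΦ
  choose dp hdp0 hdp using fun x => pp_deriv hδ x
  set q' : ℝ → ℝ := fun r => (n+1 : ℕ) * (Real.sinh r / Real.cosh r) ^ (n + 1 - 1) *
    ((Real.cosh r * Real.cosh r - Real.sinh r * Real.sinh r) / Real.cosh r ^ 2) with hq'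
  have hq : ∀ r, HasDerivAt (fun r => (Real.sinh r / Real.cosh r) ^ (n+1)) (q' r) r := by
    intro r
    exact ((Real.hasDerivAt_sinh r).fun_div (Real.hasDerivAt_cosh r) (hcne r)).fun_pow (n+1)
  have key := intervalIntegral.integral_le_sub_of_hasDeriv_right_of_le (g := Φ)
    (φ := fun r => (Real.sinh r ^ n * psi n R r) * (g r * pp δ (om r)))
    (g' := fun r => (Real.sinh r ^ n * g r) * (pp δ (om r) * psi n R r) +
      (Real.sinh r ^ n * om' r) * ((dp (om r) * om' r) * psi n R r +
        pp δ (om r) * (-(n * (Real.sinh r / Real.cosh r) ^ (n+1) / Real.sinh r ^ n))) +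
      n * ((pp δ (om r) * om' r) * (Real.sinh r / Real.cosh r) ^ (n+1) + PP δ (om r) * q' r))
    hR.le ?_ ?_ ?_ ?_
  · refine key.trans ?_
    have hR1 : psi n R R = 0 := by simp [psi]
    have h0 : Φ 0 = 0 := by
      simp [hΦ, Real.sinh_zero]
      exact Or.inl (Or.inl (by omega))
    rw [h0, hΦ]
    simp only [hR1, mul_zero, zero_add, sub_zero]
    have hP := PP_nonneg δ (om R)
    have hs : Real.sinh R / Real.cosh R ≤ 1 := by
      rw [div_le_one (Real.cosh_pos R)]; exact (Real.sinh_lt_cosh R).le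
    have hs0 : 0 ≤ Real.sinh R / Real.cosh R :=
      div_nonneg (Real.sinh_nonneg_iff.2 hR.le) (Real.cosh_pos R).le
    have := pow_le_one₀ (n := n+1) hs0 hs
    have : PP δ (om R) * (Real.sinh R / Real.cosh R) ^ (n+1) ≤ PP δ (om R) :=
      mul_le_of_le_one_right hP this
    gcongr
  · exact (((cs.pow n).continuousOn.mul c1').mul (cp1.mul cpsi.continuousOn)).add
      (continuousOn_const.mul (cP1.mul cq.continuousOn))
  · intro r hr
    have hr0 := hr.1
    apply HasDerivAt.hasDerivWithinAt
    have e1 : HasDerivAt (fun r => pp δ (om r)) (dp (om r) * om' r) r :=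
      (hdp (om r)).comp r (d0 r hr0)
    have e2 : HasDerivAt (fun r => PP δ (om r)) (pp δ (om r) * om' r) r :=
      (PP_deriv hδ (om r)).comp r (d0 r hr0)
    exact ((d1 r hr0).fun_mul (e1.fun_mul (psi_deriv n R r hr0))).fun_add
      ((e2.fun_mul (hq r)).const_mul (n:ℝ))
  · apply ContinuousOn.integrableOn_Icc
    fun_prop
  · intro r hr
    have hr0 := hr.1
    have hs := sinh_pow_pos n hr0
    have t1 : 0 ≤ (Real.sinh r ^ n * om' r) * ((dp (om r) * om' r) * psi n R r) := by
      have : (Real.sinh r ^ n * om' r) * ((dp (om r) * om' r) * psi n R r) =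
        Real.sinh r ^ n * dp (om r) * psi n R r * om' r ^ 2 := by ring
      rw [this]
      have := hdp0 (om r)
      have := psi_nonneg (n := n) hr0.le hr.2.le
      positivity
    have t2 : 0 ≤ n * (PP δ (om r) * q' r) := by
      have h1 := PP_nonneg δ (om r)
      have h2 : 0 ≤ q' r := by
        have h3 : Real.cosh r * Real.cosh r - Real.sinh r * Real.sinh r = 1 := by
          have := Real.cosh_sq_sub_sinh_sq r; nlinarith
        rw [hq']; simp only [h3]
        have := Real.cosh_pos r
        have := Real.sinh_pos_iff.2 hr0
        positivity
      positivity
    have t3 : (Real.sinh r ^ n * om' r) * (pp δ (om r) * (-(n * (Real.sinh r / Real.cosh r) ^ (n+1) / Real.sinh r ^ n))) + n * ((pp δ (om r) * om' r) * (Real.sinh r / Real.cosh r) ^ (n+1)) = 0 := by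
      generalize Real.sinh r ^ n = X at *
      field_simp
      ring
    nlinarith

end GHP

open MeasureTheory Set Filter Topology

namespace GHP

theorem swap_cont {a b c d : ℝ} {F : ℝ → ℝ → ℝ}
    (hF : ContinuousOn (fun p : ℝ × ℝ => F p.1 p.2) (Icc a b ×ˢ Icc c d)) :
    ContinuousOn (fun p : ℝ × ℝ => F p.2 p.1) (Icc c d ×ˢ Icc a b) :=
  ContinuousOn.comp (g := fun p : ℝ × ℝ => F p.1 p.2) (f := fun p : ℝ × ℝ => (p.2, p.1)) hF
    (by fun_prop) (fun p hp => ⟨hp.2, hp.1⟩)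

theorem Sol.cw {n : ℕ} {m : ℝ} {J : Set ℝ} {u wr ut : ℝ → ℝ → ℝ} (h : Sol n m J u wr ut) :
    ContinuousOn (fun p : ℝ × ℝ => u p.1 p.2 ^ m) (Set.Ici 0 ×ˢ J) :=
  h.cu.rpow_const (fun p hp => Or.inl (h.pos p.1 hp.1 p.2 hp.2).ne')

theorem Sol.mono {n : ℕ} {m : ℝ} {J J' : Set ℝ} {u wr ut : ℝ → ℝ → ℝ} (h : Sol n m J u wr ut)
    (hJ : J' ⊆ J) : Sol n m J' u wr ut :=
  ⟨h.cu.mono (prod_mono_right hJ), h.cwr.mono (prod_mono_right hJ),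
   h.cut.mono (prod_mono_right hJ), fun r hr t ht => h.pos r hr t (hJ ht),
   fun r hr t ht => h.dw r hr t (hJ ht), fun r hr t ht => h.dt r hr t (hJ ht),
   fun r hr t ht => h.da r hr t (hJ ht)⟩

section
variable {n : ℕ} {m s t : ℝ} {u1 wr1 ut1 u2 wr2 ut2 : ℝ → ℝ → ℝ}

theorem cmpA (hn : 1 ≤ n) (hst : s ≤ t)
    (h1 : Sol n m (Icc s t) u1 wr1 ut1) (h2 : Sol n m (Icc s t) u2 wr2 ut2) {C a : ℝ}
    (hC : ∀ r, 0 ≤ r → ∀ τ ∈ Icc s t, u1 r τ ^ m ≤ C * Real.exp (-(a * r)))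
    {R δ : ℝ} (hR : 0 < R) (hδ : 0 < δ) :
    ∫ r in 0..R, (Real.sinh r ^ n * psi n R r) *
      (∫ τ in s..t, (ut1 r τ - ut2 r τ) * pp δ (u1 r τ ^ m - u2 r τ ^ m)) ≤
      n * (C * Real.exp (-(a * R)) + δ) * (t - s) := by
  have cs := Real.continuous_sinh
  have cpsi := psi_cont n R
  set F : ℝ → ℝ → ℝ := fun r τ => (Real.sinh r ^ n * psi n R r) *
    ((ut1 r τ - ut2 r τ) * pp δ (u1 r τ ^ m - u2 r τ ^ m)) with hF
  have hsub : Icc 0 R ×ˢ Icc s t ⊆ Ici (0:ℝ) ×ˢ Icc s t := prod_mono_left Icc_subset_Ici_self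
  have cF : ContinuousOn (fun p : ℝ × ℝ => F p.1 p.2) (Icc 0 R ×ˢ Icc s t) := by
    have k1 : Continuous (fun p : ℝ × ℝ => Real.sinh p.1 ^ n * psi n R p.1) := by fun_prop
    exact k1.continuousOn.mul (((h1.cut.mono hsub).sub (h2.cut.mono hsub)).mul
      ((pp_cont hδ).comp_continuousOn ((h1.cw.mono hsub).sub (h2.cw.mono hsub))))
  have e1 : ∫ r in 0..R, (Real.sinh r ^ n * psi n R r) *
      (∫ τ in s..t, (ut1 r τ - ut2 r τ) * pp δ (u1 r τ ^ m - u2 r τ ^ m)) =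
      ∫ τ in s..t, ∫ r in 0..R, F r τ := by
    rw [← swap_box hR.le hst cF]
    congr 1; ext r
    rw [← intervalIntegral.integral_const_mul]
  rw [e1]
  have e2 : ∫ τ in s..t, (n * (C * Real.exp (-(a * R)) + δ)) =
      n * (C * Real.exp (-(a * R)) + δ) * (t - s) := by
    rw [intervalIntegral.integral_const]; simp [mul_comm]
  rw [← e2]
  apply intervalIntegral.integral_mono_on hst
  · apply ContinuousOn.intervalIntegrable
    rw [uIcc_of_le hst]
    exact param_box hR.le (swap_cont cF)
  · exact intervalIntegrable_const
  · intro τ hτ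
    refine (space_ineq n hn hR hδ (fun r => u1 r τ ^ m - u2 r τ ^ m)
      (fun r => wr1 r τ - wr2 r τ) (fun r => ut1 r τ - ut2 r τ)
      ((slice_r (f := fun r t => u1 r t ^ m) h1.cw hτ).sub
        (slice_r (f := fun r t => u2 r t ^ m) h2.cw hτ))
      ((slice_r h1.cwr hτ).sub (slice_r h2.cwr hτ)) ((slice_r h1.cut hτ).sub (slice_r h2.cut hτ))
      (fun r hr => (h1.dw r hr τ hτ).fun_sub (h2.dw r hr τ hτ)) ?_).trans ?_
    · intro r hr
      have := (h1.da r hr τ hτ).fun_sub (h2.da r hr τ hτ)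
      simpa only [mul_sub] using this
    · gcongr
      have p1 := Real.rpow_pos_of_pos (h1.pos R hR.le τ hτ) m
      have p2 := Real.rpow_pos_of_pos (h2.pos R hR.le τ hτ) m
      have := hC R hR.le τ hτ
      apply PP_le hδ <;> linarith

theorem cmpB (hm : 0 < m) (hst : s ≤ t)
    (h1 : Sol n m (Icc s t) u1 wr1 ut1) (h2 : Sol n m (Icc s t) u2 wr2 ut2)
    (hs : ∀ r, 0 ≤ r → u1 r s ≤ u2 r s) {r : ℝ} (hr : 0 ≤ r) :
    Tendsto (fun δ => ∫ τ in s..t, (ut1 r τ - ut2 r τ) * pp δ (u1 r τ ^ m - u2 r τ ^ m))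
      (𝓝[>] 0) (𝓝 (max (u1 r t - u2 r t) 0)) := by
  set g : ℝ → ℝ := fun τ => ut1 r τ - ut2 r τ with hg
  set d : ℝ → ℝ := fun τ => u1 r τ - u2 r τ with hd
  set om : ℝ → ℝ := fun τ => u1 r τ ^ m - u2 r τ ^ m with hom
  have cg : ContinuousOn g (uIcc s t) := by
    rw [uIcc_of_le hst]; exact (slice_t h1.cut hr).sub (slice_t h2.cut hr)
  have cd : ContinuousOn d (uIcc s t) := by
    rw [uIcc_of_le hst]; exact (slice_t h1.cu hr).sub (slice_t h2.cu hr)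
  have co : ContinuousOn om (uIcc s t) := by
    rw [uIcc_of_le hst]
    exact (slice_t (f := fun r t => u1 r t ^ m) h1.cw hr).sub
      (slice_t (f := fun r t => u2 r t ^ m) h2.cw hr)
  have k1 : ∀ δ, 0 < δ → ∫ τ in s..t, g τ * pp δ (om τ) =
      (∫ τ in s..t, g τ * (pp δ (om τ) - pp δ (d τ))) + (PP δ (d t) - PP δ (d s)) := by
    intro δ hδ
    have c1 := (pp_cont hδ).comp_continuousOn co
    have c2 := (pp_cont hδ).comp_continuousOn cd
    have : ∫ τ in s..t, g τ * pp δ (d τ) = PP δ (d t) - PP δ (d s) := by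
      apply intervalIntegral.integral_eq_sub_of_hasDerivAt (f := fun τ => PP δ (d τ))
      · intro τ hτ
        rw [uIcc_of_le hst] at hτ
        have := (PP_deriv hδ (d τ)).comp τ ((h1.dt r hr τ hτ).fun_sub (h2.dt r hr τ hτ))
        exact this.congr_deriv (mul_comm _ _)
      · exact (cg.mul c2).intervalIntegrable
    rw [← this, ← intervalIntegral.integral_add]
    · congr 1; ext τ; ring
    · exact (cg.mul (c1.sub c2)).intervalIntegrable
    · exact (cg.mul c2).intervalIntegrable
  have k2 : Tendsto (fun δ => ∫ τ in s..t, g τ * (pp δ (om τ) - pp δ (d τ))) (𝓝[>] 0)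
      (𝓝 (∫ τ in s..t, g τ * (pp 0 (om τ) - pp 0 (d τ)))) := by
    apply intervalIntegral.tendsto_integral_filter_of_dominated_convergence
      (bound := fun τ => |g τ|)
    · filter_upwards [self_mem_nhdsWithin] with δ hδ
      have c1 := (pp_cont hδ).comp_continuousOn co
      have c2 := (pp_cont hδ).comp_continuousOn cd
      exact ((cg.mul (c1.sub c2)).mono uIoc_subset_uIcc).aestronglyMeasurable measurableSet_uIoc
    · filter_upwards with δ
      filter_upwards with τ _
      rw [Real.norm_eq_abs, abs_mul]
      apply mul_le_of_le_one_right (abs_nonneg _)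
      have := pp_bd δ (om τ); have := pp_bd δ (d τ)
      rw [abs_le]; constructor <;> linarith
    · exact cg.abs.intervalIntegrable
    · filter_upwards with τ _
      exact ((pp_tendsto _).sub (pp_tendsto _)).const_mul _
  have k3 : ∫ τ in s..t, g τ * (pp 0 (om τ) - pp 0 (d τ)) = 0 := by
    rw [intervalIntegral.integral_congr (g := fun _ => 0)]
    · simp
    · intro τ hτ
      rw [uIcc_of_le hst] at hτ
      have p1 := h1.pos r hr τ hτ
      have p2 := h2.pos r hr τ hτ
      have : pp 0 (om τ) = pp 0 (d τ) := by
        apply pp_zero_sign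
        · simp only [hom, hd, sub_pos]; exact Real.rpow_lt_rpow_iff p2.le p1.le hm
        · simp only [hom, hd, sub_neg]; exact Real.rpow_lt_rpow_iff p1.le p2.le hm
      simp [this]
  have k4 : max (u1 r t - u2 r t) 0 = 0 + (max (d t) 0 - max (d s) 0) := by
    have : max (d s) 0 = 0 := max_eq_right (by have := hs r hr; simp only [hd]; linarith)
    rw [this]; simp [hd]
  rw [k4]
  rw [k3] at k2
  refine (k2.add ((PP_tendsto (d t)).sub (PP_tendsto (d s)))).congr' ?_
  filter_upwards [self_mem_nhdsWithin] with δ hδ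
  exact (k1 δ hδ).symm

theorem cmpC (hn : 1 ≤ n) (hm : 0 < m) (hst : s ≤ t)
    (h1 : Sol n m (Icc s t) u1 wr1 ut1) (h2 : Sol n m (Icc s t) u2 wr2 ut2) {C a : ℝ}
    (hC : ∀ r, 0 ≤ r → ∀ τ ∈ Icc s t, u1 r τ ^ m ≤ C * Real.exp (-(a * r)))
    (hs : ∀ r, 0 ≤ r → u1 r s ≤ u2 r s) {R : ℝ} (hR : 0 < R) :
    ∫ r in 0..R, (Real.sinh r ^ n * psi n R r) * max (u1 r t - u2 r t) 0 ≤
      n * (C * Real.exp (-(a * R))) * (t - s) := by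
  have cs := Real.continuous_sinh
  have cpsi := psi_cont n R
  have cA : Continuous (fun r => Real.sinh r ^ n * psi n R r) := by fun_prop
  have hsub : Icc 0 R ×ˢ Icc s t ⊆ Ici (0:ℝ) ×ˢ Icc s t := prod_mono_left Icc_subset_Ici_self
  have cg := (h1.cut.mono hsub).sub (h2.cut.mono hsub)
  obtain ⟨G, hG⟩ := (isCompact_Icc.prod isCompact_Icc).exists_bound_of_continuousOn cg
  have l1 : Tendsto (fun δ => ∫ r in 0..R, (Real.sinh r ^ n * psi n R r) *
      (∫ τ in s..t, (ut1 r τ - ut2 r τ) * pp δ (u1 r τ ^ m - u2 r τ ^ m))) (𝓝[>] 0)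
      (𝓝 (∫ r in 0..R, (Real.sinh r ^ n * psi n R r) * max (u1 r t - u2 r t) 0)) := by
    apply intervalIntegral.tendsto_integral_filter_of_dominated_convergence
      (bound := fun r => |Real.sinh r ^ n * psi n R r| * (G * |t - s|))
    · filter_upwards [self_mem_nhdsWithin] with δ hδ
      have c3 : ContinuousOn (fun r => ∫ τ in s..t, (ut1 r τ - ut2 r τ) *
          pp δ (u1 r τ ^ m - u2 r τ ^ m)) (Icc 0 R) := by
        apply param_box (F := fun r τ => (ut1 r τ - ut2 r τ) * pp δ (u1 r τ ^ m - u2 r τ ^ m)) hst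
        exact cg.mul ((pp_cont hδ).comp_continuousOn ((h1.cw.mono hsub).sub (h2.cw.mono hsub)))
      rw [uIoc_of_le hR.le]
      exact ((cA.continuousOn.mul c3).mono Ioc_subset_Icc_self).aestronglyMeasurable
        measurableSet_Ioc
    · filter_upwards with δ
      filter_upwards with r hr
      rw [uIoc_of_le hR.le] at hr
      rw [Real.norm_eq_abs, abs_mul]
      gcongr
      refine (Real.norm_eq_abs _).symm.le.trans ?_
      apply intervalIntegral.norm_integral_le_of_norm_le_const
      intro τ hτ
      rw [uIoc_of_le hst] at hτ
      rw [norm_mul]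
      refine (mul_le_of_le_one_right (norm_nonneg _) ?_).trans
        (hG (r, τ) ⟨Ioc_subset_Icc_self hr, Ioc_subset_Icc_self hτ⟩)
      have := pp_bd δ (u1 r τ ^ m - u2 r τ ^ m)
      rw [Real.norm_eq_abs, abs_of_nonneg this.1]; exact this.2
    · apply Continuous.intervalIntegrable
      fun_prop
    · filter_upwards with r hr
      rw [uIoc_of_le hR.le] at hr
      exact (cmpB hm hst h1 h2 hs hr.1.le).const_mul _
  have l2 : Tendsto (fun δ : ℝ => n * (C * Real.exp (-(a * R)) + δ) * (t - s)) (𝓝[>] 0)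
      (𝓝 (n * (C * Real.exp (-(a * R)) + 0) * (t - s))) := by
    apply tendsto_nhdsWithin_of_tendsto_nhds
    have : Continuous (fun δ : ℝ => n * (C * Real.exp (-(a * R)) + δ) * (t - s)) := by fun_prop
    exact this.tendsto 0
  rw [add_zero] at l2
  apply le_of_tendsto_of_tendsto l1 l2
  filter_upwards [self_mem_nhdsWithin] with δ hδ
  exact cmpA hn hst h1 h2 hC hR hδ

theorem compare (hn : 1 ≤ n) (hm : 0 < m) (hst : s ≤ t)
    (h1 : Sol n m (Icc s t) u1 wr1 ut1) (h2 : Sol n m (Icc s t) u2 wr2 ut2) {C a : ℝ} (ha : 0 < a)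
    (hC : ∀ r, 0 ≤ r → ∀ τ ∈ Icc s t, u1 r τ ^ m ≤ C * Real.exp (-(a * r)))
    (hs : ∀ r, 0 ≤ r → u1 r s ≤ u2 r s) : ∀ r, 0 ≤ r → u1 r t ≤ u2 r t := by
  have ht : t ∈ Icc s t := ⟨hst, le_rfl⟩
  apply ext_zero (f := fun r => u1 r t) (g := fun r => u2 r t) (slice_r h1.cu ht) (slice_r h2.cu ht)
  intro r0 hr0
  by_contra hcon
  push Not at hcon
  set D : ℝ → ℝ := fun r => max (u1 r t - u2 r t) 0 with hD
  have cD : ContinuousOn D (Ici 0) :=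
    ((slice_r h1.cu ht).sub (slice_r h2.cu ht)).sup continuousOn_const
  have D0 : ∀ r, 0 ≤ D r := fun r => le_max_right _ _
  have cA : ∀ R, Continuous (fun r => Real.sinh r ^ n * psi n R r) := by
    intro R
    have := psi_cont n R
    have cs := Real.continuous_sinh
    fun_prop
  have R0p : 0 < r0 + 1 := by linarith
  have cI : ∀ R R', 0 ≤ R' → ContinuousOn (fun r => Real.sinh r ^ n * psi n R r * D r) (Icc 0 R') :=
    fun R R' _ => (cA R).continuousOn.mul (cD.mono Icc_subset_Ici_self)
  have hpos : 0 < ∫ r in 0..(r0+1), (Real.sinh r ^ n * psi n (r0+1) r) * D r := by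
    apply intervalIntegral.integral_pos R0p (cI _ _ R0p.le)
    · intro r hr
      exact mul_nonneg (mul_nonneg (sinh_pow_nonneg n hr.1.le) (psi_nonneg hr.1.le hr.2)) (D0 r)
    · refine ⟨r0, ⟨hr0.le, by linarith⟩, ?_⟩
      refine mul_pos (mul_pos (sinh_pow_pos n hr0) (psi_pos hn hr0.le (by linarith))) ?_
      exact lt_max_of_lt_left (sub_pos.2 hcon)
  have hle : ∀ R, r0 + 1 ≤ R → ∫ r in 0..(r0+1), (Real.sinh r ^ n * psi n (r0+1) r) * D r ≤
      n * (C * Real.exp (-(a * R))) * (t - s) := by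
    intro R hR
    have hRp : 0 < R := by linarith
    refine le_trans ?_ (cmpC hn hm hst h1 h2 hC hs hRp)
    have i1 : ∀ R' R'', 0 ≤ R' → IntervalIntegrable
        (fun r => Real.sinh r ^ n * psi n R'' r * D r) volume 0 R' := by
      intro R' R'' h
      apply ContinuousOn.intervalIntegrable
      rw [uIcc_of_le h]; exact cI _ _ h
    calc _ ≤ ∫ r in 0..(r0+1), (Real.sinh r ^ n * psi n R r) * D r := by
          apply intervalIntegral.integral_mono_on R0p.le (i1 _ _ R0p.le) (i1 _ _ R0p.le)
          intro r hr
          have := sinh_pow_nonneg n hr.1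
          have := D0 r
          have := psi_mono (n := n) (r := r) R0p.le hR
          gcongr
      _ ≤ ∫ r in 0..R, (Real.sinh r ^ n * psi n R r) * D r := by
          apply intervalIntegral.integral_mono_interval le_rfl R0p.le hR
          · filter_upwards [ae_restrict_mem measurableSet_Ioc] with r hr
            exact mul_nonneg (mul_nonneg (sinh_pow_nonneg n hr.1.le)
              (psi_nonneg hr.1.le hr.2)) (D0 r)
          · exact i1 _ _ hRp.le
  have lim : Tendsto (fun R : ℝ => n * (C * Real.exp (-(a * R))) * (t - s)) atTop
      (𝓝 (n * (C * 0) * (t - s))) := by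
    apply Tendsto.mul_const
    apply Tendsto.const_mul
    apply Tendsto.const_mul
    apply Real.tendsto_exp_neg_atTop_nhds_zero.comp
    exact tendsto_id.const_mul_atTop ha
  have := ge_of_tendsto lim (by filter_upwards [eventually_ge_atTop (r0+1)] with R hR using hle R hR)
  simp at this
  linarith

end
end GHP

open MeasureTheory Set Filter Topology

namespace GHP

theorem Sol.scale {n : ℕ} {m T : ℝ} (hm1 : m < 1) {u wr ut : ℝ → ℝ → ℝ}
    (h : Sol n m (Ioo 0 T) u wr ut) {s0 t1 l : ℝ} (hs0 : 0 < s0) (ht1 : t1 < T) (hl : 1 ≤ l) :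
    Sol n m (Icc s0 t1) (fun r t => l ^ (1/(1-m)) * u r (s0 + (t - s0)/l))
      (fun r t => l ^ (1/(1-m) * m) * wr r (s0 + (t - s0)/l))
      (fun r t => l ^ (1/(1-m) * m) * ut r (s0 + (t - s0)/l)) := by
  have hl0 : 0 < l := by linarith
  have hmem : ∀ t ∈ Icc s0 t1, s0 + (t - s0)/l ∈ Ioo 0 T := by
    intro t ht
    have h1 : 0 ≤ (t - s0)/l := div_nonneg (by linarith [ht.1]) hl0.le
    have h2 : (t - s0)/l ≤ t - s0 := div_le_self (by linarith [ht.1]) hl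
    exact ⟨by linarith, by linarith [ht.2]⟩
  have hcomp : ∀ f : ℝ → ℝ → ℝ, ContinuousOn (fun p : ℝ × ℝ => f p.1 p.2) (Ici 0 ×ˢ Ioo 0 T) →
      ∀ c : ℝ, ContinuousOn (fun p : ℝ × ℝ => c * f p.1 (s0 + (p.2 - s0)/l))
        (Ici 0 ×ˢ Icc s0 t1) := by
    intro f hf c
    refine continuousOn_const.mul ?_
    exact ContinuousOn.comp (g := fun p : ℝ × ℝ => f p.1 p.2)
      (f := fun p : ℝ × ℝ => (p.1, s0 + (p.2 - s0)/l)) hf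
      (by fun_prop) (fun p hp => ⟨hp.1, hmem p.2 hp.2⟩)
  have hlk : 0 < l ^ (1/(1-m)) := Real.rpow_pos_of_pos hl0 _
  refine ⟨hcomp u h.cu _, hcomp wr h.cwr _, hcomp ut h.cut _, ?_, ?_, ?_, ?_⟩
  · intro r hr t ht
    exact mul_pos hlk (h.pos r hr _ (hmem t ht))
  · intro r hr t ht
    have h1 := (h.dw r hr _ (hmem t ht)).const_mul (l ^ (1/(1-m) * m))
    refine h1.congr_of_eventuallyEq ?_
    filter_upwards [eventually_gt_nhds hr] with ρ hρ
    rw [Real.mul_rpow hlk.le (h.pos ρ hρ.le _ (hmem t ht)).le, ← Real.rpow_mul hl0.le]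
  · intro r hr t ht
    have h0 : HasDerivAt (fun t : ℝ => s0 + (t - s0)/l) (1/l) t :=
      (((hasDerivAt_id t).sub_const s0).div_const l).const_add s0
    have h1 := ((h.dt r hr _ (hmem t ht)).comp t h0).const_mul (l ^ (1/(1-m)))
    refine h1.congr_deriv ?_
    have : l ^ (1/(1-m)) = l ^ (1/(1-m) * m) * l := by
      have hne : 1 - m ≠ 0 := by linarith
      rw [← Real.rpow_add_one hl0.ne']
      congr 1; field_simp; ring
    rw [this]; field_simp
  · intro r hr t ht
    have h1 := (h.da r hr _ (hmem t ht)).const_mul (l ^ (1/(1-m) * m))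
    have e : (fun ρ => Real.sinh ρ ^ n * (l ^ (1/(1-m) * m) * wr ρ (s0 + (t - s0)/l))) =
      fun ρ => l ^ (1/(1-m) * m) * (Real.sinh ρ ^ n * wr ρ (s0 + (t - s0)/l)) := by
      ext ρ; ring
    rw [e]
    refine h1.congr_deriv (by ring)

/-- All facts about the solution used later. -/
structure Ctx (n : ℕ) (m T : ℝ) (u wr ut : ℝ → ℝ → ℝ) : Prop where
  hn : 1 ≤ n
  hm0 : 0 < m
  hm1 : m < 1
  hT : 0 < T
  sol : Sol n m (Ioo 0 T) u wr ut
  cont : ContinuousOn (fun p : ℝ × ℝ => u p.1 p.2) (Ici 0 ×ˢ Icc 0 T)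
  ext : ∀ r, 0 ≤ r → u r T = 0
  dec : ∀ σ ∈ Ioo 0 T, ∃ C > 0, ∀ r, 0 ≤ r → ∀ t ∈ Ico σ T,
    u r t ^ m ≤ C * Real.exp (-(n / 2 * r))
  am : ∀ σ ∈ Ioo 0 T, ∃ K, 1 ≤ K ∧ ∀ r, 0 ≤ r → ∀ s t, σ ≤ s → s ≤ t → t < T →
    u r t ≤ K * u r s ∧ u r t ^ m ≤ K * u r s ^ m

theorem exists_ctx (n : ℕ) (hn : 1 ≤ n) (m T : ℝ) (hm0 : 0 < m) (hm1 : m < 1) (hT : 0 < T)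
    (u : ℝ → ℝ → ℝ) (hu : IsRadialEnergySolution (n+1) m T u) :
    ∃ wr ut, Ctx n m T u wr ut := by
  obtain ⟨wr, ut, hs⟩ := exists_sol n hn m T u hu
  have hdec := decay n m T hm0 u wr ut hu hs
  refine ⟨wr, ut, hn, hm0, hm1, hT, hs, hu.continuousOn, hu.extinction, hdec, ?_⟩
  intro σ hσ
  set K := (2 * T / σ) ^ (1/(1-m)) with hK
  have hk0 : 0 ≤ 1/(1-m) := by
    apply div_nonneg zero_le_one; linarith
  have h2T : 1 ≤ 2 * T / σ := by
    rw [le_div_iff₀ hσ.1]; linarith [hσ.2]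
  have hK1 : 1 ≤ K := Real.one_le_rpow h2T hk0
  refine ⟨K, hK1, ?_⟩
  intro r hr s t h1 h2 h3
  have hσ0 := hσ.1
  have hs0T : σ / 2 ∈ Ioo 0 T := ⟨by linarith, by linarith⟩
  set l := (t - σ/2)/(s - σ/2) with hl
  have hsp : 0 < s - σ/2 := by linarith
  have hl1 : 1 ≤ l := by rw [hl, one_le_div hsp]; linarith
  have hl2 : l ≤ 2 * T / σ := by
    rw [hl, div_le_div_iff₀ hsp hσ.1]
    nlinarith
  obtain ⟨C, hC, hCd⟩ := hdec _ hs0T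
  have hm : 0 < (n:ℝ)/2 := by positivity
  have key := compare (C := C) hn hm0 (by linarith : σ/2 ≤ t)
    (hs.mono (fun x hx => ⟨by linarith [hx.1, hs0T.1], lt_of_le_of_lt hx.2 h3⟩))
    (hs.scale hm1 hs0T.1 h3 hl1) hm
    (fun r hr τ hτ => hCd r hr τ ⟨hτ.1, lt_of_le_of_lt hτ.2 h3⟩)
    (fun r hr => by
      have hp := hs.pos r hr _ hs0T
      have : (1:ℝ) ≤ l ^ (1/(1-m)) := Real.one_le_rpow hl1 hk0
      simp only [sub_self, zero_div, add_zero]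
      nlinarith) r hr
  have e : σ/2 + (t - σ/2)/l = s := by
    rw [hl]
    have : t - σ/2 ≠ 0 := by linarith
    rw [div_div_cancel₀ this]; ring
  simp only [e] at key
  have hp := hs.pos r hr s ⟨by linarith, by linarith⟩
  have hpt := hs.pos r hr t ⟨by linarith, by linarith⟩
  have k1 : u r t ≤ K * u r s := by
    refine key.trans ?_
    gcongr
    exact Real.rpow_le_rpow (by linarith) hl2 hk0
  refine ⟨k1, ?_⟩
  calc u r t ^ m ≤ (K * u r s) ^ m := Real.rpow_le_rpow hpt.le k1 hm0.le
    _ = K ^ m * u r s ^ m := Real.mul_rpow (by linarith) hp.le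
    _ ≤ K * u r s ^ m := by
      gcongr
      calc K ^ m ≤ K ^ (1:ℝ) := Real.rpow_le_rpow_of_exponent_le hK1 hm1.le
        _ = K := Real.rpow_one K

end GHP

open MeasureTheory Set Filter Topology

namespace GHP

noncomputable def Mass (n : ℕ) (u : ℝ → ℝ → ℝ) (r t : ℝ) : ℝ :=
  ∫ x in 0..r, Real.sinh x ^ n * u x t

section
variable {n : ℕ} {m T : ℝ} {u wr ut : ℝ → ℝ → ℝ}

theorem Ctx.cAu (h : Ctx n m T u wr ut) {t : ℝ} (ht : t ∈ Ioo 0 T) :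
    ContinuousOn (fun x => Real.sinh x ^ n * u x t) (Ici 0) :=
  (Real.continuous_sinh.pow n).continuousOn.mul (slice_r h.sol.cu ht)

theorem Ctx.iAu (h : Ctx n m T u wr ut) {t : ℝ} (ht : t ∈ Ioo 0 T) {a b : ℝ} (ha : 0 ≤ a)
    (hb : 0 ≤ b) : IntervalIntegrable (fun x => Real.sinh x ^ n * u x t) volume a b := by
  apply ContinuousOn.intervalIntegrable
  refine (h.cAu ht).mono ?_
  intro x hx
  exact le_trans (le_min ha hb) hx.1

theorem Ctx.M_deriv (h : Ctx n m T u wr ut) {t : ℝ} (ht : t ∈ Ioo 0 T) {r : ℝ} (hr : 0 < r) :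
    HasDerivAt (fun r => Mass n u r t) (Real.sinh r ^ n * u r t) r := by
  have hc : ContinuousAt (fun x => Real.sinh x ^ n * u x t) r :=
    (h.cAu ht).continuousAt (Ici_mem_nhds hr)
  apply intervalIntegral.integral_hasDerivAt_right (h.iAu ht le_rfl hr.le) _ hc
  exact ((h.cAu ht).mono Ioi_subset_Ici_self).stronglyMeasurableAtFilter isOpen_Ioi r hr

theorem Ctx.M_zero : Mass n u 0 t = 0 := by simp [Mass]

theorem Ctx.M_sub (h : Ctx n m T u wr ut) {t : ℝ} (ht : t ∈ Ioo 0 T) {a b : ℝ} (ha : 0 ≤ a)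
    (hb : 0 ≤ b) : Mass n u b t - Mass n u a t = ∫ x in a..b, Real.sinh x ^ n * u x t :=
  intervalIntegral.integral_interval_sub_left (h.iAu ht le_rfl hb) (h.iAu ht le_rfl ha)

theorem Ctx.Au_nonneg (h : Ctx n m T u wr ut) {t : ℝ} (ht : t ∈ Ioo 0 T) {x : ℝ} (hx : 0 ≤ x) :
    0 ≤ Real.sinh x ^ n * u x t :=
  mul_nonneg (sinh_pow_nonneg n hx) (h.sol.pos x hx t ht).le

theorem Ctx.M_mono (h : Ctx n m T u wr ut) {t : ℝ} (ht : t ∈ Ioo 0 T) {a b : ℝ} (ha : 0 ≤ a)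
    (hab : a ≤ b) : Mass n u a t ≤ Mass n u b t := by
  have := h.M_sub ht ha (ha.trans hab)
  have h2 : 0 ≤ ∫ x in a..b, Real.sinh x ^ n * u x t :=
    intervalIntegral.integral_nonneg hab (fun x hx => h.Au_nonneg ht (ha.trans hx.1))
  linarith

theorem Ctx.M_nonneg (h : Ctx n m T u wr ut) {t : ℝ} (ht : t ∈ Ioo 0 T) {a : ℝ} (ha : 0 ≤ a) :
    0 ≤ Mass n u a t := by
  have := h.M_mono ht le_rfl ha
  rwa [Ctx.M_zero] at this

theorem Ctx.M_cont (h : Ctx n m T u wr ut) {t : ℝ} (ht : t ∈ Ioo 0 T) :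
    ContinuousOn (fun r => Mass n u r t) (Ioi 0) :=
  fun _ hr => (h.M_deriv ht hr).continuousAt.continuousWithinAt

theorem Ctx.M_le_of_le (h : Ctx n m T u wr ut) {t : ℝ} (ht : t ∈ Ioo 0 T) {r : ℝ} (hr : 0 ≤ r)
    {f : ℝ → ℝ} (hf : ContinuousOn f (Icc 0 r)) (hle : ∀ x, 0 < x → x ≤ r → u x t ≤ f x) :
    Mass n u r t ≤ ∫ x in 0..r, Real.sinh x ^ n * f x := by
  apply intervalIntegral.integral_mono_on_of_le_Ioo hr (h.iAu ht le_rfl hr)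
  · apply ContinuousOn.intervalIntegrable
    rw [uIcc_of_le hr]
    exact (Real.continuous_sinh.pow n).continuousOn.mul hf
  · intro x hx
    exact mul_le_mul_of_nonneg_left (hle x hx.1 hx.2.le) (sinh_pow_nonneg n hx.1.le)

theorem Ctx.M_am (h : Ctx n m T u wr ut) {K s t : ℝ} (hs : s ∈ Ioo 0 T) (ht : t ∈ Ioo 0 T)
    (hK : ∀ r, 0 ≤ r → u r t ≤ K * u r s) {r : ℝ} (hr : 0 ≤ r) :
    Mass n u r t ≤ K * Mass n u r s := by
  refine (h.M_le_of_le ht hr (f := fun x => K * u x s) ?_ (fun x hx _ => hK x hx.le)).trans ?_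
  · exact continuousOn_const.mul ((slice_r h.sol.cu hs).mono Icc_subset_Ici_self)
  · rw [Mass, ← intervalIntegral.integral_const_mul]
    apply le_of_eq; congr 1; ext x; ring

theorem Ctx.flux (h : Ctx n m T u wr ut) {t : ℝ} (ht : t ∈ Ioo 0 T) {r : ℝ} (hr : 0 ≤ r) :
    ∫ x in 0..r, Real.sinh x ^ n * ut x t = Real.sinh r ^ n * wr r t := by
  have cs := (Real.continuous_sinh.pow n)
  have c1 : ContinuousOn (fun x => Real.sinh x ^ n * wr x t) (Ici 0) :=
    cs.continuousOn.mul (slice_r h.sol.cwr ht)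
  have c2 : ContinuousOn (fun x => Real.sinh x ^ n * ut x t) (Ici 0) :=
    cs.continuousOn.mul (slice_r h.sol.cut ht)
  have := intervalIntegral.integral_eq_sub_of_hasDerivAt_of_le hr
    (c1.mono Icc_subset_Ici_self) (fun x hx => h.sol.da x hx.1 t ht)
    (by apply ContinuousOn.intervalIntegrable; rw [uIcc_of_le hr]; exact c2.mono Icc_subset_Ici_self)
  rw [this, Real.sinh_zero, zero_pow (by have := h.hn; omega)]
  simp

theorem Ctx.flux_int (h : Ctx n m T u wr ut) {s t : ℝ} (hs : 0 < s) (hst : s ≤ t) (ht : t < T)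
    {r : ℝ} (hr : 0 ≤ r) :
    Real.sinh r ^ n * ∫ τ in s..t, wr r τ = Mass n u r t - Mass n u r s := by
  have hsub : Icc s t ⊆ Ioo 0 T := fun x hx => ⟨lt_of_lt_of_le hs hx.1, lt_of_le_of_lt hx.2 ht⟩
  have hsub2 : Icc 0 r ×ˢ Icc s t ⊆ Ici (0:ℝ) ×ˢ Ioo 0 T := prod_mono Icc_subset_Ici_self hsub
  have cs : Continuous (fun p : ℝ × ℝ => Real.sinh p.1 ^ n) := by
    have := Real.continuous_sinh
    fun_prop
  have hsw := swap_box hr hst (F := fun x τ => Real.sinh x ^ n * ut x τ)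
    (cs.continuousOn.mul (h.sol.cut.mono hsub2))
  have e1 : ∫ τ in s..t, ∫ x in 0..r, Real.sinh x ^ n * ut x τ =
      Real.sinh r ^ n * ∫ τ in s..t, wr r τ := by
    rw [← intervalIntegral.integral_const_mul]
    apply intervalIntegral.integral_congr
    intro τ hτ
    rw [uIcc_of_le hst] at hτ
    exact h.flux (hsub hτ) hr
  rw [← e1, ← hsw]
  have htm : t ∈ Ioo 0 T := hsub ⟨hst, le_rfl⟩
  have hsm : s ∈ Ioo 0 T := hsub ⟨le_rfl, hst⟩
  rw [Mass, Mass, ← intervalIntegral.integral_sub (h.iAu htm le_rfl hr) (h.iAu hsm le_rfl hr)]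
  apply intervalIntegral.integral_congr
  intro x hx
  rw [uIcc_of_le hr] at hx
  simp only
  rw [intervalIntegral.integral_const_mul, ← mul_sub]
  congr 1
  apply intervalIntegral.integral_eq_sub_of_hasDerivAt
  · intro τ hτ
    rw [uIcc_of_le hst] at hτ
    exact h.sol.dt x hx.1 τ (hsub hτ)
  · apply ContinuousOn.intervalIntegrable
    rw [uIcc_of_le hst]
    exact (slice_t h.sol.cut hx.1).mono hsub

theorem Ctx.Vid (h : Ctx n m T u wr ut) {s t : ℝ} (hs : 0 < s) (hst : s ≤ t) (ht : t < T)
    {a b : ℝ} (ha : 0 < a) (hab : a ≤ b) :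
    (∫ τ in s..t, u a τ ^ m) - (∫ τ in s..t, u b τ ^ m) =
      ∫ ρ in a..b, (Mass n u ρ s - Mass n u ρ t) / Real.sinh ρ ^ n := by
  have hsub : Icc s t ⊆ Ioo 0 T := fun x hx => ⟨lt_of_lt_of_le hs hx.1, lt_of_le_of_lt hx.2 ht⟩
  have hsub2 : Icc a b ×ˢ Icc s t ⊆ Ici (0:ℝ) ×ˢ Ioo 0 T :=
    prod_mono (fun x hx => ha.le.trans hx.1) hsub
  have hsw := swap_box hab hst (F := fun x τ => wr x τ) (h.sol.cwr.mono hsub2)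
  have cw : ∀ r, 0 ≤ r → IntervalIntegrable (fun τ => u r τ ^ m) volume s t := by
    intro r hr
    apply ContinuousOn.intervalIntegrable
    rw [uIcc_of_le hst]
    exact (slice_t (f := fun r t => u r t ^ m) h.sol.cw hr).mono hsub
  have e1 : ∫ τ in s..t, ∫ x in a..b, wr x τ = ∫ τ in s..t, (u b τ ^ m - u a τ ^ m) := by
    apply intervalIntegral.integral_congr
    intro τ hτ
    rw [uIcc_of_le hst] at hτ
    apply intervalIntegral.integral_eq_sub_of_hasDerivAt (f := fun x => u x τ ^ m)
    · intro x hx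
      rw [uIcc_of_le hab] at hx
      exact h.sol.dw x (lt_of_lt_of_le ha hx.1) τ (hsub hτ)
    · apply ContinuousOn.intervalIntegrable
      rw [uIcc_of_le hab]
      exact (slice_r h.sol.cwr (hsub hτ)).mono (fun x hx => ha.le.trans hx.1)
  rw [intervalIntegral.integral_sub (cw b (ha.le.trans hab)) (cw a ha.le), ← hsw] at e1
  have e2 : ∫ x in a..b, ∫ τ in s..t, wr x τ =
      - ∫ ρ in a..b, (Mass n u ρ s - Mass n u ρ t) / Real.sinh ρ ^ n := by
    rw [← intervalIntegral.integral_neg]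
    apply intervalIntegral.integral_congr
    intro x hx
    rw [uIcc_of_le hab] at hx
    have hx0 : 0 < x := lt_of_lt_of_le ha hx.1
    have := h.flux_int hs hst ht hx0.le
    have hp := sinh_pow_pos n hx0
    simp only
    rw [← neg_div, eq_div_iff hp.ne', mul_comm, this]; ring
  linarith

theorem Ctx.cMA (h : Ctx n m T u wr ut) {t : ℝ} (ht : t ∈ Ioo 0 T) :
    ContinuousOn (fun ρ => Mass n u ρ t / Real.sinh ρ ^ n) (Ioi 0) :=
  (h.M_cont ht).div (Real.continuous_sinh.pow n).continuousOn
    (fun _ hx => (sinh_pow_pos n hx).ne')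

theorem Ctx.iMA (h : Ctx n m T u wr ut) {t : ℝ} (ht : t ∈ Ioo 0 T) {a b : ℝ} (ha : 0 < a)
    (hb : 0 < b) :
    IntervalIntegrable (fun ρ => Mass n u ρ t / Real.sinh ρ ^ n) volume a b := by
  apply ContinuousOn.intervalIntegrable
  exact (h.cMA ht).mono (fun x hx => lt_of_lt_of_le (lt_min ha hb) hx.1)

theorem Ctx.M_ext (h : Ctx n m T u wr ut) {r : ℝ} (hr : 0 ≤ r) :
    Tendsto (fun t => Mass n u r t) (𝓝[<] T) (𝓝 0) := by
  have cs : Continuous (fun p : ℝ × ℝ => Real.sinh p.2 ^ n) := by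
    have := Real.continuous_sinh
    fun_prop
  have hT := h.hT
  have hc : ContinuousOn (fun p : ℝ × ℝ => u p.2 p.1) (Icc 0 T ×ˢ Icc 0 r) :=
    swap_cont (F := u) (h.cont.mono (prod_mono_left Icc_subset_Ici_self))
  have h1 : ContinuousOn (fun t => Mass n u r t) (Icc 0 T) :=
    param_box hr (F := fun t x => Real.sinh x ^ n * u x t) (cs.continuousOn.mul hc)
  have h2 := (h1 T ⟨hT.le, le_rfl⟩).mono_left (nhdsWithin_mono T (Ioo_subset_Icc_self (a := 0)))
  have h3 : Mass n u r T = 0 := by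
    rw [Mass, intervalIntegral.integral_congr (g := fun _ => 0)]
    · simp
    · intro x hx
      rw [uIcc_of_le hr] at hx
      simp [h.ext x hx.1]
  rw [← h3, ← nhdsWithin_Ioo_eq_nhdsLT hT]
  exact h2

/-- (I) -/
theorem Ctx.estI (h : Ctx n m T u wr ut) {σ K : ℝ} (hσ : σ ∈ Ioo 0 T)
    (hK : ∀ r, 0 ≤ r → ∀ s t, σ ≤ s → s ≤ t → t < T →
      u r t ≤ K * u r s ∧ u r t ^ m ≤ K * u r s ^ m)
    {t : ℝ} (ht : t ∈ Ico σ T) {r R : ℝ} (hr : 0 < r) (hrR : r ≤ R) :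
    ∫ ρ in r..R, Mass n u ρ t / Real.sinh ρ ^ n ≤ K * (T - t) * u r t ^ m := by
  have ht0 : t ∈ Ioo 0 T := ⟨lt_of_lt_of_le hσ.1 ht.1, ht.2⟩
  have hRp : 0 < R := lt_of_lt_of_le hr hrR
  have hwp : 0 < u r t ^ m := Real.rpow_pos_of_pos (h.sol.pos r hr.le t ht0) m
  have hK0 : 0 ≤ K := by
    have := (hK r hr.le t t ht.1 le_rfl ht.2).2
    by_contra hc
    push Not at hc
    nlinarith
  set c := ∫ ρ in r..R, (Real.sinh ρ ^ n)⁻¹ with hc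
  have ci : IntervalIntegrable (fun ρ => (Real.sinh ρ ^ n)⁻¹) volume r R := by
    apply ContinuousOn.intervalIntegrable
    rw [uIcc_of_le hrR]
    exact (Real.continuous_sinh.pow n).continuousOn.inv₀
      (fun x hx => (sinh_pow_pos n (lt_of_lt_of_le hr hx.1)).ne')
  have key : ∀ t', t < t' → t' < T → ∫ ρ in r..R, Mass n u ρ t / Real.sinh ρ ^ n ≤
      K * (T - t) * u r t ^ m + Mass n u R t' * c := by
    intro t' h1 h2
    have ht'0 : t' ∈ Ioo 0 T := ⟨ht0.1.trans h1, h2⟩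
    have hV := h.Vid ht0.1 h1.le h2 hr hrR
    have hsub : Icc t t' ⊆ Ioo 0 T :=
      fun x hx => ⟨lt_of_lt_of_le ht0.1 hx.1, lt_of_le_of_lt hx.2 h2⟩
    have a1 : 0 ≤ ∫ τ in t..t', u R τ ^ m := by
      apply intervalIntegral.integral_nonneg h1.le
      intro τ hτ
      exact (Real.rpow_pos_of_pos (h.sol.pos R hRp.le τ (hsub hτ)) m).le
    have a2 : ∫ τ in t..t', u r τ ^ m ≤ K * u r t ^ m * (t' - t) := by
      have : ∫ τ in t..t', (K * u r t ^ m) = K * u r t ^ m * (t' - t) := by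
        rw [intervalIntegral.integral_const]; simp [mul_comm]
      rw [← this]
      apply intervalIntegral.integral_mono_on h1.le
      · apply ContinuousOn.intervalIntegrable
        rw [uIcc_of_le h1.le]
        exact (slice_t (f := fun r t => u r t ^ m) h.sol.cw hr.le).mono hsub
      · exact intervalIntegrable_const
      · intro τ hτ
        exact (hK r hr.le t τ ht.1 hτ.1 (lt_of_le_of_lt hτ.2 h2)).2
    have a3 : ∫ ρ in r..R, (Mass n u ρ t - Mass n u ρ t') / Real.sinh ρ ^ n =
        (∫ ρ in r..R, Mass n u ρ t / Real.sinh ρ ^ n) -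
        ∫ ρ in r..R, Mass n u ρ t' / Real.sinh ρ ^ n := by
      rw [← intervalIntegral.integral_sub (h.iMA ht0 hr hRp) (h.iMA ht'0 hr hRp)]
      congr 1; ext ρ; ring
    have a4 : ∫ ρ in r..R, Mass n u ρ t' / Real.sinh ρ ^ n ≤ Mass n u R t' * c := by
      rw [hc, ← intervalIntegral.integral_const_mul]
      apply intervalIntegral.integral_mono_on hrR (h.iMA ht'0 hr hRp) (ci.const_mul _)
      intro x hx
      have hx0 : 0 < x := lt_of_lt_of_le hr hx.1
      have := sinh_pow_pos n hx0
      rw [div_eq_mul_inv]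
      gcongr
      exact h.M_mono ht'0 hx0.le hx.2
    have a5 : K * u r t ^ m * (t' - t) ≤ K * (T - t) * u r t ^ m := by
      have : K * u r t ^ m * (t' - t) ≤ K * u r t ^ m * (T - t) := by gcongr
      linarith
    linarith
  have lim : Tendsto (fun t' => K * (T - t) * u r t ^ m + Mass n u R t' * c) (𝓝[<] T)
      (𝓝 (K * (T - t) * u r t ^ m + 0 * c)) := ((h.M_ext hRp.le).mul_const c).const_add _
  rw [zero_mul, add_zero] at lim
  apply ge_of_tendsto lim
  filter_upwards [Ioo_mem_nhdsLT ht.2] with t' ht'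
  exact key t' ht'.1 ht'.2

/-- (II) -/
theorem Ctx.estII (h : Ctx n m T u wr ut) {σ K : ℝ} (hσ : σ ∈ Ioo 0 T)
    (hK : ∀ r, 0 ≤ r → ∀ s t, σ ≤ s → s ≤ t → t < T →
      u r t ≤ K * u r s ∧ u r t ^ m ≤ K * u r s ^ m) (hK1 : 1 ≤ K) {C : ℝ}
    (hC : ∀ r, 0 ≤ r → ∀ t ∈ Ico σ T, u r t ^ m ≤ C * Real.exp (-(n / 2 * r)))
    {t0 t : ℝ} (ht0 : σ ≤ t0) (htt : t0 ≤ t) (ht : t < T) {r R : ℝ} (hr : 0 < r) (hrR : r ≤ R) :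
    (t - t0) * u r t ^ m ≤ K * ((∫ ρ in r..R, Mass n u ρ t0 / Real.sinh ρ ^ n) +
      (t - t0) * (C * Real.exp (-(n / 2 * R)))) := by
  have hRp : 0 < R := lt_of_lt_of_le hr hrR
  have ht0' : 0 < t0 := lt_of_lt_of_le hσ.1 ht0
  have hm0 : t0 ∈ Ioo 0 T := ⟨ht0', lt_of_le_of_lt htt ht⟩
  have hmt : t ∈ Ioo 0 T := ⟨lt_of_lt_of_le ht0' htt, ht⟩
  have hsub : Icc t0 t ⊆ Ioo 0 T :=
    fun x hx => ⟨lt_of_lt_of_le ht0' hx.1, lt_of_le_of_lt hx.2 ht⟩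
  have hV := h.Vid ht0' htt ht hr hrR
  have ci : ∀ r, 0 ≤ r → IntervalIntegrable (fun τ => u r τ ^ m) volume t0 t := by
    intro r hr
    apply ContinuousOn.intervalIntegrable
    rw [uIcc_of_le htt]
    exact (slice_t (f := fun r t => u r t ^ m) h.sol.cw hr).mono hsub
  have a1 : (t - t0) * u r t ^ m ≤ K * ∫ τ in t0..t, u r τ ^ m := by
    have : ∫ τ in t0..t, (u r t ^ m) = (t - t0) * u r t ^ m := by
      rw [intervalIntegral.integral_const]; simp
    rw [← this, ← intervalIntegral.integral_const_mul]
    apply intervalIntegral.integral_mono_on htt intervalIntegrable_const ((ci r hr.le).const_mul K)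
    intro τ hτ
    exact (hK r hr.le τ t (ht0.trans hτ.1) hτ.2 ht).2
  have a2 : ∫ τ in t0..t, u R τ ^ m ≤ (t - t0) * (C * Real.exp (-(n / 2 * R))) := by
    have : ∫ τ in t0..t, (C * Real.exp (-(n / 2 * R))) =
        (t - t0) * (C * Real.exp (-(n / 2 * R))) := by
      rw [intervalIntegral.integral_const]; simp
    rw [← this]
    apply intervalIntegral.integral_mono_on htt (ci R hRp.le) intervalIntegrable_const
    intro τ hτ
    exact hC R hRp.le τ ⟨ht0.trans hτ.1, lt_of_le_of_lt hτ.2 ht⟩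
  have a3 : ∫ ρ in r..R, (Mass n u ρ t0 - Mass n u ρ t) / Real.sinh ρ ^ n ≤
      (∫ ρ in r..R, Mass n u ρ t0 / Real.sinh ρ ^ n) := by
    apply intervalIntegral.integral_mono_on hrR _ (h.iMA hm0 hr hRp)
    · intro x hx
      have hx0 : 0 < x := lt_of_lt_of_le hr hx.1
      have := sinh_pow_pos n hx0
      have := h.M_nonneg hmt hx0.le
      gcongr
      linarith
    · have := (h.iMA hm0 hr hRp).sub (h.iMA hmt hr hRp)
      refine this.congr ?_
      intro x _
      simp only; ring
  calc _ ≤ _ := a1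
    _ ≤ _ := by
      gcongr
      linarith

end
end GHP

open MeasureTheory Set Filter Topology

namespace GHP

theorem sinh_exp_mono (n : ℕ) {x y : ℝ} (hx : 0 ≤ x) (hxy : x ≤ y) :
    Real.sinh x ^ n ≤ Real.exp (n * x) * (Real.exp (-(n * y)) * Real.sinh y ^ n) := by
  have e1 : ∀ z : ℝ, Real.exp (-z) * Real.sinh z = (1 - Real.exp (-z) ^ 2) / 2 := by
    intro z
    have : Real.exp (-z) * Real.exp z = 1 := by rw [← Real.exp_add]; simp
    rw [Real.sinh_eq]
    nlinarith
  have h1 : Real.exp (-x) * Real.sinh x ≤ Real.exp (-y) * Real.sinh y := by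
    rw [e1, e1]
    have : Real.exp (-y) ≤ Real.exp (-x) := Real.exp_le_exp.2 (by linarith)
    have := Real.exp_pos (-y)
    nlinarith
  have h2 := pow_le_pow_left₀ (mul_nonneg (Real.exp_pos _).le (Real.sinh_nonneg_iff.2 hx)) h1 n
  rw [mul_pow, mul_pow, ← Real.exp_nat_mul, ← Real.exp_nat_mul] at h2
  have h3 : Real.exp (n * x) * Real.exp (n * -x) = 1 := by
    rw [← Real.exp_add]; simp
  have e4 : (-(n * y) : ℝ) = n * -y := by ring
  rw [e4]
  calc Real.sinh x ^ n = Real.exp (n * x) * (Real.exp (n * -x) * Real.sinh x ^ n) := by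
        rw [← mul_assoc, h3, one_mul]
    _ ≤ _ := by gcongr

theorem int_exp (c : ℝ) (hc : c ≠ 0) (a b : ℝ) :
    ∫ x in a..b, Real.exp (c * x) = (Real.exp (c * b) - Real.exp (c * a)) / c := by
  rw [intervalIntegral.integral_comp_mul_left (fun x => Real.exp x) hc, integral_exp]
  simp [div_eq_inv_mul]

theorem expA_gen (n : ℕ) {β ρ : ℝ} (hρ : 0 ≤ ρ) :
    ∫ x in 0..ρ, Real.sinh x ^ n * Real.exp (-(β * x)) ≤
      (Real.exp (-(n * ρ)) * Real.sinh ρ ^ n) * ∫ x in 0..ρ, Real.exp ((n - β) * x) := by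
  rw [← intervalIntegral.integral_const_mul]
  have cs := Real.continuous_sinh
  apply intervalIntegral.integral_mono_on hρ
  · apply Continuous.intervalIntegrable; fun_prop
  · apply Continuous.intervalIntegrable; fun_prop
  · intro x hx
    have := sinh_exp_mono n hx.1 hx.2
    calc _ ≤ Real.exp (n * x) * (Real.exp (-(n * ρ)) * Real.sinh ρ ^ n) * Real.exp (-(β * x)) := by
          gcongr
      _ = (Real.exp (-(n * ρ)) * Real.sinh ρ ^ n) * (Real.exp (n * x) * Real.exp (-(β * x))) := by
          ring
      _ = _ := by rw [← Real.exp_add]; congr 2; ring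

theorem expA_lt (n : ℕ) {β ρ : ℝ} (hβ : β < n) (hρ : 0 ≤ ρ) :
    ∫ x in 0..ρ, Real.sinh x ^ n * Real.exp (-(β * x)) ≤
      1 / (n - β) * (Real.exp (-(β * ρ)) * Real.sinh ρ ^ n) := by
  refine (expA_gen n hρ).trans ?_
  have hp : 0 < (n:ℝ) - β := by linarith
  rw [int_exp _ hp.ne']
  have hA := sinh_pow_nonneg n hρ
  calc _ ≤ (Real.exp (-(n * ρ)) * Real.sinh ρ ^ n) * (Real.exp ((n - β) * ρ) / (n - β)) := by
        gcongr
        have := Real.exp_pos ((n - β) * 0)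
        linarith
    _ = 1 / (n - β) * ((Real.exp (-(n * ρ)) * Real.exp ((n - β) * ρ)) * Real.sinh ρ ^ n) := by ring
    _ = _ := by rw [← Real.exp_add]; congr 3; ring_nf

theorem expA_gt (n : ℕ) {β ρ : ℝ} (hβ : (n:ℝ) < β) (hρ : 0 ≤ ρ) :
    ∫ x in 0..ρ, Real.sinh x ^ n * Real.exp (-(β * x)) ≤
      1 / (β - n) * (Real.exp (-(n * ρ)) * Real.sinh ρ ^ n) := by
  refine (expA_gen n hρ).trans ?_
  have hp : 0 < β - (n:ℝ) := by linarith
  rw [int_exp _ (by linarith : (n:ℝ) - β ≠ 0)]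
  have hA := sinh_pow_nonneg n hρ
  have e : (Real.exp ((n - β) * ρ) - Real.exp ((n - β) * 0)) / (n - β) =
    (1 - Real.exp ((n - β) * ρ)) / (β - n) := by
    rw [mul_zero, Real.exp_zero, ← neg_sub β (n:ℝ), div_neg, ← neg_div]; ring
  rw [e]
  calc _ ≤ (Real.exp (-(n * ρ)) * Real.sinh ρ ^ n) * (1 / (β - n)) := by
        gcongr
        have := Real.exp_pos ((n - β) * ρ)
        linarith
    _ = _ := by ring

theorem exp_int (η D : ℝ) (hη : 0 < η) : IntegrableOn (fun x => D * Real.exp (-(η * x))) (Ioi 0) := by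
  have := (exp_neg_integrableOn_Ioi 0 hη).const_mul D
  simp only [neg_mul] at this
  exact this

section
variable {n : ℕ} {m T : ℝ} {u wr ut : ℝ → ℝ → ℝ}

/-- basic decay bounds, valid on `[σ,T)`, with `b = n/2+η`. -/
def Bd (n : ℕ) (m T : ℝ) (u : ℝ → ℝ → ℝ) (σ η C : ℝ) : Prop :=
  0 < σ ∧ 0 < η ∧ 0 < C ∧ ∀ r, 0 ≤ r → ∀ t ∈ Ico σ T,
    u r t ^ m ≤ C * Real.exp (-(n / 2 * r)) ∧ u r t ≤ C * Real.exp (-((n/2 + η) * r)) ∧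
    Mass n u r t ≤ C * Real.exp (-((n/2 + η) * r)) * Real.sinh r ^ n

theorem Ctx.bd (h : Ctx n m T u wr ut) {σ : ℝ} (hσ : σ ∈ Ioo 0 T) :
    ∃ η C, Bd n m T u σ η C := by
  obtain ⟨C, hC, hd⟩ := h.dec σ hσ
  have hm0 := h.hm0
  have hm1 := h.hm1
  have hn : (1:ℝ) ≤ n := by exact_mod_cast h.hn
  set b : ℝ := n / (1 + m) with hb
  have hb1 : b < n := by rw [hb, div_lt_iff₀ (by linarith)]; nlinarith
  have hb2 : n/2 < b := by rw [hb, lt_div_iff₀ (by linarith)]; nlinarith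
  have hb3 : b * m ≤ n/2 := by
    rw [hb, div_mul_eq_mul_div, div_le_div_iff₀ (by linarith) (by norm_num)]; nlinarith
  have hbe : n/2 + (b - n/2) = b := by ring
  set C1 := C ^ (1/m) with hC1
  have hC1p : 0 < C1 := Real.rpow_pos_of_pos hC _
  have k2 : ∀ r, 0 ≤ r → ∀ t ∈ Ico σ T, u r t ≤ C1 * Real.exp (-(b * r)) := by
    intro r hr t ht
    have hp := h.sol.pos r hr t ⟨lt_of_lt_of_le hσ.1 ht.1, ht.2⟩
    rw [← Real.rpow_le_rpow_iff hp.le (by positivity) hm0]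
    refine (hd r hr t ht).trans ?_
    rw [Real.mul_rpow hC1p.le (Real.exp_pos _).le, hC1, ← Real.rpow_mul hC.le, ← Real.exp_mul,
      one_div_mul_cancel hm0.ne', Real.rpow_one]
    gcongr
    nlinarith
  have k3 : ∀ r, 0 ≤ r → ∀ t ∈ Ico σ T,
      Mass n u r t ≤ C1 * (1 / (n - b)) * Real.exp (-(b * r)) * Real.sinh r ^ n := by
    intro r hr t ht
    have ht0 : t ∈ Ioo 0 T := ⟨lt_of_lt_of_le hσ.1 ht.1, ht.2⟩
    refine (h.M_le_of_le ht0 hr (f := fun x => C1 * Real.exp (-(b * x))) (by fun_prop)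
      (fun x hx _ => k2 x hx.le t ht)).trans ?_
    have e : ∀ x, Real.sinh x ^ n * (C1 * Real.exp (-(b * x))) =
      C1 * (Real.sinh x ^ n * Real.exp (-(b * x))) := fun x => by ring
    simp only [e]
    rw [intervalIntegral.integral_const_mul]
    have := mul_le_mul_of_nonneg_left (expA_lt n hb1 hr) hC1p.le
    refine this.trans (le_of_eq (by ring))
  have hnb : 0 < 1 / (n - b) := by apply one_div_pos.2; linarith
  have hc2 : 0 < C1 * (1 / (n - b)) := by positivity
  refine ⟨b - n/2, C + C1 + C1 * (1 / (n - b)), hσ.1, by linarith, by positivity, ?_⟩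
  intro r hr t ht
  rw [hbe]
  have hA := sinh_pow_nonneg n hr
  refine ⟨(hd r hr t ht).trans ?_, (k2 r hr t ht).trans ?_, (k3 r hr t ht).trans ?_⟩
  · gcongr; linarith
  · gcongr; linarith
  · gcongr; linarith

noncomputable def BB (n : ℕ) (u : ℝ → ℝ → ℝ) (t s : ℝ) : ℝ :=
  ∫ r in Ioi (0:ℝ), Mass n u r t * Mass n u r s / Real.sinh r ^ n

noncomputable def HH (n : ℕ) (m : ℝ) (u : ℝ → ℝ → ℝ) (t s : ℝ) : ℝ :=
  ∫ r in Ioi (0:ℝ), u r t ^ m * (Real.sinh r ^ n * u r s)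

theorem Ctx.BB_dom (h : Ctx n m T u wr ut) {σ η C : ℝ} (hb : Bd n m T u σ η C) {t s : ℝ}
    (ht : t ∈ Ico σ T) (hs : s ∈ Ico σ T) {r : ℝ} (hr : 0 < r) :
    Mass n u r t * Mass n u r s / Real.sinh r ^ n ≤ C ^ 2 * Real.exp (-(η * r)) := by
  obtain ⟨hσ, hη, hC, hb⟩ := hb
  have h1 := (hb r hr.le t ht).2.2
  have h2 := (hb r hr.le s hs).2.2
  have hA := sinh_pow_pos n hr
  have ht0 : t ∈ Ioo 0 T := ⟨lt_of_lt_of_le hσ ht.1, ht.2⟩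
  have hs0 : s ∈ Ioo 0 T := ⟨lt_of_lt_of_le hσ hs.1, hs.2⟩
  have n1 := h.M_nonneg ht0 hr.le
  have n2 := h.M_nonneg hs0 hr.le
  rw [div_le_iff₀ hA]
  set X := Real.exp (-((n/2 + η) * r)) with hX
  calc _ ≤ (C * X * Real.sinh r ^ n) * (C * X * Real.sinh r ^ n) := by gcongr
    _ = C ^ 2 * (X * X * Real.sinh r ^ n) * Real.sinh r ^ n := by ring
    _ ≤ C ^ 2 * (X * X * Real.exp (n * r)) * Real.sinh r ^ n := by
      gcongr; exact sinh_pow_le n hr.le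
    _ ≤ _ := by
      gcongr
      rw [hX, ← Real.exp_add, ← Real.exp_add]
      apply Real.exp_le_exp.2
      nlinarith

theorem Ctx.HH_dom (h : Ctx n m T u wr ut) {σ η C : ℝ} (hb : Bd n m T u σ η C) {t s : ℝ}
    (ht : t ∈ Ico σ T) (hs : s ∈ Ico σ T) {r : ℝ} (hr : 0 ≤ r) :
    u r t ^ m * (Real.sinh r ^ n * u r s) ≤ C ^ 2 * Real.exp (-(η * r)) := by
  obtain ⟨hσ, hη, hC, hb⟩ := hb
  have h1 := (hb r hr t ht).1
  have h2 := (hb r hr s hs).2.1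
  have hA := sinh_pow_nonneg n hr
  have hs0 : s ∈ Ioo 0 T := ⟨lt_of_lt_of_le hσ hs.1, hs.2⟩
  have := (h.sol.pos r hr s hs0).le
  calc _ ≤ (C * Real.exp (-(n / 2 * r))) * (Real.exp (n * r) * (C * Real.exp (-((n/2 + η) * r)))) := by
        gcongr; exact sinh_pow_le n hr
    _ = C ^ 2 * (Real.exp (-(n / 2 * r)) * (Real.exp (n * r) * Real.exp (-((n/2 + η) * r)))) := by ring
    _ ≤ _ := by
      gcongr
      rw [← Real.exp_add, ← Real.exp_add]
      apply Real.exp_le_exp.2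
      nlinarith

theorem Ctx.BB_nn (h : Ctx n m T u wr ut) {t s : ℝ} (ht : t ∈ Ioo 0 T) (hs : s ∈ Ioo 0 T)
    {r : ℝ} (hr : 0 ≤ r) : 0 ≤ Mass n u r t * Mass n u r s / Real.sinh r ^ n :=
  div_nonneg (mul_nonneg (h.M_nonneg ht hr) (h.M_nonneg hs hr)) (sinh_pow_nonneg n hr)

theorem Ctx.HH_nn (h : Ctx n m T u wr ut) {t s : ℝ} (ht : t ∈ Ioo 0 T) (hs : s ∈ Ioo 0 T)
    {r : ℝ} (hr : 0 ≤ r) : 0 ≤ u r t ^ m * (Real.sinh r ^ n * u r s) :=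
  mul_nonneg (Real.rpow_nonneg (h.sol.pos r hr t ht).le m) (h.Au_nonneg hs hr)

theorem Ctx.BB_cont (h : Ctx n m T u wr ut) {t s : ℝ} (ht : t ∈ Ioo 0 T) (hs : s ∈ Ioo 0 T) :
    ContinuousOn (fun r => Mass n u r t * Mass n u r s / Real.sinh r ^ n) (Ioi 0) :=
  ((h.M_cont ht).mul (h.M_cont hs)).div (Real.continuous_sinh.pow n).continuousOn
    (fun _ hx => (sinh_pow_pos n hx).ne')

theorem Ctx.HH_cont (h : Ctx n m T u wr ut) {t s : ℝ} (ht : t ∈ Ioo 0 T) (hs : s ∈ Ioo 0 T) :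
    ContinuousOn (fun r => u r t ^ m * (Real.sinh r ^ n * u r s)) (Ici 0) :=
  (slice_r (f := fun r t => u r t ^ m) h.sol.cw ht).mul (h.cAu hs)

theorem Bd.mem {σ η C : ℝ} (hb : Bd n m T u σ η C) {t : ℝ} (ht : t ∈ Ico σ T) : t ∈ Ioo 0 T :=
  ⟨lt_of_lt_of_le hb.1 ht.1, ht.2⟩

theorem Ctx.BB_int (h : Ctx n m T u wr ut) {σ η C : ℝ} (hb : Bd n m T u σ η C) {t s : ℝ}
    (ht : t ∈ Ico σ T) (hs : s ∈ Ico σ T) :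
    IntegrableOn (fun r => Mass n u r t * Mass n u r s / Real.sinh r ^ n) (Ioi 0) := by
  refine Integrable.mono' (exp_int η (C ^ 2) hb.2.1)
    ((h.BB_cont (hb.mem ht) (hb.mem hs)).aestronglyMeasurable measurableSet_Ioi) ?_
  filter_upwards [ae_restrict_mem measurableSet_Ioi] with r hr
  have hr' : 0 < r := hr
  rw [Real.norm_eq_abs, abs_of_nonneg (h.BB_nn (hb.mem ht) (hb.mem hs) hr'.le)]
  exact h.BB_dom hb ht hs hr'

theorem Ctx.HH_int (h : Ctx n m T u wr ut) {σ η C : ℝ} (hb : Bd n m T u σ η C) {t s : ℝ}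
    (ht : t ∈ Ico σ T) (hs : s ∈ Ico σ T) :
    IntegrableOn (fun r => u r t ^ m * (Real.sinh r ^ n * u r s)) (Ioi 0) := by
  refine Integrable.mono' (exp_int η (C ^ 2) hb.2.1)
    (((h.HH_cont (hb.mem ht) (hb.mem hs)).mono Ioi_subset_Ici_self).aestronglyMeasurable
      measurableSet_Ioi) ?_
  filter_upwards [ae_restrict_mem measurableSet_Ioi] with r hr
  have hr' : 0 < r := hr
  rw [Real.norm_eq_abs, abs_of_nonneg (h.HH_nn (hb.mem ht) (hb.mem hs) hr'.le)]
  exact h.HH_dom hb ht hs hr'.le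

theorem Ctx.HH_cont2 (h : Ctx n m T u wr ut) {σ η C : ℝ} (hb : Bd n m T u σ η C) :
    ContinuousOn (fun p : ℝ × ℝ => HH n m u p.1 p.2) (Ico σ T ×ˢ Ico σ T) := by
  apply continuousOn_of_dominated (bound := fun r => C ^ 2 * Real.exp (-(η * r)))
  · rintro ⟨t, s⟩ ⟨ht, hs⟩
    exact (h.HH_int hb ht hs).aestronglyMeasurable
  · rintro ⟨t, s⟩ ⟨ht, hs⟩
    filter_upwards [ae_restrict_mem measurableSet_Ioi] with r hr
    have hr' : 0 < r := hr
    rw [Real.norm_eq_abs, abs_of_nonneg (h.HH_nn (hb.mem ht) (hb.mem hs) hr'.le)]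
    exact h.HH_dom hb ht hs hr'.le
  · exact exp_int η (C ^ 2) hb.2.1
  · filter_upwards [ae_restrict_mem measurableSet_Ioi] with r hr
    have hr' : (0:ℝ) ≤ r := le_of_lt hr
    have c1 : ContinuousOn (fun t => u r t ^ m) (Ico σ T) :=
      (slice_t (f := fun r t => u r t ^ m) h.sol.cw hr').mono (fun _ => hb.mem)
    have c2 : ContinuousOn (fun t => u r t) (Ico σ T) :=
      (slice_t h.sol.cu hr').mono (fun _ => hb.mem)
    refine (c1.comp continuousOn_fst (fun p hp => hp.1)).mul (continuousOn_const.mul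
      (c2.comp continuousOn_snd (fun p hp => hp.2)))

theorem Ctx.BB_pos (h : Ctx n m T u wr ut) {σ η C : ℝ} (hb : Bd n m T u σ η C) {t s : ℝ}
    (ht : t ∈ Ico σ T) (hs : s ∈ Ico σ T) : 0 < BB n u t s := by
  have hMpos : ∀ t ∈ Ico σ T, ∀ r, 0 < r → 0 < Mass n u r t := by
    intro t ht r hr
    apply intervalIntegral.intervalIntegral_pos_of_pos_on (h.iAu (hb.mem ht) le_rfl hr.le) _ hr
    intro x hx
    exact mul_pos (sinh_pow_pos n hx.1) (h.sol.pos x hx.1.le t (hb.mem ht))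
  rw [BB, setIntegral_pos_iff_support_of_nonneg_ae _ (h.BB_int hb ht hs)]
  · have : Ioi (0:ℝ) ⊆ Function.support
      (fun r => Mass n u r t * Mass n u r s / Real.sinh r ^ n) := by
      intro r hr
      exact (div_pos (mul_pos (hMpos t ht r hr) (hMpos s hs r hr)) (sinh_pow_pos n hr)).ne'
    rw [inter_eq_right.2 this]; simp
  · filter_upwards [ae_restrict_mem measurableSet_Ioi] with r hr
    exact h.BB_nn (hb.mem ht) (hb.mem hs) (le_of_lt hr)

theorem Ctx.HH_pos (h : Ctx n m T u wr ut) {σ η C : ℝ} (hb : Bd n m T u σ η C) {t s : ℝ}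
    (ht : t ∈ Ico σ T) (hs : s ∈ Ico σ T) : 0 < HH n m u t s := by
  rw [HH, setIntegral_pos_iff_support_of_nonneg_ae _ (h.HH_int hb ht hs)]
  · have : Ioi (0:ℝ) ⊆ Function.support
      (fun r => u r t ^ m * (Real.sinh r ^ n * u r s)) := by
      intro r hr
      exact (mul_pos (Real.rpow_pos_of_pos (h.sol.pos r (le_of_lt hr) t (hb.mem ht)) m)
        (mul_pos (sinh_pow_pos n hr) (h.sol.pos r (le_of_lt hr) s (hb.mem hs)))).ne'
    rw [inter_eq_right.2 this]; simp
  · filter_upwards [ae_restrict_mem measurableSet_Ioi] with r hr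
    exact h.HH_nn (hb.mem ht) (hb.mem hs) (le_of_lt hr)

end
end GHP

open MeasureTheory Set Filter Topology

namespace GHP

theorem ratio_mono {m α T : ℝ} (hm0 : 0 < m) (B H : ℝ → ℝ → ℝ)
    (hB : ∀ t ∈ Ioo α T, 0 < B t t) (hH : ∀ t ∈ Ioo α T, 0 < H t t)
    (cs : ∀ t ∈ Ioo α T, ∀ s ∈ Ioo α T, B t s ≤ √(B t t) * √(B s s))
    (hol : ∀ t ∈ Ioo α T, ∀ s ∈ Ioo α T,
      H t s ≤ H t t ^ (m/(m+1)) * H s s ^ (1/(m+1)))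
    (dB : ∀ t ∈ Ioo α T, ∀ s ∈ Ioo α T, HasDerivAt (fun t => B t s) (-H t s) t)
    (dE : ∀ t ∈ Ioo α T, HasDerivAt (fun t => B t t) (-(2 * H t t)) t)
    (cF : ContinuousOn (fun t => H t t) (Ioo α T)) {a b : ℝ} (ha : α < a) (hab : a ≤ b)
    (hb : b < T) :
    H b b / √(B b b) ^ (m+1) ≤ H a a / √(B a a) ^ (m+1) := by
  set Φ : ℝ → ℝ := fun t => H t t / √(B t t) ^ (m+1) with hΦ
  have hsub : Icc a b ⊆ Ioo α T := fun x hx => ⟨lt_of_lt_of_le ha hx.1, lt_of_le_of_lt hx.2 hb⟩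
  have hep : ∀ t ∈ Ioo α T, 0 < √(B t t) := fun t ht => Real.sqrt_pos.2 (hB t ht)
  have cE : ContinuousOn (fun t => B t t) (Ioo α T) :=
    fun t ht => (dE t ht).continuousAt.continuousWithinAt
  have ce : ContinuousOn (fun t => √(B t t)) (Ioo α T) := cE.sqrt
  have cΦ : ContinuousOn Φ (Ioo α T) := by
    apply cF.div
    · exact ce.rpow_const (fun t ht => Or.inl (hep t ht).ne')
    · intro t ht
      exact (Real.rpow_pos_of_pos (hep t ht) _).ne'
  by_contra hcon
  push Not at hcon
  have hcomp : IsCompact (Icc a b ∩ Φ ⁻¹' Iic (Φ a)) :=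
    isCompact_Icc.of_isClosed_subset
      ((cΦ.mono hsub).preimage_isClosed_of_isClosed isClosed_Icc isClosed_Iic) inter_subset_left
  obtain ⟨s, ⟨hs1, hs2⟩, hsg⟩ := hcomp.exists_isGreatest ⟨a, ⟨le_rfl, hab⟩, le_refl (Φ a)⟩
  have hs2' : Φ s ≤ Φ a := hs2
  have hsb : s < b := by
    rcases hs1.2.eq_or_lt with h | h
    · subst h; exact absurd hs2' (not_le.2 hcon)
    · exact h
  have hsI := hsub hs1
  have hgt : ∀ τ, s < τ → τ ≤ b → Φ s < Φ τ := by
    intro τ h1 h2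
    by_contra hc
    push Not at hc
    exact absurd (hsg ⟨⟨hs1.1.trans h1.le, h2⟩, hc.trans hs2'⟩) (not_le.2 h1)
  have hsub2 : Icc s b ⊆ Ioo α T := (Icc_subset_Icc_left hs1.1).trans hsub
  have hder : ∀ τ ∈ Ioo α T, HasDerivAt (fun τ => B τ s - √(B s s) * √(B τ τ))
      (-H τ s - √(B s s) * (-(2 * H τ τ) / (2 * √(B τ τ)))) τ := by
    intro τ hτ
    exact (dB τ hτ s hsI).fun_sub (((dE τ hτ).sqrt (hB τ hτ).ne').const_mul _)
  have hmono : StrictMonoOn (fun τ => B τ s - √(B s s) * √(B τ τ)) (Icc s b) := by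
    apply strictMonoOn_of_deriv_pos (convex_Icc s b)
    · intro τ hτ
      exact (hder τ (hsub2 hτ)).continuousAt.continuousWithinAt
    · intro τ hτ
      rw [interior_Icc] at hτ
      have hτI := hsub2 (Ioo_subset_Icc_self hτ)
      rw [(hder τ hτI).deriv]
      have h1 := hgt τ hτ.1 hτ.2.le
      have pe1 := hep s hsI
      have pe2 := hep τ hτI
      have pF1 := hH s hsI
      have pF2 := hH τ hτI
      have h2 : H s s ^ (1/(m+1)) / √(B s s) < H τ τ ^ (1/(m+1)) / √(B τ τ) := by
        have := Real.rpow_lt_rpow (by simp only [hΦ]; positivity) h1 (by positivity : 0 < 1/(m+1))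
        simp only [hΦ] at this
        rw [Real.div_rpow pF1.le (by positivity), Real.div_rpow pF2.le (by positivity),
          ← Real.rpow_mul pe1.le, ← Real.rpow_mul pe2.le, mul_one_div_cancel (by positivity),
          Real.rpow_one, Real.rpow_one] at this
        exact this
      have h3 := hol τ hτI s hsI
      have h4 : H τ τ ^ (m/(m+1)) * H τ τ ^ (1/(m+1)) = H τ τ := by
        rw [← Real.rpow_add pF2, ← add_div, div_self (by positivity), Real.rpow_one]
      have h5 : 0 < H τ τ ^ (m/(m+1)) := Real.rpow_pos_of_pos pF2 _
      rw [div_lt_div_iff₀ pe1 pe2] at h2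
      have e6 : √(B s s) * (-(2 * H τ τ) / (2 * √(B τ τ))) = - (√(B s s) * H τ τ / √(B τ τ)) := by
        field_simp
      rw [e6]
      have h7 : H τ s < √(B s s) * H τ τ / √(B τ τ) := by
        refine lt_of_le_of_lt h3 ?_
        rw [lt_div_iff₀ pe2]
        calc _ = H τ τ ^ (m/(m+1)) * (H s s ^ (1/(m+1)) * √(B τ τ)) := by ring
          _ < H τ τ ^ (m/(m+1)) * (H τ τ ^ (1/(m+1)) * √(B s s)) := by gcongr
          _ = _ := by rw [← mul_assoc, h4, mul_comm]
      linarith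
  have hfin := hmono ⟨le_rfl, hsb.le⟩ ⟨hsb.le, le_rfl⟩ hsb
  have hc := cs b (hsub2 ⟨hsb.le, le_rfl⟩) s hsI
  have : √(B s s) * √(B s s) = B s s := Real.mul_self_sqrt (hB s hsI).le
  simp only at hfin
  nlinarith

section
variable {n : ℕ} {m T : ℝ} {u wr ut : ℝ → ℝ → ℝ}

theorem Ctx.cs (h : Ctx n m T u wr ut) {σ η C : ℝ} (hb : Bd n m T u σ η C) {t s : ℝ}
    (ht : t ∈ Ico σ T) (hs : s ∈ Ico σ T) :
    BB n u t s ≤ √(BB n u t t) * √(BB n u s s) := by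
  have p1 := Real.sqrt_pos.2 (h.BB_pos hb ht ht)
  have p2 := Real.sqrt_pos.2 (h.BB_pos hb hs hs)
  set x := √(BB n u t t)
  set y := √(BB n u s s)
  have hx : x ^ 2 = BB n u t t := Real.sq_sqrt (h.BB_pos hb ht ht).le
  have hy : y ^ 2 = BB n u s s := Real.sq_sqrt (h.BB_pos hb hs hs).le
  have i1 := h.BB_int hb ht ht
  have i2 := h.BB_int hb hs hs
  have key : BB n u t s ≤ ∫ r in Ioi (0:ℝ),
      ((y / (2 * x)) * (Mass n u r t * Mass n u r t / Real.sinh r ^ n) +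
       (x / (2 * y)) * (Mass n u r s * Mass n u r s / Real.sinh r ^ n)) := by
    apply setIntegral_mono_on (h.BB_int hb ht hs) ((i1.const_mul _).add (i2.const_mul _))
      measurableSet_Ioi
    intro r hr
    simp only [Pi.add_apply]
    have hA := sinh_pow_pos n hr
    generalize Mass n u r t = p
    generalize Mass n u r s = q
    have : (y / (2 * x)) * (p * p / Real.sinh r ^ n) + (x / (2 * y)) * (q * q / Real.sinh r ^ n)
      - p * q / Real.sinh r ^ n = (y * p - x * q) ^ 2 / (2 * x * y * Real.sinh r ^ n) := by
      field_simp; ring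
    have : 0 ≤ (y * p - x * q) ^ 2 / (2 * x * y * Real.sinh r ^ n) := by positivity
    linarith
  rw [integral_add (i1.const_mul _) (i2.const_mul _), integral_const_mul, integral_const_mul] at key
  change BB n u t s ≤ y / (2 * x) * BB n u t t + x / (2 * y) * BB n u s s at key
  rw [← hx, ← hy] at key
  refine key.trans (le_of_eq ?_)
  field_simp; ring

theorem Ctx.hol (h : Ctx n m T u wr ut) {σ η C : ℝ} (hb : Bd n m T u σ η C) {t s : ℝ}
    (ht : t ∈ Ico σ T) (hs : s ∈ Ico σ T) :
    HH n m u t s ≤ HH n m u t t ^ (m/(m+1)) * HH n m u s s ^ (1/(m+1)) := by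
  have hm0 := h.hm0
  have p1 := h.HH_pos hb ht ht
  have p2 := h.HH_pos hb hs hs
  set P := HH n m u t t with hP
  set Q := HH n m u s s with hQ
  set Z := P ^ (m/(m+1)) * Q ^ (1/(m+1)) with hZ
  have hZp : 0 < Z := mul_pos (Real.rpow_pos_of_pos p1 _) (Real.rpow_pos_of_pos p2 _)
  have i1 := h.HH_int hb ht ht
  have i2 := h.HH_int hb hs hs
  have hw : m/(m+1) + 1/(m+1) = 1 := by rw [← add_div, div_self (by positivity)]
  have key : HH n m u t s ≤ ∫ r in Ioi (0:ℝ),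
      ((Z * (m/(m+1)) / P) * (u r t ^ m * (Real.sinh r ^ n * u r t)) +
       (Z * (1/(m+1)) / Q) * (u r s ^ m * (Real.sinh r ^ n * u r s))) := by
    apply setIntegral_mono_on (h.HH_int hb ht hs) ((i1.const_mul _).add (i2.const_mul _))
      measurableSet_Ioi
    intro r hr
    simp only [Pi.add_apply]
    have hA := sinh_pow_pos n hr
    have px := h.sol.pos r (le_of_lt hr) t (hb.mem ht)
    have py := h.sol.pos r (le_of_lt hr) s (hb.mem hs)
    generalize u r t = x at *
    generalize u r s = y at *
    have e1 : ∀ z : ℝ, 0 < z → z ^ m * z = z ^ (m+1) := fun z hz => by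
      rw [Real.rpow_add_one hz.ne']
    have yng := Real.geom_mean_le_arith_mean2_weighted (by positivity : 0 ≤ m/(m+1))
      (by positivity : 0 ≤ 1/(m+1)) (by positivity : 0 ≤ x ^ (m+1) / P)
      (by positivity : 0 ≤ y ^ (m+1) / Q) hw
    rw [Real.div_rpow (by positivity) p1.le, Real.div_rpow (by positivity) p2.le,
      ← Real.rpow_mul px.le, ← Real.rpow_mul py.le, mul_div_cancel₀ _ (by positivity),
      mul_one_div_cancel (by positivity), Real.rpow_one, div_mul_div_comm, ← hZ,
      div_le_iff₀ hZp] at yng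
    calc x ^ m * (Real.sinh r ^ n * y) = (x ^ m * y) * Real.sinh r ^ n := by ring
      _ ≤ _ := mul_le_mul_of_nonneg_right yng hA.le
      _ = _ := by rw [← e1 x px, ← e1 y py]; ring
  rw [integral_add (i1.const_mul _) (i2.const_mul _), integral_const_mul, integral_const_mul] at key
  change HH n m u t s ≤ Z * (m/(m+1)) / P * P + Z * (1/(m+1)) / Q * Q at key
  rw [div_mul_cancel₀ _ p1.ne', div_mul_cancel₀ _ p2.ne', ← mul_add, hw, mul_one] at key
  exact key

theorem Ctx.V_deriv (h : Ctx n m T u wr ut) {s t : ℝ} (hs : 0 < s) (hst : s ≤ t) (ht : t < T)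
    {r : ℝ} (hr : 0 < r) : HasDerivAt (fun x => ∫ τ in s..t, u x τ ^ m)
      (-((Mass n u r s - Mass n u r t) / Real.sinh r ^ n)) r := by
  have ms : s ∈ Ioo 0 T := ⟨hs, lt_of_le_of_lt hst ht⟩
  have mt : t ∈ Ioo 0 T := ⟨lt_of_lt_of_le hs hst, ht⟩
  have cg : ContinuousOn (fun ρ => (Mass n u ρ s - Mass n u ρ t) / Real.sinh ρ ^ n) (Ioi 0) :=
    ((h.M_cont ms).sub (h.M_cont mt)).div (Real.continuous_sinh.pow n).continuousOn
      (fun _ hx => (sinh_pow_pos n hx).ne')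
  have hr2 : r/2 < r := by linarith
  have hr20 : 0 < r/2 := by linarith
  have d1 : HasDerivAt (fun x => ∫ ρ in (r/2)..x, (Mass n u ρ s - Mass n u ρ t) / Real.sinh ρ ^ n)
      ((Mass n u r s - Mass n u r t) / Real.sinh r ^ n) r := by
    apply intervalIntegral.integral_hasDerivAt_right
    · apply ContinuousOn.intervalIntegrable
      rw [uIcc_of_le hr2.le]
      exact cg.mono (fun x hx => lt_of_lt_of_le hr20 hx.1)
    · exact cg.stronglyMeasurableAtFilter isOpen_Ioi r hr
    · exact cg.continuousAt (Ioi_mem_nhds hr)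
  refine (d1.const_sub (∫ τ in s..t, u (r/2) τ ^ m)).congr_of_eventuallyEq ?_
  filter_upwards [eventually_gt_nhds hr2] with x hx
  have := h.Vid hs hst ht hr20 hx.le
  linarith

theorem Ctx.M_cont0 (h : Ctx n m T u wr ut) {t : ℝ} (ht : t ∈ Ioo 0 T) :
    ContinuousOn (fun r => Mass n u r t) (Icc 0 1) := by
  have := intervalIntegral.continuousOn_primitive_interval (a := 0) (b := 1) (μ := volume)
    (f := fun x => Real.sinh x ^ n * u x t) (by
      rw [uIcc_of_le zero_le_one]
      exact ((h.cAu ht).mono Icc_subset_Ici_self).integrableOn_Icc)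
  rwa [uIcc_of_le zero_le_one] at this

theorem Ctx.Kid (h : Ctx n m T u wr ut) {σ η C : ℝ} (hb : Bd n m T u σ η C) {t t' s : ℝ}
    (ht : σ ≤ t) (htt : t ≤ t') (ht' : t' < T) (hs : s ∈ Ico σ T) :
    BB n u t s - BB n u t' s = ∫ τ in t..t', HH n m u τ s := by
  have mt : t ∈ Ico σ T := ⟨ht, lt_of_le_of_lt htt ht'⟩
  have mt' : t' ∈ Ico σ T := ⟨ht.trans htt, ht'⟩
  have hσ := hb.1
  have t0 : 0 < t := lt_of_lt_of_le hσ ht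
  have hsubI : Icc t t' ⊆ Ico σ T := fun x hx => ⟨ht.trans hx.1, lt_of_le_of_lt hx.2 ht'⟩
  have hsub0 : Icc t t' ⊆ Ioo 0 T := fun x hx => hb.mem (hsubI hx)
  -- product integrability
  set μ := volume.restrict (Ioi (0:ℝ)) with hμ
  set ν := volume.restrict (Ioc t t') with hν
  have hprod : Integrable (fun p : ℝ × ℝ => u p.1 p.2 ^ m * (Real.sinh p.1 ^ n * u p.1 s))
      (μ.prod ν) := by
    have hdom : Integrable (fun p : ℝ × ℝ => C ^ 2 * Real.exp (-(η * p.1)) * 1) (μ.prod ν) :=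
      Integrable.mul_prod (exp_int η (C ^ 2) hb.2.1) (integrable_const (1:ℝ))
    refine hdom.mono' ?_ ?_
    · rw [hμ, hν, Measure.prod_restrict]
      apply ContinuousOn.aestronglyMeasurable _ (measurableSet_Ioi.prod measurableSet_Ioc)
      have c1 : ContinuousOn (fun p : ℝ × ℝ => u p.1 p.2 ^ m) (Ioi 0 ×ˢ Ioc t t') :=
        h.sol.cw.mono (prod_mono Ioi_subset_Ici_self (Ioc_subset_Icc_self.trans hsub0))
      refine c1.mul ((h.cAu (hb.mem hs)).comp continuousOn_fst (fun p hp => Set.mem_Ici.2 (le_of_lt hp.1)))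
    · rw [hμ, hν, Measure.prod_restrict]
      filter_upwards [ae_restrict_mem (measurableSet_Ioi.prod measurableSet_Ioc)] with p hp
      have hp1 : 0 < p.1 := hp.1
      have hp2 := hsubI (Ioc_subset_Icc_self hp.2)
      rw [Real.norm_eq_abs, abs_of_nonneg (h.HH_nn (hb.mem hp2) (hb.mem hs) hp1.le), mul_one]
      exact h.HH_dom hb hp2 hs hp1.le
  set V : ℝ → ℝ := fun x => ∫ τ in t..t', u x τ ^ m with hV
  have eV : ∀ r, V r * (Real.sinh r ^ n * u r s) =
      ∫ τ in Ioc t t', u r τ ^ m * (Real.sinh r ^ n * u r s) := by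
    intro r
    rw [hV]; simp only
    rw [intervalIntegral.integral_of_le htt, ← integral_mul_const]
  have iV : IntegrableOn (fun r => V r * (Real.sinh r ^ n * u r s)) (Ioi 0) := by
    simp only [eV]
    exact hprod.integral_prod_left
  have swp : ∫ r in Ioi (0:ℝ), V r * (Real.sinh r ^ n * u r s) = ∫ τ in t..t', HH n m u τ s := by
    simp only [eV]
    rw [intervalIntegral.integral_of_le htt]
    exact integral_integral_swap hprod
  have i1 := h.BB_int hb mt hs
  have i2 := h.BB_int hb mt' hs
  have dF : ∀ r ∈ Ioi (0:ℝ), HasDerivAt (fun r => V r * Mass n u r s)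
      ((Mass n u r t' * Mass n u r s / Real.sinh r ^ n -
        Mass n u r t * Mass n u r s / Real.sinh r ^ n) + V r * (Real.sinh r ^ n * u r s)) r := by
    intro r hr
    have := (h.V_deriv t0 htt ht' hr).fun_mul (h.M_deriv (hb.mem hs) hr)
    exact this.congr_deriv (by ring)
  have cV : ContinuousOn V (Icc 0 1) :=
    param_box htt (h.sol.cw.mono (prod_mono Icc_subset_Ici_self hsub0))
  have c0 : ContinuousWithinAt (fun r => V r * Mass n u r s) (Ici 0) 0 := by
    have := (cV.mul (h.M_cont0 (hb.mem hs))) 0 ⟨le_rfl, zero_le_one⟩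
    exact this.mono_of_mem_nhdsWithin (Icc_mem_nhdsGE zero_lt_one)
  have lim : Tendsto (fun r => V r * Mass n u r s) atTop (𝓝 0) := by
    obtain ⟨_, hη, hC, hbb⟩ := id hb
    have l1 : Tendsto (fun r : ℝ => C ^ 2 * (t' - t) * Real.exp (-(η * r))) atTop (𝓝 (C ^ 2 * (t' - t) * 0)) :=
      (Real.tendsto_exp_neg_atTop_nhds_zero.comp (tendsto_id.const_mul_atTop hη)).const_mul _
    rw [mul_zero] at l1
    apply squeeze_zero' _ _ l1
    · filter_upwards [eventually_gt_atTop 0] with r hr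
      apply mul_nonneg _ (h.M_nonneg (hb.mem hs) hr.le)
      apply intervalIntegral.integral_nonneg htt
      intro τ hτ
      exact (Real.rpow_pos_of_pos (h.sol.pos r hr.le τ (hsub0 hτ)) m).le
    · filter_upwards [eventually_gt_atTop 0] with r hr
      have v1 : V r ≤ C * Real.exp (-(n / 2 * r)) * (t' - t) := by
        have : ∫ τ in t..t', (C * Real.exp (-(n / 2 * r))) =
            C * Real.exp (-(n / 2 * r)) * (t' - t) := by
          rw [intervalIntegral.integral_const]; simp [mul_comm]
        rw [← this]
        apply intervalIntegral.integral_mono_on htt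
        · apply ContinuousOn.intervalIntegrable
          rw [uIcc_of_le htt]
          exact (slice_t (f := fun r t => u r t ^ m) h.sol.cw hr.le).mono hsub0
        · exact intervalIntegrable_const
        · intro τ hτ
          exact (hbb r hr.le τ (hsubI hτ)).1
      have v2 := (hbb r hr.le s hs).2.2
      have v3 := sinh_pow_le n hr.le
      have v4 := h.M_nonneg (hb.mem hs) hr.le
      have v5 : 0 ≤ t' - t := by linarith
      calc V r * Mass n u r s ≤ (C * Real.exp (-(n / 2 * r)) * (t' - t)) *
            (C * Real.exp (-((n/2 + η) * r)) * Real.exp (n * r)) := by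
            gcongr
            exact v2.trans (by gcongr)
        _ = C ^ 2 * (t' - t) * (Real.exp (-(n / 2 * r)) * (Real.exp (-((n/2 + η) * r)) *
            Real.exp (n * r))) := by ring
        _ = _ := by
          rw [← Real.exp_add, ← Real.exp_add]; congr 2; ring
  have i3 : IntegrableOn (fun r => Mass n u r t' * Mass n u r s / Real.sinh r ^ n -
      Mass n u r t * Mass n u r s / Real.sinh r ^ n) (Ioi 0) := i2.sub i1
  have ftc := integral_Ioi_of_hasDerivAt_of_tendsto c0 dF (i3.add iV) lim
  have e0 : Mass n u 0 s = 0 := by simp [Mass]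
  rw [integral_add i3 iV, integral_sub i2 i1, swp, e0, mul_zero, sub_zero] at ftc
  change BB n u t' s - BB n u t s + _ = 0 at ftc
  linarith

end
end GHP

open MeasureTheory Set Filter Topology

namespace GHP

section
variable {n : ℕ} {m T : ℝ} {u wr ut : ℝ → ℝ → ℝ}

theorem BB_symm (t s : ℝ) : BB n u t s = BB n u s t := by
  unfold BB; congr 1; ext r; ring

theorem Ctx.Kid' (h : Ctx n m T u wr ut) {σ η C : ℝ} (hb : Bd n m T u σ η C) {t t' s : ℝ}
    (ht : t ∈ Ico σ T) (ht' : t' ∈ Ico σ T) (hs : s ∈ Ico σ T) :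
    BB n u t s - BB n u t' s = ∫ τ in t..t', HH n m u τ s := by
  rcases le_total t t' with hh | hh
  · exact h.Kid hb ht.1 hh ht'.2 hs
  · have := h.Kid hb ht'.1 hh ht.2 hs
    rw [intervalIntegral.integral_symm]; linarith

theorem Ctx.HH_c1 (h : Ctx n m T u wr ut) {σ η C : ℝ} (hb : Bd n m T u σ η C) {s : ℝ}
    (hs : s ∈ Ico σ T) : ContinuousOn (fun t => HH n m u t s) (Ico σ T) :=
  ContinuousOn.comp (g := fun p : ℝ × ℝ => HH n m u p.1 p.2) (f := fun t : ℝ => (t, s))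
    (h.HH_cont2 hb) (by fun_prop) (fun x hx => ⟨hx, hs⟩)

theorem Ctx.HH_cd (h : Ctx n m T u wr ut) {σ η C : ℝ} (hb : Bd n m T u σ η C) :
    ContinuousOn (fun t => HH n m u t t) (Ico σ T) :=
  ContinuousOn.comp (g := fun p : ℝ × ℝ => HH n m u p.1 p.2) (f := fun t : ℝ => (t, t))
    (h.HH_cont2 hb) (by fun_prop) (fun x hx => ⟨hx, hx⟩)

theorem Ctx.HH_ii (h : Ctx n m T u wr ut) {σ η C : ℝ} (hb : Bd n m T u σ η C) {s a b : ℝ}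
    (hs : s ∈ Ico σ T) (ha : a ∈ Ico σ T) (hbb : b ∈ Ico σ T) :
    IntervalIntegrable (fun t => HH n m u t s) volume a b := by
  apply ContinuousOn.intervalIntegrable
  refine (h.HH_c1 hb hs).mono ?_
  exact fun x hx => ⟨(le_min ha.1 hbb.1).trans hx.1, lt_of_le_of_lt hx.2 (max_lt ha.2 hbb.2)⟩

theorem Ctx.dB (h : Ctx n m T u wr ut) {σ η C : ℝ} (hb : Bd n m T u σ η C) {t s : ℝ}
    (ht : t ∈ Ioo σ T) (hs : s ∈ Ico σ T) :
    HasDerivAt (fun t => BB n u t s) (-HH n m u t s) t := by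
  have hσ : σ ∈ Ico σ T := ⟨le_rfl, ht.1.trans ht.2⟩
  have htm : t ∈ Ico σ T := ⟨ht.1.le, ht.2⟩
  have c := h.HH_c1 hb hs
  have d1 : HasDerivAt (fun x => ∫ τ in σ..x, HH n m u τ s) (HH n m u t s) t := by
    apply intervalIntegral.integral_hasDerivAt_right (h.HH_ii hb hs hσ htm)
    · exact (c.mono Ioo_subset_Ico_self).stronglyMeasurableAtFilter isOpen_Ioo t ht
    · exact c.continuousAt (Ico_mem_nhds ht.1 ht.2)
  refine (d1.const_sub (BB n u σ s)).congr_of_eventuallyEq ?_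
  filter_upwards [Ioo_mem_nhds ht.1 ht.2] with x hx
  have := h.Kid' hb hσ ⟨hx.1.le, hx.2⟩ hs
  linarith

theorem Ctx.dE (h : Ctx n m T u wr ut) {σ η C : ℝ} (hb : Bd n m T u σ η C) {t : ℝ}
    (ht : t ∈ Ioo σ T) :
    HasDerivAt (fun t => BB n u t t) (-(2 * HH n m u t t)) t := by
  have htm : t ∈ Ico σ T := ⟨ht.1.le, ht.2⟩
  apply HasDerivAt.of_isLittleO
  rw [Asymptotics.isLittleO_iff]
  intro c hc
  have hcont : ContinuousAt (fun p : ℝ × ℝ => HH n m u p.1 p.2) (t, t) :=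
    (h.HH_cont2 hb).continuousAt (prod_mem_nhds (Ico_mem_nhds ht.1 ht.2) (Ico_mem_nhds ht.1 ht.2))
  obtain ⟨δ, hδ, hclose⟩ := Metric.continuousAt_iff.1 hcont (c/2) (by positivity)
  filter_upwards [Ioo_mem_nhds ht.1 ht.2, Metric.ball_mem_nhds t hδ] with x hx hxd
  have hxm : x ∈ Ico σ T := ⟨hx.1.le, hx.2⟩
  have k1 := h.Kid' hb htm hxm htm
  have k2 := h.Kid' hb htm hxm hxm
  rw [BB_symm t x] at k2
  have close : ∀ τ s, τ ∈ uIoc t x → (s = t ∨ s = x) → |HH n m u τ s - HH n m u t t| ≤ c/2 := by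
    intro τ s hτ hs
    have hd : dist ((τ, s) : ℝ × ℝ) (t, t) < δ := by
      rw [Prod.dist_eq]
      have hxd' : dist x t < δ := hxd
      apply max_lt
      · refine lt_of_le_of_lt ?_ hxd'
        have := uIoc_subset_uIcc hτ
        simp only [Real.dist_eq]
        exact abs_sub_left_of_mem_uIcc this
      · rcases hs with rfl | rfl
        · simpa using hδ
        · exact hxd'
    have := hclose hd
    rw [Real.dist_eq] at this
    exact this.le
  have e : ∀ s, (s = t ∨ s = x) → |(∫ τ in t..x, HH n m u τ s) - (x - t) * HH n m u t t| ≤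
      c/2 * |x - t| := by
    intro s hs
    have hsm : s ∈ Ico σ T := by rcases hs with rfl | rfl <;> assumption
    have : (∫ τ in t..x, HH n m u τ s) - (x - t) * HH n m u t t =
        ∫ τ in t..x, (HH n m u τ s - HH n m u t t) := by
      rw [intervalIntegral.integral_sub (h.HH_ii hb hsm htm hxm) intervalIntegrable_const,
        intervalIntegral.integral_const, smul_eq_mul]
    rw [this]
    refine (Real.norm_eq_abs _).symm.le.trans ?_
    apply intervalIntegral.norm_integral_le_of_norm_le_const
    intro τ hτ
    refine (Real.norm_eq_abs _).le.trans ?_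
    exact close τ s hτ hs
  have e1 := e t (Or.inl rfl)
  have e2 := e x (Or.inr rfl)
  rw [Real.norm_eq_abs, Real.norm_eq_abs]
  have : BB n u x x - BB n u t t - (x - t) • (-(2 * HH n m u t t)) =
    -((∫ τ in t..x, HH n m u τ t) - (x - t) * HH n m u t t) -
    ((∫ τ in t..x, HH n m u τ x) - (x - t) * HH n m u t t) := by
    rw [smul_eq_mul]; linarith
  rw [this]
  have e3 := abs_le.1 e1
  have e4 := abs_le.1 e2
  rw [abs_le]
  constructor <;> nlinarith [e3.1, e3.2, e4.1, e4.2]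

theorem Ctx.EF (h : Ctx n m T u wr ut) {σ η C K : ℝ} (hb : Bd n m T u σ η C)
    (hK : ∀ r, 0 ≤ r → ∀ s t, σ ≤ s → s ≤ t → t < T →
      u r t ≤ K * u r s ∧ u r t ^ m ≤ K * u r s ^ m) (hK1 : 1 ≤ K)
    {t : ℝ} (ht : t ∈ Ico σ T) :
    BB n u t t ≤ K * (T - t) * HH n m u t t := by
  have hF := (h.HH_pos hb ht ht).le
  have key : ∀ t', t < t' → t' < T → BB n u t t ≤ K * (T - t) * HH n m u t t + BB n u t' t := by
    intro t' h1 h2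
    have ht' : t' ∈ Ico σ T := ⟨ht.1.trans h1.le, h2⟩
    have k := h.Kid hb ht.1 h1.le h2 ht
    have : ∫ τ in t..t', HH n m u τ t ≤ ∫ τ in t..t', K * HH n m u t t := by
      apply intervalIntegral.integral_mono_on h1.le (h.HH_ii hb ht ht ht') intervalIntegrable_const
      intro τ hτ
      have hτm : τ ∈ Ico σ T := ⟨ht.1.trans hτ.1, lt_of_le_of_lt hτ.2 h2⟩
      rw [HH, HH, ← integral_const_mul]
      apply setIntegral_mono_on (h.HH_int hb hτm ht) ((h.HH_int hb ht ht).const_mul K)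
        measurableSet_Ioi
      intro r hr
      have := (hK r (le_of_lt hr) t τ ht.1 hτ.1 hτm.2).2
      have h5 := mul_le_mul_of_nonneg_right this (h.Au_nonneg (hb.mem ht) (le_of_lt hr))
      exact h5.trans (le_of_eq (by ring))
    rw [intervalIntegral.integral_const, smul_eq_mul] at this
    have : (t' - t) * (K * HH n m u t t) ≤ (T - t) * (K * HH n m u t t) := by
      have : 0 ≤ K * HH n m u t t := mul_nonneg (by linarith) hF
      gcongr
    linarith
  have lim : Tendsto (fun t' => BB n u t' t) (𝓝[<] T) (𝓝 (∫ r in Ioi (0:ℝ), 0)) := by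
    apply tendsto_integral_filter_of_dominated_convergence
      (bound := fun r => C ^ 2 * Real.exp (-(η * r)))
    · filter_upwards [Ioo_mem_nhdsLT ht.2] with t' h'
      exact (h.BB_int hb ⟨ht.1.trans h'.1.le, h'.2⟩ ht).aestronglyMeasurable
    · filter_upwards [Ioo_mem_nhdsLT ht.2] with t' h'
      have ht' : t' ∈ Ico σ T := ⟨ht.1.trans h'.1.le, h'.2⟩
      filter_upwards [ae_restrict_mem measurableSet_Ioi] with r hr
      rw [Real.norm_eq_abs, abs_of_nonneg (h.BB_nn (hb.mem ht') (hb.mem ht) (le_of_lt hr))]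
      exact h.BB_dom hb ht' ht hr
    · exact exp_int η (C ^ 2) hb.2.1
    · filter_upwards [ae_restrict_mem measurableSet_Ioi] with r hr
      have := ((h.M_ext (r := r) (le_of_lt hr)).mul_const (Mass n u r t)).div_const (Real.sinh r ^ n)
      simpa using this
  have lim2 := lim.const_add (K * (T - t) * HH n m u t t)
  simp only [integral_zero, add_zero] at lim2
  apply ge_of_tendsto lim2
  filter_upwards [Ioo_mem_nhdsLT ht.2] with t' ht'
  exact key t' ht'.1 ht'.2

theorem Ctx.energy_bound (h : Ctx n m T u wr ut) {σ : ℝ} (hσ : σ ∈ Ioo 0 T) :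
    ∃ D > 0, ∀ t ∈ Ico σ T, BB n u t t ≤ D * ((T - t) ^ (1/(1-m))) ^ 2 := by
  have hσ2 : σ/2 ∈ Ioo 0 T := ⟨by linarith [hσ.1], by linarith [hσ.1, hσ.2]⟩
  obtain ⟨η, C, hb⟩ := h.bd hσ2
  obtain ⟨K, hK1, hK⟩ := h.am _ hσ2
  have hm0 := h.hm0
  have hm1 : 0 < 1 - m := by linarith [h.hm1]
  have ico : ∀ t ∈ Ioo (σ/2) T, t ∈ Ico (σ/2) T := fun t ht => ⟨ht.1.le, ht.2⟩
  have hσm : σ ∈ Ico (σ/2) T := ⟨by linarith [hσ.1], hσ.2⟩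
  set Φ0 := HH n m u σ σ / √(BB n u σ σ) ^ (m+1) with hΦ0
  have hΦ0p : 0 < Φ0 :=
    div_pos (h.HH_pos hb hσm hσm) (Real.rpow_pos_of_pos (Real.sqrt_pos.2 (h.BB_pos hb hσm hσm)) _)
  have hKp : 0 < K := by linarith
  refine ⟨((K * Φ0) ^ (1/(1-m))) ^ 2, by positivity, ?_⟩
  intro t ht
  have htm : t ∈ Ico (σ/2) T := ⟨hσm.1.trans ht.1, ht.2⟩
  have mono : HH n m u t t / √(BB n u t t) ^ (m+1) ≤ Φ0 :=
    ratio_mono (α := σ/2) (T := T) hm0 (BB n u) (HH n m u)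
      (fun t ht => h.BB_pos hb (ico t ht) (ico t ht))
      (fun t ht => h.HH_pos hb (ico t ht) (ico t ht))
      (fun t ht s hs => h.cs hb (ico t ht) (ico s hs))
      (fun t ht s hs => h.hol hb (ico t ht) (ico s hs))
      (fun t ht s hs => h.dB hb ht (ico s hs))
      (fun t ht => h.dE hb ht) ((h.HH_cd hb).mono Ioo_subset_Ico_self)
      (by linarith [hσ.1]) ht.1 ht.2
  have hE := h.BB_pos hb htm htm
  have he := Real.sqrt_pos.2 hE
  have hee : √(BB n u t t) ^ 2 = BB n u t t := Real.sq_sqrt hE.le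
  have ef := h.EF hb hK hK1 htm
  rw [← hee] at ef ⊢
  set e := √(BB n u t t) with hedef
  have hθ : 0 < T - t := by linarith [ht.2]
  have hep : 0 < e ^ (m+1) := Real.rpow_pos_of_pos he _
  rw [div_le_iff₀ hep] at mono
  have k1 : e ^ (1-m) * e ^ (m+1) = e ^ 2 := by
    rw [← Real.rpow_add he, ← Real.rpow_natCast]; congr 1; push_cast; ring
  have k2 : e ^ (1-m) ≤ K * Φ0 * (T - t) := by
    have : e ^ (1-m) * e ^ (m+1) ≤ (K * Φ0 * (T - t)) * e ^ (m+1) := by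
      rw [k1]
      refine ef.trans ?_
      calc K * (T - t) * HH n m u t t ≤ K * (T - t) * (Φ0 * e ^ (m+1)) := by gcongr
        _ = _ := by ring
    exact le_of_mul_le_mul_right this hep
  have k3 : e ≤ (K * Φ0 * (T - t)) ^ (1/(1-m)) := by
    have := Real.rpow_le_rpow (by positivity) k2 (by positivity : 0 ≤ 1/(1-m))
    rwa [← Real.rpow_mul he.le, mul_one_div_cancel hm1.ne', Real.rpow_one] at this
  rw [Real.mul_rpow (by positivity) hθ.le] at k3
  calc e ^ 2 ≤ _ := pow_le_pow_left₀ he.le k3 2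
    _ = _ := by rw [mul_pow]

theorem Ctx.mass_sq (h : Ctx n m T u wr ut) {σ : ℝ} (hσ : σ ∈ Ioo 0 T) :
    ∃ D > 0, ∀ t ∈ Ico σ T, ∀ ρ l, 0 < ρ → 0 < l →
      Mass n u ρ t ^ 2 * l ≤ D * ((T - t) ^ (1/(1-m))) ^ 2 * Real.sinh (ρ + l) ^ n := by
  obtain ⟨D, hD, hE⟩ := h.energy_bound hσ
  obtain ⟨η, C, hb⟩ := h.bd hσ
  refine ⟨D, hD, ?_⟩
  intro t ht ρ l hρ hl
  have ht0 := hb.mem ht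
  have hA := sinh_pow_pos n (by linarith : 0 < ρ + l)
  have hle : ρ ≤ ρ + l := by linarith
  have i1 := h.BB_int hb ht ht
  have hsub : Ioc ρ (ρ + l) ⊆ Ioi (0:ℝ) := fun x hx => lt_trans hρ hx.1
  have k1 : ∫ r in Ioc ρ (ρ+l), Mass n u r t * Mass n u r t / Real.sinh r ^ n ≤ BB n u t t := by
    apply setIntegral_mono_set i1
    · filter_upwards [ae_restrict_mem measurableSet_Ioi] with r hr
      exact h.BB_nn ht0 ht0 (le_of_lt hr)
    · exact hsub.eventuallyLE
  have k2 : ∫ r in Ioc ρ (ρ+l), Mass n u ρ t ^ 2 / Real.sinh (ρ + l) ^ n ≤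
      ∫ r in Ioc ρ (ρ+l), Mass n u r t * Mass n u r t / Real.sinh r ^ n := by
    apply setIntegral_mono_on _ (i1.mono_set hsub) measurableSet_Ioc
    · intro r hr
      have hr0 : 0 < r := hsub hr
      have := sinh_pow_pos n hr0
      have a1 := h.M_mono ht0 hρ.le hr.1.le
      have a2 := h.M_nonneg ht0 hρ.le
      have a3 := sinh_mono_pow n hr0.le hr.2
      rw [← sq]
      gcongr
    · exact integrableOn_const (by simp)
  rw [setIntegral_const, smul_eq_mul] at k2
  simp only [Real.volume_real_Ioc_of_le hle] at k2
  have k3 := k2.trans (k1.trans (hE t ht))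
  have e : (ρ + l - ρ) * (Mass n u ρ t ^ 2 / Real.sinh (ρ + l) ^ n) =
    (Mass n u ρ t ^ 2 * l) / Real.sinh (ρ + l) ^ n := by ring
  rw [e, div_le_iff₀ hA] at k3
  exact k3

end
end GHP

open MeasureTheory Set Filter Topology

namespace GHP

theorem le_of_sqq_le {a b : ℝ} (hb : 0 ≤ b) (h : a ^ 2 ≤ b ^ 2) : a ≤ b :=
  (abs_le.1 (abs_le_of_sq_le_sq h hb)).2

def MBd (n : ℕ) (m T : ℝ) (u : ℝ → ℝ → ℝ) (S : Set ℝ) (h : ℝ → ℝ) : Prop :=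
  ∀ σ ∈ Ioo 0 T, ∃ C > 0, ∀ t ∈ Ico σ T, ∀ ρ ∈ S,
    Mass n u ρ t ≤ C * (T - t) ^ (1/(1-m)) * (h ρ * Real.sinh ρ ^ n)

def UBd (m T : ℝ) (u : ℝ → ℝ → ℝ) (S : Set ℝ) (h : ℝ → ℝ) : Prop :=
  ∀ σ ∈ Ioo 0 T, ∃ C > 0, ∀ t ∈ Ico σ T, ∀ ρ ∈ S,
    u ρ t ≤ C * (T - t) ^ (1/(1-m)) * h ρ

theorem sinh_le_two {x : ℝ} (h0 : 0 ≤ x) (h1 : x ≤ 1) : Real.sinh x ≤ 2 * x := by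
  have a := Real.abs_exp_sub_one_le (x := x) (by rw [abs_of_nonneg h0]; exact h1)
  rw [abs_of_nonneg h0] at a
  have b := (abs_le.1 a).2
  have c := Real.add_one_le_exp (-x)
  rw [Real.sinh_eq]
  linarith

section
variable {n : ℕ} {m T : ℝ} {u wr ut : ℝ → ℝ → ℝ}

theorem MBd.mono {S S' : Set ℝ} {f g : ℝ → ℝ} (c : ℝ) (hc : 0 < c) (h : MBd n m T u S f)
    (hS : S' ⊆ S) (h0 : ∀ ρ ∈ S', 0 ≤ ρ) (hfg : ∀ ρ ∈ S', f ρ ≤ c * g ρ) : MBd n m T u S' g := by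
  intro σ hσ
  obtain ⟨C, hC, hb⟩ := h σ hσ
  refine ⟨C * c, by positivity, ?_⟩
  intro t ht ρ hρ
  refine (hb t ht ρ (hS hρ)).trans ?_
  have hX : 0 ≤ (T - t) ^ (1/(1-m)) := Real.rpow_nonneg (by linarith [ht.2]) _
  have hA := sinh_pow_nonneg n (h0 ρ hρ)
  have : f ρ * Real.sinh ρ ^ n ≤ (c * g ρ) * Real.sinh ρ ^ n :=
    mul_le_mul_of_nonneg_right (hfg ρ hρ) hA
  have : C * (T - t) ^ (1/(1-m)) * (f ρ * Real.sinh ρ ^ n) ≤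
    C * (T - t) ^ (1/(1-m)) * ((c * g ρ) * Real.sinh ρ ^ n) :=
    mul_le_mul_of_nonneg_left this (by positivity)
  exact this.trans (le_of_eq (by ring))

theorem MBd.union {S S' : Set ℝ} {f : ℝ → ℝ} (h : MBd n m T u S f) (h' : MBd n m T u S' f)
    (hf : ∀ ρ ∈ S ∪ S', 0 ≤ f ρ)
    (h0 : ∀ ρ ∈ S ∪ S', 0 ≤ ρ) : MBd n m T u (S ∪ S') f := by
  intro σ hσ
  obtain ⟨C, hC, hb⟩ := h σ hσ
  obtain ⟨C', hC', hb'⟩ := h' σ hσ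
  refine ⟨C + C', by positivity, ?_⟩
  intro t ht ρ hρ
  have hX : 0 ≤ (T - t) ^ (1/(1-m)) := Real.rpow_nonneg (by linarith [ht.2]) _
  have hA := sinh_pow_nonneg n (h0 ρ hρ)
  have hff := hf ρ hρ
  have e1 : 0 ≤ C * (T - t) ^ (1/(1-m)) * (f ρ * Real.sinh ρ ^ n) := by positivity
  have e2 : 0 ≤ C' * (T - t) ^ (1/(1-m)) * (f ρ * Real.sinh ρ ^ n) := by positivity
  rcases hρ with hρ | hρ
  · have := hb t ht ρ hρ
    linarith
  · have := hb' t ht ρ hρ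
    linarith

theorem UBd.mono {S S' : Set ℝ} {f g : ℝ → ℝ} (c : ℝ) (hc : 0 < c) (h : UBd m T u S f)
    (hS : S' ⊆ S) (hfg : ∀ ρ ∈ S', f ρ ≤ c * g ρ) : UBd m T u S' g := by
  intro σ hσ
  obtain ⟨C, hC, hb⟩ := h σ hσ
  refine ⟨C * c, by positivity, ?_⟩
  intro t ht ρ hρ
  refine (hb t ht ρ (hS hρ)).trans ?_
  have hX : 0 ≤ (T - t) ^ (1/(1-m)) := Real.rpow_nonneg (by linarith [ht.2]) _
  have : C * (T - t) ^ (1/(1-m)) * (f ρ) ≤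
    C * (T - t) ^ (1/(1-m)) * ((c * g ρ)) :=
    mul_le_mul_of_nonneg_left (hfg ρ hρ) (by positivity)
  exact this.trans (le_of_eq (by ring))

/-- initial bounds from the energy estimate -/
theorem Ctx.pl0 (h : Ctx n m T u wr ut) :
    MBd n m T u (Ioc 0 1) (fun ρ => ρ ^ (1 - ((n:ℝ)+3)/2)) := by
  intro σ hσ
  obtain ⟨D, hD, hb⟩ := h.mass_sq hσ
  set c := (4 * Real.cosh 1) ^ n with hc
  have hcp : 0 < c := by have := Real.cosh_pos 1; positivity
  refine ⟨√(D * c), by positivity, ?_⟩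
  intro t ht ρ hρ
  have ht0 : t ∈ Ioo 0 T := ⟨lt_of_lt_of_le hσ.1 ht.1, ht.2⟩
  set X := (T - t) ^ (1/(1-m)) with hXd
  have hX : 0 ≤ X := Real.rpow_nonneg (by linarith [ht.2]) _
  have hρ0 : 0 < ρ := hρ.1
  have key := hb t ht ρ ρ hρ0 hρ0
  have hA := sinh_pow_pos n hρ0
  have hs : Real.sinh (ρ + ρ) ^ n ≤ c * ρ ^ n := by
    rw [hc, ← mul_pow]
    apply pow_le_pow_left₀ (Real.sinh_nonneg_iff.2 (by linarith))
    rw [← two_mul, Real.sinh_two_mul]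
    have e1 := sinh_le_two hρ0.le hρ.2
    have e2 : Real.cosh ρ ≤ Real.cosh 1 := by
      rw [Real.cosh_le_cosh, abs_of_pos hρ0, abs_one]; exact hρ.2
    have e3 := Real.cosh_pos ρ
    have e4 := Real.sinh_nonneg_iff.2 hρ0.le
    calc 2 * Real.sinh ρ * Real.cosh ρ ≤ 2 * (2 * ρ) * Real.cosh 1 := by gcongr
      _ = _ := by ring
  have hge : ρ ^ n ≤ Real.sinh ρ ^ n :=
    pow_le_pow_left₀ hρ0.le (Real.self_le_sinh_iff.2 hρ0.le) n
  have hp : 0 < ρ ^ (1 - ((n:ℝ)+3)/2) := Real.rpow_pos_of_pos hρ0 _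
  have hp2 : (ρ ^ (1 - ((n:ℝ)+3)/2)) ^ 2 * ρ ^ (n+1) = 1 := by
    rw [← Real.rpow_natCast, ← Real.rpow_natCast, ← Real.rpow_mul hρ0.le, ← Real.rpow_add hρ0]
    rw [show (1 - ((n:ℝ)+3)/2) * ((2:ℕ):ℝ) + ((n+1 : ℕ):ℝ) = 0 by push_cast; ring, Real.rpow_zero]
  apply le_of_sqq_le 
  · positivity
  have e5 : Mass n u ρ t ^ 2 * ρ ^ (n+1) ≤ D * X ^ 2 * c * (Real.sinh ρ ^ n) ^ 2 := by
    calc Mass n u ρ t ^ 2 * ρ ^ (n+1) = (Mass n u ρ t ^ 2 * ρ) * ρ ^ n := by ring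
      _ ≤ (D * X ^ 2 * (c * ρ ^ n)) * ρ ^ n := by
        apply mul_le_mul_of_nonneg_right _ (by positivity)
        exact key.trans (mul_le_mul_of_nonneg_left hs (by positivity))
      _ = D * X ^ 2 * c * (ρ ^ n) ^ 2 := by ring
      _ ≤ _ := by gcongr
  have e6 : (√(D * c) * X * (ρ ^ (1 - ((n:ℝ)+3)/2) * Real.sinh ρ ^ n)) ^ 2 * ρ ^ (n+1) =
      D * X ^ 2 * c * (Real.sinh ρ ^ n) ^ 2 := by
    calc _ = (√(D*c)) ^ 2 * X ^ 2 * (Real.sinh ρ ^ n) ^ 2 *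
          ((ρ ^ (1 - ((n:ℝ)+3)/2)) ^ 2 * ρ ^ (n+1)) := by ring
      _ = _ := by rw [hp2, Real.sq_sqrt (by positivity)]; ring
  rw [← e6] at e5
  exact le_of_mul_le_mul_right e5 (by positivity)

theorem Ctx.tl0 (h : Ctx n m T u wr ut) :
    MBd n m T u (Ici 1) (fun ρ => Real.exp (-(n/2*ρ))) := by
  intro σ hσ
  obtain ⟨D, hD, hb⟩ := h.mass_sq hσ
  set c := Real.exp n * 16 ^ n with hc
  have hcp : 0 < c := by positivity
  refine ⟨√(D * c), by positivity, ?_⟩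
  intro t ht ρ hρ
  have hρ1 : 1 ≤ ρ := hρ
  set X := (T - t) ^ (1/(1-m)) with hXd
  have hX : 0 ≤ X := Real.rpow_nonneg (by linarith [ht.2]) _
  have hρ0 : 0 < ρ := by linarith
  have key := hb t ht ρ 1 hρ0 one_pos
  have hA := sinh_pow_pos n hρ0
  have hs := sinh_pow_le n (by linarith : 0 ≤ ρ + 1)
  have hge := sinh_pow_ge n hρ1
  apply le_of_sqq_le
  · positivity
  have e1 : Real.exp (n*ρ) ≤ 4 ^ n * Real.sinh ρ ^ n := by
    rwa [div_le_iff₀' (by positivity)] at hge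
  have e2 : Real.exp (n*ρ) ^ 2 ≤ 16 ^ n * (Real.sinh ρ ^ n) ^ 2 := by
    calc _ ≤ (4 ^ n * Real.sinh ρ ^ n) ^ 2 := by gcongr
      _ = _ := by
        rw [mul_pow, ← pow_mul, mul_comm n 2, pow_mul]; norm_num
  have e3 : Real.exp (n*ρ) = Real.exp (-(n/2*ρ)) ^ 2 * Real.exp (n*ρ) ^ 2 := by
    rw [← Real.exp_nat_mul, ← Real.exp_nat_mul, ← Real.exp_add]; congr 1; push_cast; ring
  have e4 : Real.exp (n*(ρ+1)) = Real.exp n * Real.exp (n*ρ) := by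
    rw [← Real.exp_add]; congr 1; ring
  calc Mass n u ρ t ^ 2 ≤ D * X ^ 2 * Real.sinh (ρ + 1) ^ n := by linarith
    _ ≤ D * X ^ 2 * (Real.exp n * (Real.exp (-(n/2*ρ)) ^ 2 * Real.exp (n*ρ) ^ 2)) := by
      rw [← e3, ← e4]; gcongr
    _ ≤ D * X ^ 2 * (Real.exp n * (Real.exp (-(n/2*ρ)) ^ 2 * (16 ^ n * (Real.sinh ρ ^ n) ^ 2))) := by
      gcongr
    _ = (D * c) * X ^ 2 * (Real.exp (-(n/2*ρ)) * Real.sinh ρ ^ n) ^ 2 := by rw [hc]; ring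
    _ = (√(D * c)) ^ 2 * X ^ 2 * (Real.exp (-(n/2*ρ)) * Real.sinh ρ ^ n) ^ 2 := by
      rw [Real.sq_sqrt (by positivity)]
    _ = _ := by ring

/-- the generic smoothing step -/
theorem Ctx.stepU (h : Ctx n m T u wr ut) {f H : ℝ → ℝ} (hM : MBd n m T u (Ioi 0) f)
    (hf : ContinuousOn f (Ioi 0)) (hH0 : ∀ r, 0 < r → 0 ≤ H r)
    (hH : ∀ r R, 0 < r → r ≤ R → ∫ ρ in r..R, f ρ ≤ H r) :
    UBd m T u (Ioi 0) (fun r => H r ^ (1/m)) := by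
  have hm0 := h.hm0
  have hm1 := h.hm1
  have hT := h.hT
  intro σ hσ
  have hσ' : σ/2 ∈ Ioo 0 T := ⟨by linarith [hσ.1], by linarith [hσ.1, hσ.2]⟩
  obtain ⟨C, hC, hb⟩ := hM (σ/2) hσ'
  obtain ⟨K, hK1, hK⟩ := h.am (σ/2) hσ'
  obtain ⟨Cd, hCd, hd⟩ := h.dec (σ/2) hσ'
  set k := 1/(1-m) with hk
  have hk0 : 0 < k := by rw [hk]; apply div_pos one_pos; linarith
  set κ := σ / (2*T) with hκ
  have hσp := hσ.1
  have hκ0 : 0 < κ := by positivity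
  have hκ1 : κ ≤ 1 := by
    rw [hκ, div_le_one (by positivity)]; linarith [hσ.2]
  have hκT : κ * T = σ/2 := by rw [hκ]; field_simp
  set Q := K * C * 2 ^ k / κ with hQ
  have hQ0 : 0 < Q := by
    have : (0:ℝ) < 2 ^ k := Real.rpow_pos_of_pos (by norm_num) _
    positivity
  refine ⟨Q ^ (1/m), Real.rpow_pos_of_pos hQ0 _, ?_⟩
  intro t ht r hr
  have hr0 : 0 < r := hr
  have ht0 : t ∈ Ioo 0 T := ⟨lt_of_lt_of_le hσ.1 ht.1, ht.2⟩
  set θ := T - t with hθ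
  have hθ0 : 0 < θ := by rw [hθ]; linarith [ht.2]
  set t0 := t - κ * θ with ht0d
  have hκθ : 0 < κ * θ := by positivity
  have hle : κ * θ ≤ σ/2 := by
    rw [← hκT]; apply mul_le_mul_of_nonneg_left _ hκ0.le; rw [hθ]; linarith [ht0.1]
  have hs0 : σ/2 ≤ t0 := by rw [ht0d]; linarith [ht.1]
  have htt : t0 ≤ t := by rw [ht0d]; linarith
  have hm0' : t0 ∈ Ico (σ/2) T := ⟨hs0, lt_of_le_of_lt htt ht.2⟩
  have hm0'' : t0 ∈ Ioo 0 T := ⟨lt_of_lt_of_le hσ'.1 hs0, hm0'.2⟩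
  have hX : (T - t0) ^ k ≤ 2 ^ k * θ ^ k := by
    rw [← Real.mul_rpow (by norm_num) hθ0.le]
    apply Real.rpow_le_rpow
    · linarith [hm0'.2]
    · rw [ht0d]; nlinarith
    · exact hk0.le
  have hX0 : 0 ≤ (T - t0) ^ k := Real.rpow_nonneg (by linarith [hm0'.2]) _
  have hint : ∀ R, r ≤ R → ∫ ρ in r..R, Mass n u ρ t0 / Real.sinh ρ ^ n ≤
      C * (2 ^ k * θ ^ k) * H r := by
    intro R hR
    have hR0 : 0 < R := lt_of_lt_of_le hr0 hR
    have hfi : IntervalIntegrable f volume r R := by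
      apply ContinuousOn.intervalIntegrable
      apply hf.mono
      intro x hx
      rw [uIcc_of_le hR] at hx
      exact lt_of_lt_of_le hr0 hx.1
    have : ∫ ρ in r..R, Mass n u ρ t0 / Real.sinh ρ ^ n ≤
        ∫ ρ in r..R, C * (T - t0) ^ k * f ρ := by
      apply intervalIntegral.integral_mono_on hR (h.iMA hm0'' hr0 hR0) (hfi.const_mul _)
      intro x hx
      have hx0 : 0 < x := lt_of_lt_of_le hr0 hx.1
      rw [div_le_iff₀ (sinh_pow_pos n hx0)]
      exact (hb t0 hm0' x hx0).trans (le_of_eq (by ring))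
    rw [intervalIntegral.integral_const_mul] at this
    refine this.trans ?_
    have h1 := hH r R hr0 hR
    calc _ ≤ C * (T - t0) ^ k * H r := mul_le_mul_of_nonneg_left h1 (by positivity)
      _ ≤ _ := by
        apply mul_le_mul_of_nonneg_right _ (hH0 r hr0)
        gcongr
  have hR : ∀ R, r ≤ R → κ * θ * u r t ^ m ≤ K * (C * (2 ^ k * θ ^ k) * H r +
      κ * θ * (Cd * Real.exp (-(n/2*R)))) := by
    intro R hR
    have e := h.estII hσ' hK hK1 hd hs0 htt ht.2 hr0 hR
    have e1 : t - t0 = κ * θ := by rw [ht0d]; ring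
    rw [e1] at e
    refine e.trans ?_
    apply mul_le_mul_of_nonneg_left _ (by linarith)
    linarith [hint R hR]
  have hnp : (0:ℝ) < n := by exact_mod_cast h.hn
  have lim : Tendsto (fun R : ℝ => K * (C * (2 ^ k * θ ^ k) * H r +
      κ * θ * (Cd * Real.exp (-(n/2*R))))) atTop
      (𝓝 (K * (C * (2 ^ k * θ ^ k) * H r + κ * θ * (Cd * 0)))) := by
    have : Tendsto (fun R : ℝ => Real.exp (-((n:ℝ)/2*R))) atTop (𝓝 0) := by
      apply Real.tendsto_exp_neg_atTop_nhds_zero.comp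
      exact tendsto_id.const_mul_atTop (by positivity)
    exact ((this.const_mul _).const_mul _).const_add _ |>.const_mul _
  have fin := ge_of_tendsto lim (eventually_atTop.2 ⟨r, hR⟩)
  have hup := h.sol.pos r hr0.le t ht0
  have hw : u r t ^ m ≤ Q * θ ^ (k - 1) * H r := by
    rw [Real.rpow_sub_one hθ0.ne']
    rw [← mul_le_mul_iff_right₀ hκθ]
    refine fin.trans (le_of_eq ?_)
    rw [hQ]; field_simp; ring
  have hkm : (k - 1) * (1/m) = k := by
    rw [hk]
    have : 1 - m ≠ 0 := by linarith
    field_simp; ring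
  calc u r t = (u r t ^ m) ^ (1/m) := by
        rw [← Real.rpow_mul hup.le, mul_one_div_cancel hm0.ne', Real.rpow_one]
    _ ≤ (Q * θ ^ (k - 1) * H r) ^ (1/m) := 
        Real.rpow_le_rpow (Real.rpow_nonneg hup.le _) hw (by positivity)
    _ = _ := by
        have := hH0 r hr0
        rw [Real.mul_rpow (by positivity) this, Real.mul_rpow hQ0.le (by positivity),
          ← Real.rpow_mul hθ0.le, hkm]

end
end GHP

open MeasureTheory Set Filter Topology

namespace GHP
section
variable {n : ℕ} {m T : ℝ} {u wr ut : ℝ → ℝ → ℝ}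

theorem MBd.glue {f : ℝ → ℝ} (c c' : ℝ) (hc : 0 < c) (hc' : 0 < c') {g g' : ℝ → ℝ}
    (h : MBd n m T u (Ioc 0 1) g) (h' : MBd n m T u (Ici 1) g')
    (hg : ∀ ρ, 0 < ρ → ρ ≤ 1 → g ρ ≤ c * f ρ) (hg' : ∀ ρ, 1 ≤ ρ → g' ρ ≤ c' * f ρ)
    (hf : ∀ ρ, 0 < ρ → 0 ≤ f ρ) : MBd n m T u (Ioi 0) f := by
  have a := h.mono (g := f) c hc (S' := Ioc 0 1) Subset.rfl (fun ρ hρ => hρ.1.le)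
    (fun ρ hρ => hg ρ hρ.1 hρ.2)
  have b := h'.mono (g := f) c' hc' (S' := Ici 1) Subset.rfl
    (fun ρ hρ => zero_le_one.trans hρ) (fun ρ hρ => hg' ρ hρ)
  have p : ∀ ρ ∈ Ioc (0:ℝ) 1 ∪ Ici 1, 0 < ρ := by
    rintro ρ (hρ | hρ)
    · exact hρ.1
    · exact lt_of_lt_of_le one_pos hρ
  have c := a.union b (fun ρ hρ => hf ρ (p ρ hρ)) (fun ρ hρ => (p ρ hρ).le)
  refine c.mono 1 one_pos ?_ (fun ρ hρ => le_of_lt hρ) (fun ρ _ => by simp)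
  intro ρ hρ
  rcases le_total ρ 1 with h1 | h1
  · exact Or.inl ⟨hρ, h1⟩
  · exact Or.inr h1

theorem int_exp_le {β r R : ℝ} (hβ : 0 < β) :
    ∫ ρ in r..R, Real.exp (-(β*ρ)) ≤ Real.exp (-(β*r)) / β := by
  have := int_exp (-β) (by linarith) r R
  simp only [neg_mul] at this
  rw [this, div_neg, ← neg_div]
  gcongr
  linarith [Real.exp_pos (-(β*R))]

theorem Ctx.plstep (h : Ctx n m T u wr ut) {γ : ℝ} (hγ : 2 < γ) (hγn : (γ-2)/m < n + 1)
    (hP : MBd n m T u (Ioc 0 1) (fun ρ => ρ ^ (1 - γ))) :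
    MBd n m T u (Ioc 0 1) (fun ρ => ρ ^ (1 - (γ-2)/m)) := by
  have hm0 := h.hm0
  have hnp : (0:ℝ) < n := by exact_mod_cast h.hn
  set f : ℝ → ℝ := fun ρ => (ρ ^ (1 - γ) + 1) * Real.exp (-(n/2*ρ)) with hf
  have hfM : MBd n m T u (Ioi 0) f := by
    apply MBd.glue (Real.exp (n/2)) 1 (Real.exp_pos _) one_pos hP h.tl0
    · intro ρ h0 h1
      have e : 1 ≤ Real.exp (n/2) * Real.exp (-(n/2*ρ)) := by
        rw [← Real.exp_add]; apply Real.one_le_exp; nlinarith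
      have e2 : 0 < ρ ^ (1-γ) := Real.rpow_pos_of_pos h0 _
      calc ρ ^ (1-γ) ≤ (ρ ^ (1-γ) + 1) * 1 := by linarith
        _ ≤ (ρ ^ (1-γ) + 1) * (Real.exp (n/2) * Real.exp (-(n/2*ρ))) := by gcongr
        _ = _ := by rw [hf]; ring
    · intro ρ h1
      have e2 : 0 < ρ ^ (1-γ) := Real.rpow_pos_of_pos (by linarith) _
      have := Real.exp_pos (-(n/2*ρ))
      simp only [hf, one_mul]
      nlinarith
    · intro ρ h0
      have e2 : 0 < ρ ^ (1-γ) := Real.rpow_pos_of_pos h0 _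
      positivity
  have hcr : ContinuousOn (fun ρ : ℝ => ρ ^ (1 - γ)) (Ioi 0) := by
    intro x hx
    exact (Real.continuousAt_rpow_const x _ (Or.inl (ne_of_gt hx))).continuousWithinAt
  have hce : Continuous (fun ρ : ℝ => Real.exp (-((n:ℝ)/2*ρ))) := by fun_prop
  have hfc : ContinuousOn f (Ioi 0) := (hcr.add continuousOn_const).mul hce.continuousOn
  set H : ℝ → ℝ := fun r => r ^ (2 - γ) / (γ - 2) + 2 / n with hH
  have hγ2 : 0 < γ - 2 := by linarith
  have hU := h.stepU (H := H) hfM hfc (by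
    intro r hr
    have : 0 < r ^ (2-γ) := Real.rpow_pos_of_pos hr _
    simp only [hH]; positivity) (by
    intro r R hr hR
    have hsub : uIcc r R ⊆ Ioi 0 := by
      intro x hx; rw [uIcc_of_le hR] at hx; exact lt_of_lt_of_le hr hx.1
    have i1 : IntervalIntegrable (fun ρ : ℝ => ρ ^ (1 - γ)) volume r R :=
      (hcr.mono hsub).intervalIntegrable
    have i2 : IntervalIntegrable (fun ρ : ℝ => Real.exp (-((n:ℝ)/2*ρ))) volume r R :=
      hce.intervalIntegrable _ _
    have s1 : ∫ ρ in r..R, f ρ ≤ ∫ ρ in r..R, (ρ ^ (1 - γ) + Real.exp (-((n:ℝ)/2*ρ))) := by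
      apply intervalIntegral.integral_mono_on hR (hfc.mono hsub).intervalIntegrable (i1.add i2)
      intro x hx
      have hx0 : 0 < x := lt_of_lt_of_le hr hx.1
      have e2 : 0 < x ^ (1-γ) := Real.rpow_pos_of_pos hx0 _
      have e3 : Real.exp (-((n:ℝ)/2*x)) ≤ 1 := by
        rw [Real.exp_le_one_iff]; have : 0 < (n:ℝ)/2*x := by positivity
        linarith
      simp only [hf]
      nlinarith
    rw [intervalIntegral.integral_add i1 i2] at s1
    have s2 : ∫ ρ in r..R, ρ ^ (1 - γ) ≤ r ^ (2 - γ) / (γ - 2) := by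
      rw [integral_rpow (Or.inr ⟨by linarith, fun h0 => lt_irrefl (0:ℝ) (mem_Ioi.1 (hsub h0))⟩)]
      rw [show 1 - γ + 1 = -(γ - 2) by ring, div_neg, ← neg_div, show 2 - γ = -(γ-2) by ring]
      have : 0 < R ^ (-(γ-2)) := Real.rpow_pos_of_pos (lt_of_lt_of_le hr hR) _
      gcongr
      linarith
    have s3 := int_exp_le (β := (n:ℝ)/2) (r := r) (R := R) (by positivity)
    have s4 : Real.exp (-((n:ℝ)/2*r)) / ((n:ℝ)/2) ≤ 2 / n := by
      rw [div_div_eq_mul_div]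
      apply div_le_div_of_nonneg_right _ hnp.le
      have e3 : Real.exp (-((n:ℝ)/2*r)) ≤ 1 := by
        rw [Real.exp_le_one_iff]; have : 0 < (n:ℝ)/2*r := by positivity
        linarith
      linarith
    simp only [hH]
    linarith)
  set c0 := 1/(γ-2) + 2/n with hc0
  have hc0p : 0 < c0 := by positivity
  have hU1 : UBd m T u (Ioc 0 1) (fun r => r ^ (-((γ-2)/m))) := by
    refine hU.mono (c0 ^ (1/m)) (Real.rpow_pos_of_pos hc0p _) (fun x hx => hx.1) ?_
    intro r hr
    have hr0 := hr.1
    have e1 : 1 ≤ r ^ (2 - γ) :=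
      Real.one_le_rpow_of_pos_of_le_one_of_nonpos hr.1 hr.2 (by linarith)
    have e2 : H r ≤ c0 * r ^ (2 - γ) := by
      simp only [hH, hc0, add_mul]
      have : 2 / (n:ℝ) * 1 ≤ 2/(n:ℝ) * r ^ (2-γ) := by gcongr
      have : r ^ (2 - γ) / (γ - 2) = 1/(γ-2) * r ^ (2-γ) := by ring
      linarith
    have e3 : 0 ≤ H r := by simp only [hH]; positivity
    calc H r ^ (1/m) ≤ (c0 * r ^ (2-γ)) ^ (1/m) := Real.rpow_le_rpow e3 e2 (by positivity)
      _ = c0 ^ (1/m) * r ^ (-((γ-2)/m)) := by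
        rw [Real.mul_rpow hc0p.le (by positivity), ← Real.rpow_mul hr0.le]
        congr 2; ring
  set γ' := (γ-2)/m with hγ'
  intro σ hσ
  obtain ⟨C, hC, hb⟩ := hU1 σ hσ
  have hq : 0 < (n:ℝ) + 1 - γ' := by linarith
  refine ⟨C * (2 ^ n / ((n:ℝ) + 1 - γ')), by positivity, ?_⟩
  intro t ht ρ hρ
  have ht0 : t ∈ Ioo 0 T := ⟨lt_of_lt_of_le hσ.1 ht.1, ht.2⟩
  set X := (T - t) ^ (1/(1-m)) with hXd
  have hX : 0 ≤ X := Real.rpow_nonneg (by linarith [ht.2]) _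
  have hρ0 := hρ.1
  have s1 : Mass n u ρ t ≤ ∫ x in 0..ρ, C * X * 2 ^ n * x ^ ((n:ℝ) - γ') := by
    apply intervalIntegral.integral_mono_on_of_le_Ioo hρ0.le (h.iAu ht0 le_rfl hρ0.le)
    · exact (intervalIntegral.intervalIntegrable_rpow' (by linarith)).const_mul _
    · intro x hx
      have hx0 := hx.1
      have hx1 : x ≤ 1 := hx.2.le.trans hρ.2
      have e1 := hb t ht x ⟨hx0, hx1⟩
      have e2 : Real.sinh x ^ n ≤ (2 * x) ^ n :=
        pow_le_pow_left₀ (Real.sinh_nonneg_iff.2 hx0.le) (sinh_le_two hx0.le hx1) n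
      have e3 := (h.sol.pos x hx0.le t ht0).le
      have e4 : x ^ ((n:ℝ) - γ') = x ^ n * x ^ (-γ') := by
        rw [sub_eq_add_neg, Real.rpow_add hx0, Real.rpow_natCast]
      calc Real.sinh x ^ n * u x t ≤ (2*x) ^ n * (C * X * x ^ (-γ')) :=
            mul_le_mul e2 e1 e3 (by positivity)
        _ = _ := by rw [e4, mul_pow]; ring
  rw [intervalIntegral.integral_const_mul, integral_rpow (Or.inl (by linarith)),
    Real.zero_rpow (by linarith), sub_zero] at s1
  have e5 : ρ ^ ((n:ℝ) - γ' + 1) = ρ ^ (1 - γ') * ρ ^ n := by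
    rw [← Real.rpow_natCast, ← Real.rpow_add hρ0]; congr 1; ring
  have hge : ρ ^ n ≤ Real.sinh ρ ^ n :=
    pow_le_pow_left₀ hρ0.le (Real.self_le_sinh_iff.2 hρ0.le) n
  rw [e5] at s1
  have hpp : 0 < ρ ^ (1-γ') := Real.rpow_pos_of_pos hρ0 _
  calc _ ≤ _ := s1
    _ = C * (2 ^ n / ((n:ℝ) + 1 - γ')) * X * (ρ ^ (1-γ') * ρ ^ n) := by
      rw [show (n:ℝ) - γ' + 1 = n + 1 - γ' by ring]; ring
    _ ≤ _ := by gcongr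

theorem Ctx.pl1 (h : Ctx n m T u wr ut) (hms : ((n:ℝ) - 1)/(n+3) < m) :
    MBd n m T u (Ioc 0 1) (fun ρ => ρ ^ (1 - (1:ℝ))) := by
  have hm0 := h.hm0
  have hm1 := h.hm1
  have hnp : (1:ℝ) ≤ n := by exact_mod_cast h.hn
  set gs := 2/(1-m) with hgs
  set g0 := ((n:ℝ)+3)/2 with hg0
  have h1m : 0 < 1 - m := by linarith
  have hlt : g0 < gs := by
    rw [hg0, hgs, lt_div_iff₀ h1m]
    rw [div_lt_iff₀ (by linarith)] at hms
    nlinarith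
  have hrec : ∀ x, (x - 2)/m = gs - (gs - x)/m := by
    intro x
    rw [hgs]; field_simp; ring
  have main : ∀ j : ℕ, MBd n m T u (Ioc 0 1)
      (fun ρ => ρ ^ (1 - max 1 (gs - (gs - g0)/m^j))) := by
    intro j
    have mono : ∀ a b : ℝ, a ≤ b → MBd n m T u (Ioc 0 1) (fun ρ => ρ ^ (1 - a)) →
        MBd n m T u (Ioc 0 1) (fun ρ => ρ ^ (1 - b)) := by
      intro a b hab hM
      refine hM.mono 1 one_pos Subset.rfl (fun ρ hρ => hρ.1.le) ?_
      intro ρ hρ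
      rw [one_mul]
      exact Real.rpow_le_rpow_of_exponent_ge hρ.1 hρ.2 (by linarith)
    induction j with
    | zero =>
      refine mono _ _ ?_ h.pl0
      apply le_max_of_le_right
      simp [hg0]
    | succ j ih =>
      set gj := gs - (gs - g0)/m^j with hgj
      have hnext : (gj - 2)/m = gs - (gs - g0)/m^(j+1) := by
        rw [hrec, hgj, pow_succ]; field_simp; ring
      have hmx : (max (2+m) gj - 2)/m = max 1 (gs - (gs - g0)/m^(j+1)) := by
        rw [← hnext]
        rcases le_total gj (2+m) with hc | hc
        · rw [max_eq_left hc, max_eq_left]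
          · field_simp; ring
          · rw [div_le_one hm0]; linarith
        · rw [max_eq_right hc, max_eq_right]
          rw [le_div_iff₀ hm0]; linarith
      rw [← hmx]
      apply h.plstep
      · exact lt_max_of_lt_left (by linarith)
      · rw [hmx]
        apply max_lt
        · linarith
        · have : (gs - g0) ≤ (gs - g0)/m^(j+1) := by
            rw [le_div_iff₀ (by positivity)]
            have : m^(j+1) ≤ 1 := pow_le_one₀ hm0.le hm1.le
            nlinarith
          have hm' : g0 ≤ n + 1 := by rw [hg0]; linarith
          have hp : m^(j+1) < 1 := pow_lt_one₀ hm0.le hm1 (by omega)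
          have : (gs - g0) < (gs - g0)/m^(j+1) := by
            rw [lt_div_iff₀ (by positivity)]
            nlinarith
          linarith
      · refine mono _ _ ?_ ih
        apply max_le_max_right
        linarith
  have hgap : 0 < gs - g0 := by linarith
  obtain ⟨j, hj⟩ := exists_pow_lt_of_lt_one (show 0 < (gs - g0)/(gs+1) by
    have : 0 < gs := by positivity
    positivity) hm1
  have := main j
  have hle : gs - (gs - g0)/m^j ≤ 1 := by
    have hgsp : 0 < gs := by positivity
    rw [lt_div_iff₀ (by linarith)] at hj
    have : gs + 1 ≤ (gs - g0)/m^j := by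
      rw [le_div_iff₀ (by positivity)]; linarith
    linarith
  rwa [max_eq_left hle] at this

theorem Ctx.mexp (h : Ctx n m T u wr ut) (hms : ((n:ℝ) - 1)/(n+3) < m) :
    MBd n m T u (Ioi 0) (fun ρ => Real.exp (-((n:ℝ)/2*ρ))) := by
  refine MBd.glue (Real.exp (n/2)) 1 (Real.exp_pos _) one_pos (h.pl1 hms) h.tl0 ?_ ?_ ?_
  · intro ρ h0 h1
    have hnp : (0:ℝ) < n := by exact_mod_cast h.hn
    have e : 1 ≤ Real.exp (n/2) * Real.exp (-(n/2*ρ)) := by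
      rw [← Real.exp_add]; apply Real.one_le_exp; nlinarith
    simpa using e
  · intro ρ h1; simp
  · intro ρ h0; positivity

theorem Ctx.stepE (h : Ctx n m T u wr ut) {β : ℝ} (hβ : 0 < β)
    (hM : MBd n m T u (Ioi 0) (fun ρ => Real.exp (-(β*ρ)))) :
    UBd m T u (Ioi 0) (fun ρ => Real.exp (-(β/m*ρ))) := by
  have hm0 := h.hm0
  have := h.stepU (H := fun r => Real.exp (-(β*r))/β) hM (by fun_prop) (by intro r hr; positivity)
    (fun r R _ _ => int_exp_le hβ)
  refine this.mono ((1/β)^(1/m)) (Real.rpow_pos_of_pos (by positivity) _) Subset.rfl ?_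
  intro r hr
  apply le_of_eq
  rw [div_eq_mul_one_div, Real.mul_rpow (Real.exp_pos _).le (by positivity), mul_comm,
    ← Real.exp_mul]
  congr 2; ring

theorem Ctx.stepM (h : Ctx n m T u wr ut) {β β' : ℝ} {c : ℝ} (hc : 0 < c)
    (hU : UBd m T u (Ioi 0) (fun ρ => Real.exp (-(β*ρ))))
    (hI : ∀ ρ, 0 ≤ ρ → ∫ x in 0..ρ, Real.sinh x ^ n * Real.exp (-(β * x)) ≤
      c * (Real.exp (-(β'*ρ)) * Real.sinh ρ ^ n)) :
    MBd n m T u (Ioi 0) (fun ρ => Real.exp (-(β'*ρ))) := by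
  intro σ hσ
  obtain ⟨C, hC, hb⟩ := hU σ hσ
  refine ⟨C * c, by positivity, ?_⟩
  intro t ht ρ hρ
  have hρ0 : 0 < ρ := hρ
  have ht0 : t ∈ Ioo 0 T := ⟨lt_of_lt_of_le hσ.1 ht.1, ht.2⟩
  set X := (T - t) ^ (1/(1-m)) with hXd
  have hX : 0 ≤ X := Real.rpow_nonneg (by linarith [ht.2]) _
  have := h.M_le_of_le ht0 hρ0.le (f := fun x => C * X * Real.exp (-(β*x))) (by fun_prop)
    (fun x hx _ => hb t ht x hx)
  have e : ∫ x in 0..ρ, Real.sinh x ^ n * (C * X * Real.exp (-(β*x))) =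
      C * X * ∫ x in 0..ρ, Real.sinh x ^ n * Real.exp (-(β*x)) := by
    rw [← intervalIntegral.integral_const_mul]
    congr 1; ext x; ring
  rw [e] at this
  refine this.trans ?_
  calc _ ≤ C * X * (c * (Real.exp (-(β'*ρ)) * Real.sinh ρ ^ n)) :=
        mul_le_mul_of_nonneg_left (hI ρ hρ0.le) (by positivity)
    _ = _ := by ring

theorem Ctx.massn (h : Ctx n m T u wr ut) (hms : ((n:ℝ) - 1)/(n+3) < m) :
    MBd n m T u (Ioi 0) (fun ρ => Real.exp (-((n:ℝ)*ρ))) ∧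
    UBd m T u (Ioi 0) (fun ρ => Real.exp (-((n:ℝ)/m*ρ))) := by
  have hm0 := h.hm0
  have hm1 := h.hm1
  have hnp : (0:ℝ) < n := by exact_mod_cast h.hn
  have mono : ∀ a b : ℝ, b ≤ a → UBd m T u (Ioi 0) (fun ρ => Real.exp (-(a*ρ))) →
      UBd m T u (Ioi 0) (fun ρ => Real.exp (-(b*ρ))) := by
    intro a b hab hU
    refine hU.mono 1 one_pos Subset.rfl ?_
    intro ρ hρ
    have : 0 < ρ := hρ
    rw [one_mul, Real.exp_le_exp]
    nlinarith
  have step : ∀ β : ℝ, 0 < β → β < n → UBd m T u (Ioi 0) (fun ρ => Real.exp (-(β*ρ))) →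
      UBd m T u (Ioi 0) (fun ρ => Real.exp (-(β/m*ρ))) := by
    intro β h0 h1 hU
    apply h.stepE h0
    have : 0 < (n:ℝ) - β := by linarith
    exact h.stepM (c := 1/(n-β)) (by positivity) hU (fun ρ hρ => expA_lt n h1 hρ)
  set b := (n:ℝ)*(1+m)/2 with hb
  have hb0 : 0 < b := by positivity
  have hbn : b < n := by rw [hb]; nlinarith
  have main : ∀ j : ℕ, UBd m T u (Ioi 0) (fun ρ => Real.exp (-(min b ((n:ℝ)/2/m^j)*ρ))) := by
    intro j
    induction j with
    | zero =>
      refine mono ((n:ℝ)/2/m) _ ?_ (h.stepE (by positivity) (h.mexp hms))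
      refine (min_le_right _ _).trans ?_
      rw [pow_zero, div_one, le_div_iff₀ hm0]
      nlinarith
    | succ j ih =>
      have := step _ (lt_min hb0 (by positivity)) (lt_of_le_of_lt (min_le_left _ _) hbn) ih
      refine mono _ _ ?_ this
      rw [le_div_iff₀ hm0]
      apply le_min
      · calc _ ≤ b * m := mul_le_mul_of_nonneg_right (min_le_left _ _) hm0.le
          _ ≤ b := by nlinarith
      · calc _ ≤ (n:ℝ)/2/m^(j+1) * m := mul_le_mul_of_nonneg_right (min_le_right _ _) hm0.le
          _ = _ := by rw [pow_succ]; field_simp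
  obtain ⟨j, hj⟩ := exists_pow_lt_of_lt_one (show 0 < (1/2:ℝ) by norm_num) hm1
  have hU := main j
  have hle : b ≤ (n:ℝ)/2/m^j := by
    rw [le_div_iff₀ (by positivity)]
    nlinarith
  rw [min_eq_left hle] at hU
  have hU2 := step b hb0 hbn hU
  have hgt : (n:ℝ) < b/m := by
    rw [lt_div_iff₀ hm0, hb]; nlinarith
  have hp : 0 < b/m - n := by linarith
  have hM := h.stepM (c := 1/(b/m - n)) (β' := n) (by positivity) hU2
    (fun ρ hρ => expA_gt n hgt hρ)
  exact ⟨hM, h.stepE hnp hM⟩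

end
end GHP

open MeasureTheory Set Filter Topology

namespace GHP
section
variable {n : ℕ} {m T : ℝ} {u wr ut : ℝ → ℝ → ℝ}

theorem Ctx.M_pos (h : Ctx n m T u wr ut) {t : ℝ} (ht : t ∈ Ioo 0 T) {a : ℝ} (ha : 0 < a) :
    0 < Mass n u a t := by
  apply intervalIntegral.intervalIntegral_pos_of_pos_on (h.iAu ht le_rfl ha.le) _ ha
  intro x hx
  exact mul_pos (sinh_pow_pos n hx.1) (h.sol.pos x hx.1.le t ht)

/-- one step with explicit constant -/
theorem Ctx.stepL (h : Ctx n m T u wr ut) {σ : ℝ} (hσ : σ ∈ Ioo 0 T) :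
    ∃ Q > 0, ∀ s t, σ ≤ s → s < t → t < T → ∀ S, 0 ≤ S →
      (∀ ρ, 0 < ρ → Mass n u ρ s ≤ S * (Real.exp (-((n:ℝ)/2*ρ)) * Real.sinh ρ ^ n)) →
      (∀ ρ, 0 < ρ → Mass n u ρ t ≤ Q * (S/(t-s)) ^ (1/m) *
        (Real.exp (-((n:ℝ)/2*ρ)) * Real.sinh ρ ^ n)) := by
  have hm0 := h.hm0
  have hm1 := h.hm1
  have hnp : (0:ℝ) < n := by exact_mod_cast h.hn
  obtain ⟨K, hK1, hK⟩ := h.am σ hσ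
  obtain ⟨Cd, hCd, hd⟩ := h.dec σ hσ
  have hKp : 0 < K := by linarith
  set P := K / ((n:ℝ)/2) with hP
  have hP0 : 0 < P := by positivity
  refine ⟨P ^ (1/m) * (1/((n:ℝ) - n/2)), ?_, ?_⟩
  · have : 0 < (n:ℝ) - n/2 := by linarith
    have := Real.rpow_pos_of_pos hP0 (1/m)
    positivity
  intro s t hs hst htT S hS hM
  have hsm : s ∈ Ioo 0 T := ⟨lt_of_lt_of_le hσ.1 hs, hst.trans htT⟩
  have htm : t ∈ Ioo 0 T := ⟨hsm.1.trans hst, htT⟩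
  have hτ : 0 < t - s := by linarith
  have hu : ∀ r, 0 < r → u r t ≤ (P * (S/(t-s))) ^ (1/m) * Real.exp (-((n:ℝ)/2*r)) := by
    intro r hr
    have hint : ∀ R, r ≤ R → ∫ ρ in r..R, Mass n u ρ s / Real.sinh ρ ^ n ≤
        S * (Real.exp (-((n:ℝ)/2*r)) / ((n:ℝ)/2)) := by
      intro R hR
      have hR0 : 0 < R := lt_of_lt_of_le hr hR
      have : ∫ ρ in r..R, Mass n u ρ s / Real.sinh ρ ^ n ≤
          ∫ ρ in r..R, S * Real.exp (-((n:ℝ)/2*ρ)) := by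
        apply intervalIntegral.integral_mono_on hR (h.iMA hsm hr hR0)
        · apply Continuous.intervalIntegrable; fun_prop
        intro x hx
        have hx0 : 0 < x := lt_of_lt_of_le hr hx.1
        rw [div_le_iff₀ (sinh_pow_pos n hx0)]
        exact (hM x hx0).trans (le_of_eq (by ring))
      rw [intervalIntegral.integral_const_mul] at this
      exact this.trans (mul_le_mul_of_nonneg_left (int_exp_le (by positivity)) hS)
    have hR : ∀ R, r ≤ R → (t-s) * u r t ^ m ≤ K * (S * (Real.exp (-((n:ℝ)/2*r)) / ((n:ℝ)/2)) +
        (t-s) * (Cd * Real.exp (-(n/2*R)))) := by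
      intro R hR
      have e := h.estII hσ hK hK1 hd hs hst.le htT hr hR
      refine e.trans ?_
      apply mul_le_mul_of_nonneg_left _ (by linarith)
      linarith [hint R hR]
    have lim : Tendsto (fun R : ℝ => K * (S * (Real.exp (-((n:ℝ)/2*r)) / ((n:ℝ)/2)) +
        (t-s) * (Cd * Real.exp (-(n/2*R))))) atTop
        (𝓝 (K * (S * (Real.exp (-((n:ℝ)/2*r)) / ((n:ℝ)/2)) + (t-s) * (Cd * 0)))) := by
      have : Tendsto (fun R : ℝ => Real.exp (-((n:ℝ)/2*R))) atTop (𝓝 0) := by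
        apply Real.tendsto_exp_neg_atTop_nhds_zero.comp
        exact tendsto_id.const_mul_atTop (by positivity)
      exact ((this.const_mul _).const_mul _).const_add _ |>.const_mul _
    have fin := ge_of_tendsto lim (eventually_atTop.2 ⟨r, hR⟩)
    have hup := h.sol.pos r hr.le t htm
    have hw : u r t ^ m ≤ P * (S/(t-s)) * Real.exp (-((n:ℝ)/2*r)) := by
      rw [← mul_le_mul_iff_right₀ hτ]
      refine fin.trans (le_of_eq ?_)
      rw [hP]; field_simp; ring
    calc u r t = (u r t ^ m) ^ (1/m) := by
          rw [← Real.rpow_mul hup.le, mul_one_div_cancel hm0.ne', Real.rpow_one]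
      _ ≤ (P * (S/(t-s)) * Real.exp (-((n:ℝ)/2*r))) ^ (1/m) :=
          Real.rpow_le_rpow (Real.rpow_nonneg hup.le _) hw (by positivity)
      _ = (P * (S/(t-s))) ^ (1/m) * Real.exp (-((n:ℝ)/2*r) * (1/m)) := by
          rw [Real.mul_rpow (by positivity) (by positivity), ← Real.exp_mul]
      _ ≤ _ := by
          apply mul_le_mul_of_nonneg_left _ (by positivity)
          apply Real.exp_le_exp.2
          have : 1 ≤ 1/m := by rw [le_div_iff₀ hm0]; linarith
          have h2 : 0 < (n:ℝ)/2*r := by positivity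
          nlinarith
  intro ρ hρ
  have := h.M_le_of_le htm hρ.le
    (f := fun x => (P * (S/(t-s))) ^ (1/m) * Real.exp (-((n:ℝ)/2*x))) (by fun_prop)
    (fun x hx _ => hu x hx)
  have e : ∫ x in 0..ρ, Real.sinh x ^ n * ((P * (S/(t-s))) ^ (1/m) * Real.exp (-((n:ℝ)/2*x))) =
      (P * (S/(t-s))) ^ (1/m) * ∫ x in 0..ρ, Real.sinh x ^ n * Real.exp (-((n:ℝ)/2*x)) := by
    rw [← intervalIntegral.integral_const_mul]
    congr 1; ext x; ring
  rw [e] at this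
  refine this.trans ?_
  have hI := expA_lt n (β := (n:ℝ)/2) (ρ := ρ) (by linarith) hρ.le
  refine (mul_le_mul_of_nonneg_left hI (by positivity)).trans (le_of_eq ?_)
  rw [Real.mul_rpow hP0.le (by positivity)]
  ring

theorem Ctx.lowS (h : Ctx n m T u wr ut) {σ : ℝ} (hσ : σ ∈ Ioo 0 T) :
    ∃ c > 0, ∀ t ∈ Ico σ T, ¬ (∀ ρ, 0 < ρ → Mass n u ρ t ≤
      c * (T-t)^(1/(1-m)) * (Real.exp (-((n:ℝ)/2*ρ)) * Real.sinh ρ ^ n)) := by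
  have hm0 := h.hm0
  have hm1 := h.hm1
  have h1m : 0 < 1 - m := by linarith
  obtain ⟨Q, hQ, hstep⟩ := h.stepL hσ
  obtain ⟨K, hK1, hK⟩ := h.am σ hσ
  set k := 1/(1-m) with hk
  have hk0 : 0 < k := by positivity
  set B := Q * 2 ^ k * 4 ^ (1/m) with hB
  have hB0 : 0 < B := by positivity
  set c := B ^ (-(m/(1-m))) with hc
  have hc0 : 0 < c := Real.rpow_pos_of_pos hB0 _
  have hcB : B * c ^ (1/m) = c := by
    rw [hc, ← Real.rpow_mul hB0.le]
    nth_rewrite 1 [← Real.rpow_one B]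
    rw [← Real.rpow_add hB0]
    congr 1; field_simp; ring
  refine ⟨c, hc0, ?_⟩
  intro t ht hM
  have ht0 : t ∈ Ioo 0 T := ⟨lt_of_lt_of_le hσ.1 ht.1, ht.2⟩
  set θ := T - t with hθ
  have hθ0 : 0 < θ := by rw [hθ]; linarith [ht.2]
  have hkm : (k - 1) * (1/m) = k := by
    rw [hk]; field_simp; ring
  have hhalf : ∀ j : ℕ, (1/2:ℝ)^j ≤ 1 := fun j => pow_le_one₀ (by norm_num) (by norm_num)
  have hhalfp : ∀ j : ℕ, 0 < (1/2:ℝ)^j := fun j => by positivity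
  set tt : ℕ → ℝ := fun j => t + θ/2 * (1 - (1/2:ℝ)^j) with htt
  have htt1 : ∀ j, t ≤ tt j := by
    intro j; simp only [htt]
    have := mul_nonneg (by linarith : 0 ≤ θ/2) (sub_nonneg.2 (hhalf j)); linarith
  have htt2 : ∀ j, tt j ≤ t + θ/2 := by
    intro j; simp only [htt]
    have := mul_pos (by linarith : 0 < θ/2) (hhalfp j); linarith
  have main : ∀ j : ℕ, ∀ ρ, 0 < ρ → Mass n u ρ (tt j) ≤
      c * (θ * (1/2)^j) ^ k * (Real.exp (-((n:ℝ)/2*ρ)) * Real.sinh ρ ^ n) := by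
    intro j
    induction j with
    | zero => simpa [htt] using hM
    | succ j ih =>
      have hx : 0 < θ * (1/2:ℝ)^j := mul_pos hθ0 (hhalfp j)
      have hd : tt (j+1) - tt j = (θ * (1/2:ℝ)^j) / 4 := by
        simp only [htt, pow_succ]; ring
      have := hstep (tt j) (tt (j+1)) (ht.1.trans (htt1 j)) (by linarith)
        (by have := htt2 (j+1); linarith) _ (by positivity) ih
      rw [hd] at this
      intro ρ hρ
      refine (this ρ hρ).trans (le_of_eq ?_)
      congr 1
      set x := θ * (1/2:ℝ)^j with hxd
      have e1 : c * x ^ k / (x/4) = 4 * c * x ^ (k-1) := by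
        rw [Real.rpow_sub_one hx.ne']; field_simp
      have e2 : θ * (1/2:ℝ)^(j+1) = x * (1/2) := by rw [hxd, pow_succ]; ring
      have e3 : (1/2:ℝ)^k * 2 ^ k = 1 := by
        rw [← Real.mul_rpow (by norm_num) (by norm_num)]; norm_num
      rw [e1, e2, Real.mul_rpow (by positivity) (by positivity),
        Real.mul_rpow (by norm_num) hc0.le, ← Real.rpow_mul hx.le, hkm,
        Real.mul_rpow hx.le (by norm_num)]
      calc Q * (4 ^ (1/m) * c ^ (1/m) * x ^ k)
          = Q * (4 ^ (1/m) * c ^ (1/m) * x ^ k) * ((1/2:ℝ)^k * 2 ^ k) := by rw [e3, mul_one]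
        _ = (B * c ^ (1/m)) * (x ^ k * (1/2)^k) := by rw [hB]; ring
        _ = _ := by rw [hcB]
  have htm : t + θ/2 ∈ Ioo 0 T := ⟨by linarith [ht0.1], by linarith⟩
  have hpos := h.M_pos htm one_pos
  have hle : ∀ j : ℕ, Mass n u 1 (t + θ/2) ≤
      K * (c * (θ * (1/2)^j) ^ k * (Real.exp (-((n:ℝ)/2*1)) * Real.sinh 1 ^ n)) := by
    intro j
    have hj : tt j ∈ Ioo 0 T := ⟨lt_of_lt_of_le ht0.1 (htt1 j), lt_of_le_of_lt (htt2 j) htm.2⟩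
    have e := h.M_am hj htm (K := K)
      (fun r hr => (hK r hr (tt j) (t+θ/2) (ht.1.trans (htt1 j)) (htt2 j) htm.2).1) zero_le_one
    exact e.trans (mul_le_mul_of_nonneg_left (main j 1 one_pos) (by linarith))
  have lim : Tendsto (fun j : ℕ => K * (c * (θ * (1/2:ℝ)^j) ^ k *
      (Real.exp (-((n:ℝ)/2*1)) * Real.sinh 1 ^ n))) atTop
      (𝓝 (K * (c * 0 * (Real.exp (-((n:ℝ)/2*1)) * Real.sinh 1 ^ n)))) := by
    have e1 : Tendsto (fun j : ℕ => θ * (1/2:ℝ)^j) atTop (𝓝 (θ * 0)) :=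
      (tendsto_pow_atTop_nhds_zero_of_lt_one (by norm_num) (by norm_num)).const_mul _
    have e2 : Tendsto (fun j : ℕ => (θ * (1/2:ℝ)^j) ^ k) atTop (𝓝 ((θ * 0) ^ k)) :=
      e1.rpow_const (Or.inr hk0.le)
    rw [mul_zero, Real.zero_rpow hk0.ne'] at e2
    exact ((e2.const_mul c).mul_const _).const_mul K
  have := ge_of_tendsto' lim hle
  simp only [mul_zero, zero_mul] at this
  linarith

theorem Ctx.massL (h : Ctx n m T u wr ut) (hms : ((n:ℝ) - 1)/(n+3) < m) {σ : ℝ}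
    (hσ : σ ∈ Ioo 0 T) :
    ∃ L > 0, ∃ c > 0, ∀ t ∈ Ico σ T, c * (T-t)^(1/(1-m)) ≤ Mass n u L t := by
  have hm0 := h.hm0
  have hnp : (0:ℝ) < n := by exact_mod_cast h.hn
  obtain ⟨hMB, hUB⟩ := h.massn hms
  obtain ⟨C, hC, hM⟩ := hMB σ hσ
  obtain ⟨C', hC', hU⟩ := hUB σ hσ
  obtain ⟨c0, hc0, hno⟩ := h.lowS hσ
  set L := 1 + C/c0 * (2/n) with hL
  have hL1 : 1 ≤ L := by
    have : 0 < C/c0 * (2/n) := by positivity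
    linarith
  have hLe : C * Real.exp (-((n:ℝ)/2*L)) ≤ c0 := by
    have e1 : C/c0 ≤ Real.exp ((n:ℝ)/2*L) := by
      refine le_trans ?_ (Real.add_one_le_exp _)
      have : (n:ℝ)/2*L = n/2 + C/c0 := by rw [hL]; field_simp
      rw [this]
      linarith
    rw [Real.exp_neg, ← div_eq_mul_inv, div_le_iff₀ (Real.exp_pos _)]
    rw [div_le_iff₀ hc0] at e1
    linarith
  set E := Real.exp (-((n:ℝ)/2*L)) with hE
  have hE0 : 0 < E := Real.exp_pos _
  set l := min 1 (c0 * E / C') with hl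
  have hl0 : 0 < l := lt_min one_pos (by positivity)
  have hlC : C' * l ≤ c0 * E := by
    have : l ≤ c0 * E / C' := min_le_right _ _
    rw [le_div_iff₀ hC'] at this
    linarith
  have hA := sinh_pow_pos n hl0
  refine ⟨L, by linarith, c0 * E * Real.sinh l ^ n, by positivity, ?_⟩
  intro t ht
  by_contra hcon
  push Not at hcon
  apply hno t ht
  have ht0 : t ∈ Ioo 0 T := ⟨lt_of_lt_of_le hσ.1 ht.1, ht.2⟩
  set X := (T - t) ^ (1/(1-m)) with hXd
  have hX : 0 ≤ X := Real.rpow_nonneg (by linarith [ht.2]) _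
  intro ρ hρ
  have hAρ := sinh_pow_pos n hρ
  have hEρ : ρ ≤ L → E ≤ Real.exp (-((n:ℝ)/2*ρ)) := by
    intro hh
    apply Real.exp_le_exp.2
    have : (n:ℝ)/2*ρ ≤ n/2*L := by gcongr
    linarith
  rcases le_total ρ l with h1 | h1
  · have h1L : ρ ≤ L := h1.trans ((min_le_left _ _).trans hL1)
    have e := h.M_le_of_le ht0 hρ.le (f := fun _ => C' * X) (by fun_prop) (by
      intro x hx _
      refine (hU t ht x hx).trans ?_
      have : Real.exp (-((n:ℝ)/m*x)) ≤ 1 := by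
        rw [Real.exp_le_one_iff]
        have : 0 < (n:ℝ)/m*x := by positivity
        linarith
      exact mul_le_of_le_one_right (by positivity) this)
    have e2 : ∫ x in 0..ρ, Real.sinh x ^ n * (C' * X) ≤ ∫ x in 0..ρ, Real.sinh ρ ^ n * (C' * X) := by
      have cs := Real.continuous_sinh
      apply intervalIntegral.integral_mono_on hρ.le
      · apply Continuous.intervalIntegrable; fun_prop
      · exact intervalIntegrable_const
      intro x hx
      exact mul_le_mul_of_nonneg_right (sinh_mono_pow n hx.1 hx.2) (by positivity)
    rw [intervalIntegral.integral_const, smul_eq_mul, sub_zero] at e2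
    calc Mass n u ρ t ≤ ρ * (Real.sinh ρ ^ n * (C' * X)) := e.trans e2
      _ ≤ l * (Real.sinh ρ ^ n * (C' * X)) := by gcongr
      _ = (C' * l) * (X * Real.sinh ρ ^ n) := by ring
      _ ≤ (c0 * E) * (X * Real.sinh ρ ^ n) := by gcongr
      _ ≤ (c0 * Real.exp (-((n:ℝ)/2*ρ))) * (X * Real.sinh ρ ^ n) := by
        have := hEρ h1L
        gcongr
      _ = _ := by ring
  rcases le_total ρ L with h2 | h2
  · calc Mass n u ρ t ≤ Mass n u L t := h.M_mono ht0 hρ.le h2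
      _ ≤ c0 * E * Real.sinh l ^ n * X := hcon.le
      _ ≤ c0 * Real.exp (-((n:ℝ)/2*ρ)) * Real.sinh ρ ^ n * X := by
        have := hEρ h2
        have := sinh_mono_pow n hl0.le h1
        gcongr
      _ = _ := by ring
  · have e1 : Real.exp (-((n:ℝ)*ρ)) ≤ E * Real.exp (-((n:ℝ)/2*ρ)) := by
      rw [hE, ← Real.exp_add]
      apply Real.exp_le_exp.2
      have : (n:ℝ)/2*L ≤ n/2*ρ := by gcongr
      linarith
    calc Mass n u ρ t ≤ C * X * (Real.exp (-((n:ℝ)*ρ)) * Real.sinh ρ ^ n) := hM t ht ρ hρ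
      _ ≤ C * X * (E * Real.exp (-((n:ℝ)/2*ρ)) * Real.sinh ρ ^ n) := by gcongr
      _ = (C * E) * (X * (Real.exp (-((n:ℝ)/2*ρ)) * Real.sinh ρ ^ n)) := by ring
      _ ≤ c0 * (X * (Real.exp (-((n:ℝ)/2*ρ)) * Real.sinh ρ ^ n)) := by gcongr
      _ = _ := by ring

theorem Ctx.lower (h : Ctx n m T u wr ut) (hms : ((n:ℝ) - 1)/(n+3) < m) {σ : ℝ}
    (hσ : σ ∈ Ioo 0 T) :
    ∃ c > 0, ∀ t ∈ Ico σ T, ∀ r, 0 < r →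
      c * (T-t)^(1/(1-m)) * Real.exp (-((n:ℝ)/m*r)) ≤ u r t := by
  have hm0 := h.hm0
  have hm1 := h.hm1
  have h1m : 0 < 1 - m := by linarith
  obtain ⟨L, hL, c, hc, hM⟩ := h.massL hms hσ
  obtain ⟨K, hK1, hK⟩ := h.am σ hσ
  have hK0 : 0 < K := by linarith
  set P := c * Real.exp (-((n:ℝ)*(L+1))) / K with hP
  have hP0 : 0 < P := by positivity
  refine ⟨P ^ (1/m), Real.rpow_pos_of_pos hP0 _, ?_⟩
  intro t ht r hr
  have ht0 : t ∈ Ioo 0 T := ⟨lt_of_lt_of_le hσ.1 ht.1, ht.2⟩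
  set k := 1/(1-m) with hk
  set θ := T - t with hθ
  have hθ0 : 0 < θ := by rw [hθ]; linarith [ht.2]
  have hkm : (k - 1) * (1/m) = k := by
    rw [hk]; field_simp; ring
  have e := h.estI hσ hK ht hr (by linarith : r ≤ r + L + 1)
  have hs := intervalIntegral.integral_add_adjacent_intervals
    (h.iMA ht0 hr (by linarith : 0 < r + L)) (h.iMA ht0 (by linarith : 0 < r + L)
      (by linarith : 0 < r + L + 1))
  have i1 : 0 ≤ ∫ ρ in r..(r+L), Mass n u ρ t / Real.sinh ρ ^ n := by
    apply intervalIntegral.integral_nonneg (by linarith)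
    intro x hx
    have : 0 ≤ x := hr.le.trans hx.1
    exact div_nonneg (h.M_nonneg ht0 this) (sinh_pow_nonneg n this)
  have i2 : c * θ ^ k * Real.exp (-((n:ℝ)*(r+L+1))) ≤
      ∫ ρ in (r+L)..(r+L+1), Mass n u ρ t / Real.sinh ρ ^ n := by
    have : ∫ ρ in (r+L)..(r+L+1), c * θ ^ k * Real.exp (-((n:ℝ)*(r+L+1))) ≤
        ∫ ρ in (r+L)..(r+L+1), Mass n u ρ t / Real.sinh ρ ^ n := by
      apply intervalIntegral.integral_mono_on (by linarith) intervalIntegrable_const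
        (h.iMA ht0 (by linarith : 0 < r + L) (by linarith : 0 < r + L + 1))
      intro x hx
      have hx0 : 0 < x := by linarith [hx.1]
      have hAx := sinh_pow_pos n hx0
      rw [le_div_iff₀ hAx]
      have hA : Real.sinh x ^ n ≤ Real.exp ((n:ℝ)*(r+L+1)) := by
        refine (sinh_pow_le n hx0.le).trans (Real.exp_le_exp.2 ?_)
        exact mul_le_mul_of_nonneg_left hx.2 (Nat.cast_nonneg n)
      have hee : Real.exp (-((n:ℝ)*(r+L+1))) * Real.exp ((n:ℝ)*(r+L+1)) = 1 := by
        rw [← Real.exp_add]; simp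
      calc c * θ ^ k * Real.exp (-((n:ℝ)*(r+L+1))) * Real.sinh x ^ n
          ≤ c * θ ^ k * Real.exp (-((n:ℝ)*(r+L+1))) * Real.exp ((n:ℝ)*(r+L+1)) := by gcongr
        _ = c * θ ^ k := by rw [mul_assoc, hee, mul_one]
        _ ≤ Mass n u L t := hM t ht
        _ ≤ _ := h.M_mono ht0 hL.le (by linarith [hx.1])
    rw [intervalIntegral.integral_const, smul_eq_mul] at this
    have e3 : r + L + 1 - (r + L) = 1 := by ring
    rw [e3, one_mul] at this
    exact this
  have hw : P * θ ^ (k-1) * Real.exp (-((n:ℝ)*r)) ≤ u r t ^ m := by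
    rw [← mul_le_mul_iff_right₀ (mul_pos hK0 hθ0)]
    refine le_trans (le_of_eq ?_) (i2.trans ((by linarith : _ ≤ _).trans e))
    rw [hP, Real.rpow_sub_one hθ0.ne']
    have : Real.exp (-((n:ℝ)*(r+L+1))) = Real.exp (-((n:ℝ)*(L+1))) * Real.exp (-((n:ℝ)*r)) := by
      rw [← Real.exp_add]; congr 1; ring
    rw [this]; field_simp
  have hup := h.sol.pos r hr.le t ht0
  calc P ^ (1/m) * θ ^ k * Real.exp (-((n:ℝ)/m*r))
      = (P * θ ^ (k-1) * Real.exp (-((n:ℝ)*r))) ^ (1/m) := by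
        rw [Real.mul_rpow (by positivity) (by positivity), Real.mul_rpow hP0.le (by positivity),
          ← Real.rpow_mul hθ0.le, hkm, ← Real.exp_mul]
        congr 2; ring
    _ ≤ (u r t ^ m) ^ (1/m) := Real.rpow_le_rpow (by positivity) hw (by positivity)
    _ = u r t := by
      rw [← Real.rpow_mul hup.le, mul_one_div_cancel hm0.ne', Real.rpow_one]

end
end GHP

/-- Global Harnack principle: two-sided separable bounds near the extinction time. -/
theorem global_harnack_principle
    (N : ℕ) (hN : 2 ≤ N) (m T : ℝ)
    (hm : m ∈ Set.Ioo (((N : ℝ) - 2) / ((N : ℝ) + 2)) 1) (hT : 0 < T)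
    (u : ℝ → ℝ → ℝ) (hu : IsRadialEnergySolution N m T u) :
    ∀ ε ∈ Set.Ioo (0:ℝ) T, ∃ c₁ > (0:ℝ), ∃ c₂ > (0:ℝ),
      ∀ r ∈ Set.Ici (0:ℝ), ∀ t ∈ Set.Ico ε T,
        c₁ * (1 - t / T) ^ (1 / (1 - m)) * Real.exp (-((N : ℝ) - 1) * r / m) ≤ u r t ∧
        u r t ≤ c₂ * (1 - t / T) ^ (1 / (1 - m)) * Real.exp (-((N : ℝ) - 1) * r / m) := by
  intro ε hε
  obtain ⟨n, rfl⟩ : ∃ n, N = n + 1 := ⟨N - 1, by omega⟩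
  have hn : 1 ≤ n := by omega
  have hn1 : (1:ℝ) ≤ n := by exact_mod_cast hn
  have hms : ((n:ℝ) - 1)/(n+3) < m := by
    have := hm.1
    push_cast at this
    have e : ((n:ℝ) + 1 - 2)/((n:ℝ) + 1 + 2) = ((n:ℝ) - 1)/(n+3) := by
      congr 1 <;> ring
    rwa [e] at this
  have hm0 : 0 < m := lt_of_le_of_lt (div_nonneg (by linarith) (by linarith)) hms
  obtain ⟨wr, ut, h⟩ := GHP.exists_ctx n hn m T hm0 hm.2 hT u hu
  obtain ⟨c, hc, hlow⟩ := h.lower hms hε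
  obtain ⟨C, hC, hup⟩ := (h.massn hms).2 ε hε
  have hTk : 0 < T ^ (1/(1-m)) := Real.rpow_pos_of_pos hT _
  refine ⟨c * T ^ (1/(1-m)), by positivity, C * T ^ (1/(1-m)), by positivity, ?_⟩
  intro r hr t ht
  have ht0 : t ∈ Set.Ioo 0 T := ⟨lt_of_lt_of_le hε.1 ht.1, ht.2⟩
  have hX : T ^ (1/(1-m)) * (1 - t/T) ^ (1/(1-m)) = (T - t) ^ (1/(1-m)) := by
    have : t/T ≤ 1 := by rw [div_le_one hT]; exact ht.2.le
    rw [← Real.mul_rpow hT.le (by linarith)]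
    congr 1; field_simp
  have hex : -(((n+1 : ℕ) : ℝ) - 1) * r / m = -((n:ℝ)/m*r) := by
    push_cast; ring
  rw [hex, mul_assoc c, mul_assoc C, hX]
  have hcu := GHP.slice_r h.sol.cu ht0
  constructor
  · exact GHP.ext_zero (f := fun r => c * (T - t) ^ (1/(1-m)) * Real.exp (-((n:ℝ)/m*r)))
      (g := fun r => u r t) (by fun_prop) hcu (fun r hr => hlow t ht r hr) r hr
  · exact GHP.ext_zero (f := fun r => u r t)
      (g := fun r => C * (T - t) ^ (1/(1-m)) * Real.exp (-((n:ℝ)/m*r)))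
      hcu (by fun_prop) (fun r hr => hup t ht r hr) r hr
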